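/- arXiv:2508.19617 — 3 statements merged into one kernel-verified Lean document; each statement's English description precedes it below -/
import Mathlib

section
/- Let G be a finite connected simple graph on at least 2 vertices that is not isomorphic to any graph of the exceptional family B, and define the demand function f_G : V(G) → [0,1] by f_G(v) = 4/5 if v has degree 1 and f_G(v) = 1 otherwise. Then G admits an f_G-dominating 2/5-colouring. -/
open Finset
open scoped Classical

/-- An `f`-dominating `r`-colouring of `G`: a finitely supported probability distribution `w`
over subsets of the vertices such that for every vertex `v`, the probability that the closed
neighbourhood of `v` meets the random set is at least `f v`, and the probability that `v`
belongs to the random set equals `r`. -/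
def IsFDomColouring {V : Type*} [Fintype V] [DecidableEq V]
    (G : SimpleGraph V) (f : V → ℝ) (r : ℝ) (w : Finset V → ℝ) : Prop :=
  (∀ D, 0 ≤ w D) ∧ (∑ D : Finset V, w D) = 1 ∧
    (∀ v : V, f v ≤ ∑ D ∈ Finset.univ.filter
        (fun D : Finset V => ∃ u ∈ D, u = v ∨ G.Adj u v), w D) ∧
    (∀ v : V, ∑ D ∈ Finset.univ.filter (fun D : Finset V => v ∈ D), w D = r)

/-- The 4-cycle `C₄`. -/
def badC4 : SimpleGraph (Fin 4) := SimpleGraph.fromRel (fun i j => j = i + 1)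

/-- The complete bipartite graph `K_{2,3}`. -/
def badK23 : SimpleGraph (Fin 2 ⊕ Fin 3) := completeBipartiteGraph (Fin 2) (Fin 3)

/-- Two 4-cycles sharing exactly one vertex. -/
def badTwoC4 : SimpleGraph (Fin 7) :=
  SimpleGraph.fromRel (fun i j =>
    (i, j) ∈ ([(0,1),(1,2),(2,3),(3,0),(0,4),(4,5),(5,6),(6,0)] : List (Fin 7 × Fin 7)))

/-- The 7-cycle `v0 v1 … v6` together with a list of chords. -/
def cyc7 (chords : List (Fin 7 × Fin 7)) : SimpleGraph (Fin 7) :=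
  SimpleGraph.fromRel (fun i j => j = i + 1 ∨ (i, j) ∈ chords)

/-- `G` is isomorphic to one of the eight exceptional graphs of the family `B`. -/
def InBadFamily {V : Type*} (G : SimpleGraph V) : Prop :=
  Nonempty (G ≃g badC4) ∨ Nonempty (G ≃g badK23) ∨ Nonempty (G ≃g cyc7 []) ∨
    Nonempty (G ≃g badTwoC4) ∨ Nonempty (G ≃g cyc7 [(2,5)]) ∨
    Nonempty (G ≃g cyc7 [(0,3),(0,4)]) ∨ Nonempty (G ≃g cyc7 [(1,5),(2,6)]) ∨
    Nonempty (G ≃g cyc7 [(1,5),(2,6),(2,5)])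

namespace FDom

/-- The adjacency test of the graph with edge list `E`. -/
def codeAdj (E : List (ℕ × ℕ)) (i j : ℕ) : Bool :=
  E.any fun e => (e.1 == i && e.2 == j) || (e.1 == j && e.2 == i)

lemma codeAdj_append (E F : List (ℕ × ℕ)) (i j : ℕ) :
    codeAdj (E ++ F) i j = (codeAdj E i j || codeAdj F i j) := by
  simp [codeAdj]

/-- `G` is isomorphic to the graph on `{0, …, n - 1}` with edge list `E`. -/
def HasCode {V : Type*} (G : SimpleGraph V) (n : ℕ) (E : List (ℕ × ℕ)) : Prop :=
  ∃ e : V ≃ Fin n, ∀ x y, G.Adj x y ↔ codeAdj E (e x) (e y) = true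

/-- Edge list of the 7-cycle. -/
def cycEdges : List (ℕ × ℕ) := [(0,1),(1,2),(2,3),(3,4),(4,5),(5,6),(6,0)]

/-- Orders and edge lists of the eight exceptional graphs. -/
def badCodes : List (ℕ × List (ℕ × ℕ)) :=
  [(4, [(0,1),(1,2),(2,3),(3,0)]), (5, [(0,2),(0,3),(0,4),(1,2),(1,3),(1,4)]), (7, cycEdges),
    (7, [(0,1),(1,2),(2,3),(3,0),(0,4),(4,5),(5,6),(6,0)]), (7, cycEdges ++ [(2,5)]),
    (7, cycEdges ++ [(0,3),(0,4)]), (7, cycEdges ++ [(1,5),(2,6)]),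
    (7, cycEdges ++ [(1,5),(2,6),(2,5)])]

lemma nonempty_iso_iff_hasCode {V W : Type*} (G : SimpleGraph V) (H : SimpleGraph W) {n : ℕ}
    {E : List (ℕ × ℕ)} (f : W ≃ Fin n) (hf : ∀ i j, H.Adj i j ↔ codeAdj E (f i) (f j) = true) :
    Nonempty (G ≃g H) ↔ HasCode G n E := by
  constructor
  · rintro ⟨φ⟩
    exact ⟨φ.toEquiv.trans f, fun x y => by
      rw [← φ.map_adj_iff, hf]; rfl⟩
  · rintro ⟨e, he⟩
    exact ⟨⟨e.trans f.symm, fun {x y} => by rw [hf, he]; simp⟩⟩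

lemma inBadFamily_iff {V : Type*} (G : SimpleGraph V) :
    InBadFamily G ↔ ∃ p ∈ badCodes, HasCode G p.1 p.2 := by
  have key : ∀ (chords : List (Fin 7 × Fin 7)) (E : List (ℕ × ℕ)),
      (∀ i j : Fin 7, (i ≠ j ∧ ((j = i + 1 ∨ (i, j) ∈ chords) ∨ (i = j + 1 ∨ (j, i) ∈ chords))) ↔
        codeAdj E i j = true) → (Nonempty (G ≃g cyc7 chords) ↔ HasCode G 7 E) := by
    intro chords E h
    exact nonempty_iso_iff_hasCode G _ (Equiv.refl _) fun i j => by
      simpa [cyc7, SimpleGraph.fromRel_adj] using h i j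
  unfold InBadFamily
  rw [nonempty_iso_iff_hasCode G badC4 (E := [(0,1),(1,2),(2,3),(3,0)]) (Equiv.refl _)
      (by simp only [badC4, SimpleGraph.fromRel_adj]; decide),
    nonempty_iso_iff_hasCode G badK23 (E := [(0,2),(0,3),(0,4),(1,2),(1,3),(1,4)])
      finSumFinEquiv (by simp only [badK23, completeBipartiteGraph_adj]; decide),
    nonempty_iso_iff_hasCode G badTwoC4
      (E := [(0,1),(1,2),(2,3),(3,0),(0,4),(4,5),(5,6),(6,0)]) (Equiv.refl _)
      (by simp only [badTwoC4, SimpleGraph.fromRel_adj]; decide),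
    key [] cycEdges (by decide), key [(2,5)] (cycEdges ++ [(2,5)]) (by decide),
    key [(0,3),(0,4)] (cycEdges ++ [(0,3),(0,4)]) (by decide),
    key [(1,5),(2,6)] (cycEdges ++ [(1,5),(2,6)]) (by decide),
    key [(1,5),(2,6),(2,5)] (cycEdges ++ [(1,5),(2,6),(2,5)]) (by decide)]
  simp only [badCodes, List.mem_cons, List.not_mem_nil, or_false, exists_eq_or_imp,
    exists_eq_left]

/-- Every colour occurs on the closed neighbourhood of `v`. -/
def Full {V κ : Type*} (G : SimpleGraph V) (A : V → Finset κ) (v : V) : Prop :=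
  ∀ c, ∃ u, (u = v ∨ G.Adj v u) ∧ c ∈ A u

/-- Either `v` is a leaf whose colours avoid those of its neighbour, or every colour occurs on the
closed neighbourhood of `v`. -/
def Sat {V κ : Type*} (G : SimpleGraph V) (A : V → Finset κ) (v : V) : Prop :=
  (∃ u, G.Adj v u ∧ (∀ w, G.Adj v w → w = u) ∧ Disjoint (A v) (A u)) ∨ Full G A v

/-- A colouring by `2 * m`-subsets of `5 * m` colours satisfying all vertices. -/
def Good {V : Type*} (G : SimpleGraph V) : Prop :=
  ∃ m, 0 < m ∧ ∃ A : V → Finset (Fin (5 * m)), (∀ v, #(A v) = 2 * m) ∧ ∀ v, Sat G A v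

/-- A colouring satisfying all vertices but the root `r`, which misses at most `2 * m` colours
unless it is isolated. -/
def RootedGood {V : Type*} (G : SimpleGraph V) (r : V) : Prop :=
  ∃ m, 0 < m ∧ ∃ (A : V → Finset (Fin (5 * m))) (M : Finset (Fin (5 * m))),
    (∀ v, #(A v) = 2 * m) ∧ #M = 2 * m ∧ Disjoint (A r) M ∧ (∀ v ≠ r, Sat G A v) ∧
      ((∀ w, ¬ G.Adj r w) ∨ ∀ c ∉ M, ∃ u, (u = r ∨ G.Adj r u) ∧ c ∈ A u)

lemma Full.congr_equiv {V κ κ' : Type*} {G : SimpleGraph V} {A : V → Finset κ} {B : V → Finset κ'}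
    (π : κ' → κ) (h : ∀ v c, c ∈ B v ↔ π c ∈ A v) {v : V} (hv : Full G A v) : Full G B v := by
  intro c
  obtain ⟨u, hu, hc⟩ := hv (π c)
  exact ⟨u, hu, (h u c).2 hc⟩

lemma Sat.congr_equiv {V κ κ' : Type*} {G : SimpleGraph V} {A : V → Finset κ} {B : V → Finset κ'}
    (π : κ' → κ) (h : ∀ v c, c ∈ B v ↔ π c ∈ A v) {v : V} (hv : Sat G A v) : Sat G B v := by
  rcases hv with ⟨u, hu, hw, hd⟩ | hv
  · refine Or.inl ⟨u, hu, hw, Finset.disjoint_left.2 fun c hc hc' => ?_⟩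
    exact Finset.disjoint_left.1 hd ((h _ _).1 hc) ((h _ _).1 hc')
  · exact Or.inr (hv.congr_equiv π h)

lemma good_of_full {V κ : Type*} [Fintype κ] (G : SimpleGraph V) (m : ℕ) (hm : 0 < m)
    (hκ : Fintype.card κ = 5 * m) (A : V → Finset κ) (hA : ∀ v, #(A v) ≤ 2 * m)
    (hfull : ∀ v, Full G A v) : Good G := by
  have hex : ∀ v, ∃ B : Finset κ, A v ⊆ B ∧ #B = 2 * m := fun v =>
    Finset.exists_superset_card_eq (hA v) (by omega)
  choose B hB hBc using hex
  let e : κ ≃ Fin (5 * m) := Fintype.equivFinOfCardEq hκ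
  refine ⟨m, hm, fun v => (B v).map e.toEmbedding, fun v => by simp [hBc], fun v => Or.inr ?_⟩
  intro c
  obtain ⟨u, hu, hc⟩ := hfull v (e.symm c)
  exact ⟨u, hu, Finset.mem_map.2 ⟨e.symm c, hB u hc, by simp⟩⟩

/-- The ten `2`-subsets of five colours, as bit masks. -/
def pairMask : List ℕ := [3, 5, 9, 17, 6, 10, 18, 12, 20, 24]

/-- The decimal digits of `c` encode a colouring by `2`-subsets of five colours. -/
def digitMem (c v k : ℕ) : Bool := (pairMask.getD (c / 10 ^ v % 10) 3).testBit k

/-- The closed neighbourhood of `v` as a bit mask. -/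
def row (E : List (ℕ × ℕ)) (v : ℕ) : ℕ :=
  E.foldr (fun e a => (bif e.1.beq v then 2 ^ e.2 else 0) ||| (bif e.2.beq v then 2 ^ e.1 else 0)
    ||| a) (2 ^ v)

/-- The vertices whose colour set contains `k`, as a bit mask. -/
def colourClass (n c k : ℕ) : ℕ :=
  (List.range n).foldr (fun u a => (bif digitMem c u k then 2 ^ u else 0) ||| a) 0

/-- The colour `k` occurs on the closed neighbourhood of `v`. -/
def covers (n : ℕ) (E : List (ℕ × ℕ)) (c v k : ℕ) : Bool :=
  !(row E v &&& colourClass n c k).beq 0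

lemma testBit_row {E : List (ℕ × ℕ)} {v u : ℕ} (h : (row E v).testBit u = true) :
    u = v ∨ codeAdj E v u = true := by
  induction E with
  | nil =>
    simp only [row, List.foldr_nil, Nat.testBit_two_pow, decide_eq_true_eq] at h
    exact Or.inl h.symm
  | cons e E ih =>
    rw [row, List.foldr_cons, ← row] at h
    simp only [Nat.testBit_or, Bool.or_eq_true] at h
    simp only [codeAdj, List.any_cons, Bool.or_eq_true, Bool.and_eq_true, beq_iff_eq] at ih ⊢
    rcases h with (h | h) | h
    · rcases hb : e.1.beq v with _ | _
      · simp [hb] at h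
      · simp only [hb, cond_true, Nat.testBit_two_pow, decide_eq_true_eq] at h
        exact Or.inr (Or.inl (Or.inl ⟨Nat.eq_of_beq_eq_true hb, h⟩))
    · rcases hb : e.2.beq v with _ | _
      · simp [hb] at h
      · simp only [hb, cond_true, Nat.testBit_two_pow, decide_eq_true_eq] at h
        exact Or.inr (Or.inl (Or.inr ⟨h, Nat.eq_of_beq_eq_true hb⟩))
    · exact (ih h).imp_right Or.inr

lemma testBit_colourClass {n c k u : ℕ} (h : (colourClass n c k).testBit u = true) :
    u < n ∧ digitMem c u k = true := by
  have key : ∀ l : List ℕ, (l.foldr (fun u a => (bif digitMem c u k then 2 ^ u else 0) ||| a)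
      0).testBit u = true → u ∈ l ∧ digitMem c u k = true := by
    intro l
    induction l with
    | nil => simp
    | cons w l ih =>
      intro h
      simp only [List.foldr_cons, Nat.testBit_or, Bool.or_eq_true] at h
      rcases h with h | h
      · rcases hb : digitMem c w k with _ | _
        · simp [hb] at h
        · simp only [hb, cond_true, Nat.testBit_two_pow, decide_eq_true_eq] at h
          subst h
          exact ⟨List.mem_cons_self, hb⟩
      · exact ⟨List.mem_cons_of_mem _ (ih h).1, (ih h).2⟩
  simpa using key _ h

lemma exists_of_covers_eq_true {n : ℕ} {E : List (ℕ × ℕ)} {c v k : ℕ}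
    (h : covers n E c v k = true) :
    ∃ u < n, digitMem c u k = true ∧ (u = v ∨ codeAdj E v u = true) := by
  have h0 : row E v &&& colourClass n c k ≠ 0 := by
    intro h0
    simp [covers, h0] at h
  obtain ⟨u, hu⟩ := Nat.exists_testBit_of_ne_zero h0
  rw [Nat.testBit_and, Bool.and_eq_true] at hu
  obtain ⟨hn, hd⟩ := testBit_colourClass hu.2
  exact ⟨u, hn, hd, testBit_row hu.1⟩

/-- The colouring encoded by `c` satisfies all vertices. -/
def checkGood (n : ℕ) (E : List (ℕ × ℕ)) (c : ℕ) : Bool :=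
  (List.range n).all fun v => (List.range 5).all fun k => covers n E c v k

/-- The colouring encoded by `c` satisfies all vertices but `r`, which misses at most two
colours. -/
def checkRooted (n : ℕ) (E : List (ℕ × ℕ)) (r c : ℕ) : Bool :=
  ((List.range n).all fun v => v == r || (List.range 5).all fun k => covers n E c v k) &&
    decide (3 ≤ #{k ∈ range 5 | covers n E c r k = true ∨ digitMem c r k = true})

/-- The digits of `s` encode an isomorphism between two edge lists. -/
def checkIso (n : ℕ) (E F : List (ℕ × ℕ)) (s : ℕ) : Bool :=
  ((List.range n).all fun i => decide (s / 10 ^ i % 10 < n) &&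
      (List.range n).all fun j => (i == j || s / 10 ^ i % 10 != s / 10 ^ j % 10)) &&
  (List.range n).all fun i => (List.range n).all fun j =>
    codeAdj E i j == codeAdj F (s / 10 ^ i % 10) (s / 10 ^ j % 10)

/-- One of the colourings in `cs` is satisfying, or one of the maps in `ss` is an isomorphism to
an exceptional graph. -/
def checkCode (cs ss : List ℕ) (n : ℕ) (E : List (ℕ × ℕ)) : Bool :=
  (cs.any fun c => checkGood n E c) ||
    badCodes.any fun p => p.1 == n && ss.any fun s => checkIso n E p.2 s

/-- The set of colours of a vertex in the colouring encoded by `c`. -/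
def digitSet (c v : ℕ) : Finset (Fin (5 * 1)) := {k | digitMem c v k = true}

lemma card_digitSet (c v : ℕ) : #(digitSet c v) = 2 * 1 := by
  have h : ∀ d < 10, #{k : Fin (5 * 1) | (pairMask.getD d 3).testBit k = true} = 2 * 1 := by
    decide
  exact h _ (Nat.mod_lt _ (by norm_num))

lemma exists_of_covers {V : Type*} {G : SimpleGraph V} {n : ℕ} {E : List (ℕ × ℕ)} (e : V ≃ Fin n)
    (he : ∀ x y, G.Adj x y ↔ codeAdj E (e x) (e y) = true) {c : ℕ} {v : V} {k : Fin (5 * 1)}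
    (h : covers n E c (e v) k = true) :
    ∃ u, (u = v ∨ G.Adj v u) ∧ k ∈ digitSet c (e u) := by
  obtain ⟨u, hu, hk, hadj⟩ := exists_of_covers_eq_true h
  refine ⟨e.symm ⟨u, hu⟩, ?_, by simpa [digitSet] using hk⟩
  rw [he]
  simp only [Equiv.apply_symm_apply]
  refine hadj.imp_left fun h => ?_
  rw [Equiv.symm_apply_eq]
  exact Fin.ext h

lemma good_of_checkGood {V : Type*} {G : SimpleGraph V} {n : ℕ} {E : List (ℕ × ℕ)}
    (hG : HasCode G n E) {c : ℕ} (h : checkGood n E c = true) : Good G := by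
  obtain ⟨e, he⟩ := hG
  simp only [checkGood, List.all_eq_true, List.mem_range] at h
  exact ⟨1, one_pos, fun v => digitSet c (e v), fun v => card_digitSet _ _, fun v => Or.inr
    fun k => exists_of_covers e he (h _ (e v).2 _ k.2)⟩

lemma rootedGood_of_checkRooted {V : Type*} {G : SimpleGraph V} {n : ℕ} {E : List (ℕ × ℕ)}
    (e : V ≃ Fin n) (he : ∀ x y, G.Adj x y ↔ codeAdj E (e x) (e y) = true) {c : ℕ} {r : V}
    (h : checkRooted n E (e r) c = true) : RootedGood G r := by
  simp only [checkRooted, Bool.and_eq_true, List.all_eq_true, List.mem_range, Bool.or_eq_true,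
    beq_iff_eq, decide_eq_true_eq] at h
  obtain ⟨h₁, h₂⟩ := h
  let C : Finset (Fin (5 * 1)) := {k | covers n E c (e r) k = true ∨ digitMem c (e r) k = true}
  have hC : 3 ≤ #C := by
    refine h₂.trans ?_
    rw [← Finset.card_map Fin.valEmbedding (s := C)]
    refine Finset.card_le_card fun k hk => ?_
    simp only [Finset.mem_filter, Finset.mem_range] at hk
    exact Finset.mem_map.2 ⟨⟨k, hk.1⟩, by simpa [C] using hk.2, rfl⟩
  have hsub : digitSet c (e r) ⊆ C := fun k hk => by
    simp only [digitSet, Finset.mem_filter, Finset.mem_univ, true_and] at hk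
    simp [C, hk]
  obtain ⟨M, hM, hMA, hMc⟩ := Finset.exists_subsuperset_card_eq (n := 2 * 1)
    (Finset.compl_subset_compl.2 hsub) (by rw [Finset.card_compl, Fintype.card_fin]; omega)
    (by rw [Finset.card_compl, Fintype.card_fin, card_digitSet]; omega)
  refine ⟨1, one_pos, fun v => digitSet c (e v), M, fun v => card_digitSet _ _, hMc,
    Finset.disjoint_left.2 fun k hk hk' => (Finset.mem_compl.1 (hMA hk')) hk, fun v hv => Or.inr
    fun k => exists_of_covers e he ((h₁ _ (e v).2).resolve_left (fun h => hv (e.injective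
      (Fin.ext h))) _ k.2), Or.inr fun k hk => ?_⟩
  have hkC : k ∈ C := by
    by_contra hkC
    exact hk (hM (Finset.mem_compl.2 hkC))
  simp only [C, Finset.mem_filter, Finset.mem_univ, true_and] at hkC
  rcases hkC with hkC | hkC
  · exact exists_of_covers e he hkC
  · exact ⟨r, Or.inl rfl, by simpa [digitSet] using hkC⟩

lemma good_or_bad_of_checkCode {V : Type*} {G : SimpleGraph V} {n : ℕ} {E : List (ℕ × ℕ)}
    {cs ss : List ℕ} (hG : HasCode G n E) (h : checkCode cs ss n E = true) :
    Good G ∨ InBadFamily G := by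
  simp only [checkCode, Bool.or_eq_true, List.any_eq_true, Bool.and_eq_true, beq_iff_eq] at h
  rcases h with ⟨c, -, hc⟩ | ⟨⟨m, F⟩, hp, rfl, s, -, hs⟩
  · exact Or.inl (good_of_checkGood hG hc)
  · refine Or.inr ((inBadFamily_iff G).2 ⟨_, hp, ?_⟩)
    simp only [checkIso, Bool.and_eq_true, List.all_eq_true, List.mem_range, Bool.or_eq_true,
      decide_eq_true_eq, beq_iff_eq, bne_iff_ne] at hs
    obtain ⟨h₁, h₂⟩ := hs
    obtain ⟨e, he⟩ := hG
    let f : Fin m → Fin m := fun i => ⟨s / 10 ^ (i : ℕ) % 10, (h₁ i i.2).1⟩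
    have hf : Function.Injective f := fun i j hij => Fin.ext
      (((h₁ i i.2).2 j j.2).resolve_right (not_not.2 (congrArg Fin.val hij)))
    refine ⟨e.trans (Equiv.ofBijective f (Finite.injective_iff_bijective.1 hf)), fun x y => ?_⟩
    rw [he, h₂ _ (e x).2 _ (e y).2]
    rfl

/-- Colourings satisfying all vertices of an exceptional graph but one. -/
def rootCols : List ℕ := [
  4910190, 4914910, 9104910, 9409101, 4091019, 4019019, 491091, 4910, 9401, 4019, 491, 41190,
  41109, 98070, 90870, 9870, 4919100, 6151019, 1016159, 376730]

/-- Colourings of exceptional graphs with an added edge. -/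
def chordCols : List ℕ := [
  7306730, 6730370, 1940910, 9019010, 7673700, 4919190, 9449370, 97080, 9026810, 9901010, 9190,
  9010, 99910, 70980, 9194910, 9497370, 9437910, 970890]

/-- Isomorphisms between an exceptional graph with an added edge and another one. -/
def chordIsos : List ℕ := [
  654321, 1065432, 2106543, 2345601, 3456012, 4560123, 4561230, 4563210, 6541230, 6543210]

/-- Colourings of exceptional graphs with an added vertex of degree two. -/
def twinCols : List ℕ := [
  76370370, 99140910, 95824910, 84910790, 49807910, 49516910, 99419010, 9780910, 79804910,
  76734910, 94919100, 99410, 76370, 874190, 999140, 991940, 70894910, 919940, 991010, 919010,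
  190190, 99414910, 96737800, 9821910]

/-- Isomorphisms from the 4-cycle with an added vertex of degree two. -/
def twinIsos : List ℕ := [
  41302, 43120]

/-- Colourings of exceptional graphs with an added path through three new vertices. -/
def earCols : List ℕ := [
  6739704910, 6249824910, 4379805910, 8246910970, 8539708510, 6159807910, 5828534910, 1699709410,
  199104910, 9109104910, 191940910, 8074910990, 3765824910, 4359734910, 5349824910, 8909704910,
  9101940910, 9409419010, 7346735910, 67374190, 61587190, 43785190, 6735828700, 9156824910,
  67398070, 89098070, 80794190, 9898070, 985828700, 8905828700, 6156737910, 191910, 1099010,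
  9101910, 9019010, 1911190, 9874190, 91011190, 34979010, 16790190, 89074190, 94379010, 76190190,
  194911910, 191914910, 3765828700, 9104911910, 4376735910, 9101914910]

/-- Isomorphisms from small graphs with an added path through three new vertices. -/
def earIsos : List ℕ := [
  3210, 1062543, 1063452, 1064523, 1065432, 6012543, 6013452, 6014523, 6015432, 6540321, 6542301,
  6543012, 6543210]

/-- Colourings of exceptional graphs with an edge subdivided three times. -/
def subdivCols : List ℕ := [
  8079904910, 8074910990, 3769424910, 8629424910, 6159419910, 3762854910, 3765821940, 891940970,
  897904910, 9801940970, 9807904910, 5349824910, 4359824910, 80749190, 80794190, 8941790,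
  8947190, 8974190, 95195180, 98041790, 15995180, 98047190, 98074190, 2496735810, 9516735810,
  8246735910, 5186735910, 3586724910]

/-- Isomorphisms from the 4-cycle with an edge subdivided three times to the 7-cycle. -/
def subdivIsos : List ℕ := [
  2346510, 3456210, 4326510, 4561230, 4563210, 5436210, 6541230, 6543210]

/-- The edges added by a path from `i` to `j` through the new vertices `n`, `n + 1`, `n + 2`. -/
def earEdges (n i j : ℕ) : List (ℕ × ℕ) := [(i, n), (n, n + 1), (n + 1, n + 2), (n + 2, j)]

/-- The degree of `i` in the graph with edge list `E`. -/
def codeDeg (n : ℕ) (E : List (ℕ × ℕ)) (i : ℕ) : ℕ :=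
  ((List.range n).filter fun j => codeAdj E i j).length

lemma check_root : ∀ p ∈ badCodes, ∀ r < p.1,
    (rootCols.any fun c => checkRooted p.1 p.2 r c) = true := by
  decide +kernel

lemma check_chord : ∀ p ∈ badCodes, ∀ i < p.1, ∀ j < p.1, i ≠ j → codeAdj p.2 i j = false →
    checkCode chordCols chordIsos p.1 (p.2 ++ [(i, j)]) = true := by
  decide +kernel

lemma check_twin : ∀ p ∈ badCodes, ∀ i < p.1, ∀ j < p.1, i ≠ j →
    checkCode twinCols twinIsos (p.1 + 1) (p.2 ++ [(i, p.1), (j, p.1)]) = true := by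
  decide +kernel

lemma check_ear : ∀ p ∈ (1, []) :: badCodes, ∀ i < p.1, ∀ j < p.1,
    checkCode earCols earIsos (p.1 + 3) (p.2 ++ earEdges p.1 i j) = true := by
  decide +kernel

lemma check_subdiv : ∀ p ∈ badCodes, ∀ i < p.1, ∀ j < p.1, codeAdj p.2 i j = true →
    checkCode subdivCols subdivIsos (p.1 + 3)
      ((p.2.filter fun e => !codeAdj [(i, j)] e.1 e.2) ++ earEdges p.1 i j) = true := by
  decide +kernel

lemma check_contract : ∀ p ∈ badCodes, ∀ w < p.1, 4 ≤ codeDeg p.1 p.2 w →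
    (∃ i < p.1, ∃ j < p.1, codeAdj p.2 i j = true ∧ 3 ≤ codeDeg p.1 p.2 i ∧
      3 ≤ codeDeg p.1 p.2 j) ∨
    ∃ a < p.1, ∃ b < p.1, ∃ c < p.1, a ≠ c ∧ codeAdj p.2 a b = true ∧ codeAdj p.2 b c = true ∧
      codeDeg p.1 p.2 a ≤ 2 ∧ codeDeg p.1 p.2 b ≤ 2 ∧ codeDeg p.1 p.2 c ≤ 2 := by
  decide +kernel

/-- All connected graphs on fewer than `n` vertices satisfy the dichotomy. -/
def GoodBelow.{u} (n : ℕ) : Prop :=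
  ∀ (W : Type u) [Fintype W] (H : SimpleGraph W), Fintype.card W < n → H.Connected →
    2 ≤ Fintype.card W → Good H ∨ InBadFamily H

lemma connected_of_map {V W : Type*} {G : SimpleGraph V} {H : SimpleGraph W} (hG : G.Connected)
    (f : V → W) (hf : Function.Surjective f)
    (h : ∀ x y, G.Adj x y → f x = f y ∨ H.Adj (f x) (f y)) : H.Connected := by
  have key : ∀ x y, G.Reachable x y → H.Reachable (f x) (f y) := by
    rintro x y ⟨p⟩
    induction p with
    | nil => exact SimpleGraph.Reachable.refl _
    | cons hxy _ ih =>
      rcases h _ _ hxy with h | h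
      · rwa [h]
      · exact h.reachable.trans ih
  have := hG.nonempty.map f
  refine SimpleGraph.Connected.mk fun x y => ?_
  obtain ⟨x, rfl⟩ := hf x
  obtain ⟨y, rfl⟩ := hf y
  exact key _ _ (hG.preconnected x y)

lemma mem_of_closed {V : Type*} {G : SimpleGraph V} (hG : G.Connected) (S : Set V) {x : V}
    (hx : x ∈ S) (h : ∀ v w, v ∈ S → G.Adj v w → w ∈ S) (y : V) : y ∈ S := by
  obtain ⟨p⟩ := hG.preconnected x y
  induction p with
  | nil => exact hx
  | cons hxy _ ih => exact ih (h _ _ hx hxy)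

lemma exists_projection (m k : ℕ) : ∃ π : Fin (5 * (m * k)) → Fin (5 * m),
    ∀ S : Finset (Fin (5 * m)), #{c | π c ∈ S} = #S * k := by
  let e : Fin (5 * (m * k)) ≃ Fin (5 * m) × Fin k := Fintype.equivOfCardEq (by simp [mul_assoc])
  refine ⟨fun c => (e c).1, fun S => ?_⟩
  have h := Finset.card_product S (univ : Finset (Fin k))
  rw [Finset.card_univ, Fintype.card_fin] at h
  rw [← h, ← Finset.card_map e.toEmbedding]
  congr 1
  ext ⟨a, b⟩
  simp only [mem_map, mem_filter, mem_univ, true_and, Equiv.coe_toEmbedding, mem_product,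
    and_true]
  exact ⟨fun ⟨c, hc, hcab⟩ => by simpa [hcab] using hc, fun h => ⟨e.symm (a, b), by simpa, by simp⟩⟩

lemma exists_equiv_of_disjoint {κ : Type*} [Fintype κ] {A B C D : Finset κ} (hAC : Disjoint A C)
    (hBD : Disjoint B D) (hAB : #A = #B) (hCD : #C = #D) :
    ∃ σ : κ ≃ κ, (∀ c, σ c ∈ B ↔ c ∈ A) ∧ ∀ c, σ c ∈ D ↔ c ∈ C := by
  let f (S T : Finset κ) (c : κ) : Fin 3 := if c ∈ S then 0 else if c ∈ T then 1 else 2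
  have h0 : ∀ (S T : Finset κ) c, f S T c = 0 ↔ c ∈ S := by
    intro S T c; simp only [f]; split_ifs <;> simp_all
  have h1 : ∀ (S T : Finset κ), Disjoint S T → ∀ c, f S T c = 1 ↔ c ∈ T := by
    intro S T h c
    have : c ∈ S → c ∉ T := fun h' => Finset.disjoint_left.1 h h'
    simp only [f]; split_ifs <;> simp_all
  have h2 : ∀ (S T : Finset κ), ∀ c, f S T c = 2 ↔ c ∈ (S ∪ T)ᶜ := by
    intro S T c
    simp only [f]; split_ifs <;> simp_all
  have hc : ∀ i, Nonempty ({c // f A C c = i} ≃ {c // f B D c = i}) := by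
    intro i
    rw [← Fintype.card_eq]
    fin_cases i
    · simpa [h0, Fintype.card_subtype] using hAB
    · simpa [h1 _ _ hAC, h1 _ _ hBD, Fintype.card_subtype] using hCD
    · have : #((A ∪ C)ᶜ) = #((B ∪ D)ᶜ) := by
        rw [card_compl, card_compl, card_union_of_disjoint hAC, card_union_of_disjoint hBD, hAB,
          hCD]
      simpa only [Fin.reduceFinMk, h2, Fintype.card_coe] using this
  have key : ∀ c, f B D (Equiv.ofFiberEquiv (f := f A C) (g := f B D) (fun i => (hc i).some) c)
      = f A C c := fun c => Equiv.ofFiberEquiv_map _ _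
  refine ⟨Equiv.ofFiberEquiv (f := f A C) (g := f B D) fun i => (hc i).some, fun c => ?_,
    fun c => ?_⟩
  · rw [← h0 B D, key, h0]
  · rw [← h1 B D hBD, key, h1 _ _ hAC]

lemma rootedGood_of_good {V : Type*} {G : SimpleGraph V} (hG : Good G) (r : V) :
    RootedGood G r := by
  obtain ⟨m, hm, A, hA, hs⟩ := hG
  have hex : ∃ T : Finset (Fin (5 * m)), A r ⊆ T ∧ 3 * m ≤ #T ∧
      ((∀ w, ¬ G.Adj r w) ∨ ∀ c ∈ T, ∃ u, (u = r ∨ G.Adj r u) ∧ c ∈ A u) := by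
    rcases hs r with ⟨u, hu, -, hd⟩ | hf
    · refine ⟨A r ∪ A u, subset_union_left, ?_, Or.inr fun c hc => ?_⟩
      · rw [card_union_of_disjoint hd, hA, hA]; omega
      · rcases mem_union.1 hc with hc | hc
        · exact ⟨r, Or.inl rfl, hc⟩
        · exact ⟨u, Or.inr hu, hc⟩
    · exact ⟨univ, subset_univ _, by simp; omega, Or.inr fun c _ => hf c⟩
  obtain ⟨T, hAT, hT, h⟩ := hex
  obtain ⟨M, hTM, hMA, hM⟩ := Finset.exists_subsuperset_card_eq (n := 2 * m)
    (Finset.compl_subset_compl.2 hAT) (by rw [Finset.card_compl, Fintype.card_fin]; omega)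
    (by rw [Finset.card_compl, Fintype.card_fin, hA]; omega)
  refine ⟨m, hm, A, M, hA, hM, ?_, fun v _ => hs v, h.imp_right fun h c hc => h c ?_⟩
  · exact Finset.disjoint_left.2 fun c hc hc' => (mem_compl.1 (hMA hc')) hc
  · by_contra hcT
    exact hc (hTM (mem_compl.2 hcT))

lemma rootedGood_of_goodBelow.{u} {n : ℕ} (hn : GoodBelow.{u} n) {W : Type u} [Fintype W]
    {H : SimpleGraph W} (hH : H.Connected) (hW : Fintype.card W < n) (r : W) :
    RootedGood H r := by
  rcases Nat.lt_or_ge (Fintype.card W) 2 with h1 | h2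
  · have : Subsingleton W := Fintype.card_le_one_iff_subsingleton.1 (by omega)
    refine ⟨1, one_pos, fun _ => {0, 1}, {2, 3}, by simp, by decide,
      (by decide : Disjoint ({0, 1} : Finset (Fin 5)) {2, 3}),
      fun v hv => absurd (Subsingleton.elim _ _) hv, Or.inl fun w hw => hw.ne
        (Subsingleton.elim _ _)⟩
  · rcases hn W H hW hH h2 with h | h
    · exact rootedGood_of_good h r
    · obtain ⟨p, hp, e, he⟩ := (inBadFamily_iff H).1 h
      obtain ⟨c, -, hc⟩ := List.any_eq_true.1 (check_root p hp (e r) (e r).2)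
      exact rootedGood_of_checkRooted e he hc

/-- The data of `RootedGood` with a prescribed number of colours, for one component `S` of a graph
with an edge at `x` removed. -/
def HalfGood {V : Type*} (G H : SimpleGraph V) (S : Set V) (x : V) (m : ℕ) : Prop :=
  ∃ (A : V → Finset (Fin (5 * m))) (M : Finset (Fin (5 * m))),
    (∀ v, #(A v) = 2 * m) ∧ #M = 2 * m ∧ Disjoint (A x) M ∧ (∀ v ∈ S, v ≠ x → Sat G A v) ∧
      ((∀ w, ¬ H.Adj x w) ∨ ∀ c ∉ M, ∃ u, (u = x ∨ H.Adj x u) ∧ c ∈ A u)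

lemma HalfGood.mul {V : Type*} {G H : SimpleGraph V} {S : Set V} {x : V} {m : ℕ}
    (h : HalfGood G H S x m) (k : ℕ) : HalfGood G H S x (m * k) := by
  obtain ⟨A, M, hA, hM, hd, hs, hr⟩ := h
  obtain ⟨π, hπ⟩ := exists_projection m k
  refine ⟨fun v => {c | π c ∈ A v}, ({c | π c ∈ M} : Finset _), fun v => by rw [hπ, hA, mul_assoc],
    by rw [hπ, hM, mul_assoc], Finset.disjoint_left.2 fun c hc hc' => ?_,
    fun v hv hvx => (hs v hv hvx).congr_equiv π (by simp), hr.imp_right fun h c hc => ?_⟩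
  · exact Finset.disjoint_left.1 hd (by simpa using hc) (by simpa using hc')
  · obtain ⟨u, hu, hcu⟩ := h (π c) (by simpa using hc)
    exact ⟨u, hu, by simpa using hcu⟩

lemma exists_halfGood.{u} {V : Type u} [Fintype V] {G : SimpleGraph V}
    (hn : GoodBelow.{u} (Fintype.card V)) {x y : V}
    (hr : ¬ (G.deleteEdges {s(x, y)}).Reachable x y) :
    ∃ m, 0 < m ∧ HalfGood G (G.deleteEdges {s(x, y)})
      {v | (G.deleteEdges {s(x, y)}).Reachable x v} x m := by
  set H := G.deleteEdges {s(x, y)} with hH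
  set S : Set V := {v | H.Reachable x v} with hS
  have hx : x ∈ S := SimpleGraph.Reachable.refl x
  have hconn : (H.induce S).Connected := by
    have : S = (H.connectedComponentMk x).supp := by
      ext v
      simp only [hS, Set.mem_ofPred_eq, SimpleGraph.ConnectedComponent.mem_supp_iff,
        SimpleGraph.ConnectedComponent.eq]
      exact ⟨fun h => h.symm, fun h => h.symm⟩
    rw [this]
    exact SimpleGraph.ConnectedComponent.connected_toSimpleGraph _
  have hcard : Fintype.card S < Fintype.card V := Fintype.card_subtype_lt (x := y) hr
  obtain ⟨m, hm, A, M, hA, hM, hd, hs, hroot⟩ := rootedGood_of_goodBelow hn hconn hcard ⟨x, hx⟩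
  have hout : ∀ v ∈ S, v ≠ x → ∀ w, G.Adj v w ↔ ∃ hw : w ∈ S, H.Adj v w := by
    intro v hv hvx w
    constructor
    · intro hvw
      have : H.Adj v w := by
        rw [hH, SimpleGraph.deleteEdges_adj]
        refine ⟨hvw, fun h => ?_⟩
        rcases Sym2.eq_iff.1 (Set.mem_singleton_iff.1 h) with ⟨h, -⟩ | ⟨h, -⟩
        · exact hvx h
        · exact hr (h ▸ hv)
      exact ⟨(show H.Reachable x v from hv).trans this.reachable, this⟩
    · rintro ⟨-, h⟩
      exact (SimpleGraph.deleteEdges_adj.1 h).1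
  let B : V → Finset (Fin (5 * m)) := fun v => if h : v ∈ S then A ⟨v, h⟩ else M
  have hB : ∀ v : S, B v = A v := fun v => by simp [B]
  refine ⟨m, hm, B, M, fun v => ?_, hM, by rw [hB ⟨x, hx⟩]; exact hd, fun v hv hvx => ?_, ?_⟩
  · by_cases hv : v ∈ S
    · rw [hB ⟨v, hv⟩, hA]
    · simp [B, hv, hM]
  · rcases hs ⟨v, hv⟩ (fun h => hvx (congrArg Subtype.val h)) with ⟨u, hu, hw, hd⟩ | hf
    · refine Or.inl ⟨u, (hout v hv hvx _).2 ⟨u.2, hu⟩, fun w hvw => ?_, ?_⟩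
      · obtain ⟨hwS, hvw⟩ := (hout v hv hvx _).1 hvw
        exact congrArg Subtype.val (hw ⟨w, hwS⟩ hvw)
      · rw [hB, hB ⟨v, hv⟩]; exact hd
    · refine Or.inr fun c => ?_
      obtain ⟨u, hu, hc⟩ := hf c
      refine ⟨u, hu.imp (congrArg Subtype.val) fun h => (hout v hv hvx _).2 ⟨u.2, h⟩, ?_⟩
      rwa [hB]
  · refine hroot.imp (fun h w hw => h ⟨w, hw.reachable⟩ hw) fun h c hc => ?_
    obtain ⟨u, hu, hc⟩ := h c hc
    exact ⟨u, hu.imp (congrArg Subtype.val) id, by rwa [hB]⟩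

lemma good_of_bridge.{u} {V : Type u} [Fintype V] {G : SimpleGraph V}
    (hn : GoodBelow.{u} (Fintype.card V)) (hG : G.Connected) {x y : V} (hxy : G.Adj x y)
    (hr : ¬ (G.deleteEdges {s(x, y)}).Reachable x y) : Good G := by
  obtain ⟨m₁, hm₁, h₁⟩ := exists_halfGood hn hr
  have hr' : ¬ (G.deleteEdges {s(y, x)}).Reachable y x := by
    rw [Sym2.eq_swap]; exact fun h => hr h.symm
  obtain ⟨m₂, hm₂, h₂⟩ := exists_halfGood hn hr'
  rw [Sym2.eq_swap] at h₂
  set H := G.deleteEdges {s(x, y)} with hH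
  replace h₁ := h₁.mul m₂
  replace h₂ := h₂.mul m₁
  rw [mul_comm m₂ m₁] at h₂
  have hm : 0 < m₁ * m₂ := Nat.mul_pos hm₁ hm₂
  set m := m₁ * m₂
  obtain ⟨A, M, hA, hM, hd, hs, hx⟩ := h₁
  obtain ⟨B, N, hB, hN, hd', hs', hy⟩ := h₂
  obtain ⟨σ, hσ₁, hσ₂⟩ := exists_equiv_of_disjoint (A := M) (B := B y) (C := A x) (D := N)
    hd.symm hd' (by rw [hM, hB]) (by rw [hA, hN])
  have hadj : ∀ v w, G.Adj v w → H.Adj v w ∨ (v = x ∧ w = y) ∨ (v = y ∧ w = x) := by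
    intro v w hvw
    by_cases h : s(v, w) = s(x, y)
    · exact Or.inr (Sym2.eq_iff.1 h)
    · exact Or.inl (SimpleGraph.deleteEdges_adj.2 ⟨hvw, h⟩)
  have hHG : ∀ v w, H.Adj v w → G.Adj v w := fun v w h => (SimpleGraph.deleteEdges_adj.1 h).1
  have hcover : ∀ v, H.Reachable x v ∨ H.Reachable y v := by
    refine mem_of_closed hG {v | H.Reachable x v ∨ H.Reachable y v} (x := x)
      (Or.inl (SimpleGraph.Reachable.refl x)) fun v w hv hvw => ?_
    rcases hadj v w hvw with h | ⟨-, rfl⟩ | ⟨-, rfl⟩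
    · exact hv.imp (fun h' => h'.trans h.reachable) fun h' => h'.trans h.reachable
    · exact Or.inr (SimpleGraph.Reachable.refl _)
    · exact Or.inl (SimpleGraph.Reachable.refl _)
  have hnot : ∀ v, H.Reachable y v → ¬ H.Reachable x v := fun v h h' => hr (h'.trans h.symm)
  let C : V → Finset (Fin (5 * m)) := fun v =>
    if H.Reachable x v then A v else ({c | σ c ∈ B v} : Finset _)
  have hC₁ : ∀ v, H.Reachable x v → C v = A v := fun v h => by simp only [C, if_pos h]
  have hC₂ : ∀ v, H.Reachable y v → ∀ c, c ∈ C v ↔ σ c ∈ B v := fun v h c => by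
    simp only [C, if_neg (hnot v h), mem_filter, mem_univ, true_and]
  have hCA : ∀ v w, H.Reachable x v → (w = v ∨ H.Adj v w) → C w = A w := by
    rintro v w hv (rfl | h)
    · exact hC₁ _ hv
    · exact hC₁ _ (hv.trans h.reachable)
  have hCB : ∀ v w, H.Reachable y v → (w = v ∨ H.Adj v w) → ∀ c, c ∈ C w ↔ σ c ∈ B w := by
    rintro v w hv (rfl | h)
    · exact hC₂ _ hv
    · exact hC₂ _ (hv.trans h.reachable)
  have hCx : C x = A x := hC₁ x (SimpleGraph.Reachable.refl x)
  have hCy : ∀ c, c ∈ C y ↔ c ∈ M := fun c => by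
    rw [hC₂ y (SimpleGraph.Reachable.refl y), hσ₁]
  have hnbr : ∀ v w, v ≠ x → v ≠ y → G.Adj v w → H.Adj v w := by
    intro v w hvx hvy hvw
    rcases hadj v w hvw with h | h | h
    · exact h
    · exact absurd h.1 hvx
    · exact absurd h.1 hvy
  refine ⟨m, hm, C, fun v => ?_, fun v => ?_⟩
  · by_cases h : H.Reachable x v
    · rw [hC₁ v h, hA]
    · rw [← hB v]
      exact Finset.card_bijective σ σ.bijective fun c => by simp [C, h]
  · by_cases hvx : v = x
    · subst hvx
      rcases hx with hx | hx
      · refine Or.inl ⟨y, hxy, fun w hw => ?_, ?_⟩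
        · rcases hadj _ _ hw with h | h | h
          · exact absurd h (hx w)
          · exact h.2
          · exact absurd h.1 hxy.ne
        · rw [hCx]
          exact Finset.disjoint_left.2 fun c hc hc' =>
            Finset.disjoint_left.1 hd hc ((hCy c).1 hc')
      · refine Or.inr fun c => ?_
        by_cases hc : c ∈ M
        · exact ⟨y, Or.inr hxy, (hCy c).2 hc⟩
        · obtain ⟨u, hu, hcu⟩ := hx c hc
          exact ⟨u, hu.imp_right (hHG _ _),
            by rwa [hCA _ u (SimpleGraph.Reachable.refl _) hu]⟩
    by_cases hvy : v = y
    · subst hvy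
      rcases hy with hy | hy
      · refine Or.inl ⟨x, hxy.symm, fun w hw => ?_, ?_⟩
        · rcases hadj _ _ hw with h | h | h
          · exact absurd h (hy w)
          · exact absurd h.1 hvx
          · exact h.2
        · rw [hCx]
          exact Finset.disjoint_left.2 fun c hc hc' =>
            Finset.disjoint_left.1 hd hc' ((hCy c).1 hc)
      · refine Or.inr fun c => ?_
        by_cases hc : σ c ∈ N
        · exact ⟨x, Or.inr hxy.symm, by rw [hCx]; exact (hσ₂ c).1 hc⟩
        · obtain ⟨u, hu, hcu⟩ := hy _ hc
          exact ⟨u, hu.imp_right (hHG _ _),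
            (hCB _ u (SimpleGraph.Reachable.refl _) hu c).2 hcu⟩
    rcases hcover v with hv | hv
    · rcases hs v hv hvx with ⟨u, hu, hw, hdis⟩ | hf
      · refine Or.inl ⟨u, hu, hw, ?_⟩
        rwa [hC₁ v hv, hCA v u hv (Or.inr (hnbr v u hvx hvy hu))]
      · refine Or.inr fun c => ?_
        obtain ⟨u, hu, hc⟩ := hf c
        exact ⟨u, hu, by rwa [hCA v u hv (hu.imp_right (hnbr v u hvx hvy))]⟩
    · rcases hs' v hv hvy with ⟨u, hu, hw, hdis⟩ | hf
      · refine Or.inl ⟨u, hu, hw, Finset.disjoint_left.2 fun c hc hc' => ?_⟩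
        exact Finset.disjoint_left.1 hdis ((hC₂ v hv c).1 hc)
          ((hCB v u hv (Or.inr (hnbr v u hvx hvy hu)) c).1 hc')
      · refine Or.inr fun c => ?_
        obtain ⟨u, hu, hc⟩ := hf (σ c)
        exact ⟨u, hu, (hCB v u hv (hu.imp_right (hnbr v u hvx hvy)) c).2 hc⟩

/-- No edge of `G` is a bridge. -/
def Bridgeless {V : Type*} (G : SimpleGraph V) : Prop :=
  ∀ x y, G.Adj x y → (G.deleteEdges {s(x, y)}).Connected

/-- The vertex `v` has exactly the two neighbours `a` and `b`. -/
def Deg2 {V : Type*} (G : SimpleGraph V) (v a b : V) : Prop :=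
  a ≠ b ∧ ∀ w, G.Adj v w ↔ w = a ∨ w = b

/-- The vertex `v` has at least three neighbours. -/
def Deg3 {V : Type*} (G : SimpleGraph V) (v : V) : Prop :=
  ∃ a b c, a ≠ b ∧ a ≠ c ∧ b ≠ c ∧ G.Adj v a ∧ G.Adj v b ∧ G.Adj v c

section

variable {V : Type*} {G : SimpleGraph V}

lemma Deg2.symm {v a b : V} (h : Deg2 G v a b) : Deg2 G v b a :=
  ⟨h.1.symm, fun w => by rw [h.2, or_comm]⟩

lemma Deg2.left {v a b : V} (h : Deg2 G v a b) : G.Adj v a := (h.2 a).2 (Or.inl rfl)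

lemma Deg2.right {v a b : V} (h : Deg2 G v a b) : G.Adj v b := (h.2 b).2 (Or.inr rfl)

lemma Deg2.not_deg3 {v a b : V} (h : Deg2 G v a b) : ¬ Deg3 G v := by
  rintro ⟨x, y, z, hxy, hxz, hyz, hx, hy, hz⟩
  rw [h.2] at hx hy hz
  grind

lemma Deg2.eq_of_adj {v a b w : V} (h : Deg2 G v a b) (hw : G.Adj v w) (hne : w ≠ a) : w = b :=
  ((h.2 w).1 hw).resolve_left hne

lemma Deg2.exists_of_adj {v a b w : V} (h : Deg2 G v a b) (hw : G.Adj v w) :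
    ∃ z, Deg2 G v w z := by
  rcases (h.2 w).1 hw with rfl | rfl
  · exact ⟨b, h⟩
  · exact ⟨a, h.symm⟩

lemma Bridgeless.exists_other (hb : Bridgeless G) {v w : V} (hvw : G.Adj v w) :
    ∃ z, z ≠ w ∧ G.Adj v z := by
  by_contra! h
  have := mem_of_closed (hb v w hvw) {v} rfl (fun x y hx hxy => ?_) w
  · exact hvw.ne' this
  · rw [Set.mem_singleton_iff] at hx
    subst hx
    rw [SimpleGraph.deleteEdges_adj] at hxy
    by_cases hyw : y = w
    · subst hyw
      exact absurd rfl hxy.2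
    · exact absurd hxy.1 (h y hyw)

lemma exists_adj_of_connected (hG : G.Connected) {v w : V} (h : w ≠ v) : ∃ z, G.Adj v z := by
  by_contra! h'
  exact h (mem_of_closed hG {v} rfl (fun x y hx hxy => absurd hxy (by
    rw [Set.mem_singleton_iff] at hx; rw [hx]; exact h' y)) w)

lemma Bridgeless.two_le (hG : G.Connected) (hb : Bridgeless G) [Nontrivial V] (v : V) :
    ∃ a b, a ≠ b ∧ G.Adj v a ∧ G.Adj v b := by
  obtain ⟨w, hw⟩ := exists_ne v
  obtain ⟨a, ha⟩ := exists_adj_of_connected hG hw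
  obtain ⟨b, hab, hb⟩ := hb.exists_other ha
  exact ⟨a, b, hab.symm, ha, hb⟩

lemma Bridgeless.deg (hG : G.Connected) (hb : Bridgeless G) [Nontrivial V] (v : V) :
    Deg3 G v ∨ ∃ a b, Deg2 G v a b := by
  obtain ⟨a, b, hab, ha, hb⟩ := hb.two_le hG v
  by_cases h : ∃ c, c ≠ a ∧ c ≠ b ∧ G.Adj v c
  · obtain ⟨c, hca, hcb, hc⟩ := h
    exact Or.inl ⟨a, b, c, hab, hca.symm, hcb.symm, ha, hb, hc⟩
  · push Not at h
    refine Or.inr ⟨a, b, hab, fun w => ⟨fun hw => ?_, ?_⟩⟩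
    · by_contra! hne
      exact h w hne.1 hne.2 hw
    · rintro (rfl | rfl) <;> assumption

lemma Sat.full {κ : Type*} {A : V → Finset κ} {v a b : V} (h : Sat G A v) (hab : a ≠ b)
    (ha : G.Adj v a) (hb : G.Adj v b) : Full G A v := by
  rcases h with ⟨u, -, hu, -⟩ | h
  · exact absurd ((hu a ha).trans (hu b hb).symm) hab
  · exact h

/-- The vertices outside the range of `r`. -/
abbrev Kept {V : Type*} {k : ℕ} (r : Fin k → V) : Type _ := {x : V // ∀ i, x ≠ r i}

/-- The graph obtained from `G` by removing the vertices in the range of `r`. -/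
abbrev removed {V : Type*} (G : SimpleGraph V) {k : ℕ} (r : Fin k → V) : SimpleGraph (Kept r) :=
  G.comap Subtype.val

lemma exists_extend {k : ℕ} {r : Fin k → V} (hr : Function.Injective r) {F : Type*}
    (A : Kept r → F) (f : Fin k → F) :
    ∃ B : V → F, (∀ x : Kept r, B x = A x) ∧ ∀ i, B (r i) = f i := by
  refine ⟨fun x => if h : ∀ i, x ≠ r i then A ⟨x, h⟩ else f (not_forall.1 h).choose,
    fun x => dif_pos x.2, fun i => ?_⟩
  have h : ¬ ∀ j, r i ≠ r j := fun h => h i rfl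
  exact (dif_neg h).trans (congrArg f (hr (not_not.1 (not_forall.1 h).choose_spec)).symm)

lemma exists_numbering {k n : ℕ} {r : Fin k → V} (hr : Function.Injective r)
    (ψ : Kept r ≃ Fin n) :
    ∃ e : V ≃ Fin (n + k), (∀ x : Kept r, (e x : ℕ) = ψ x) ∧ ∀ i, (e (r i) : ℕ) = n + i := by
  let f : Fin n ⊕ Fin k → V := Sum.elim (fun i => (ψ.symm i : V)) r
  have hf : Function.Bijective f := by
    refine ⟨Function.Injective.sumElim (Subtype.val_injective.comp ψ.symm.injective) hr
      fun i j => (ψ.symm i).2 j, fun x => ?_⟩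
    by_cases h : ∀ i, x ≠ r i
    · exact ⟨Sum.inl (ψ ⟨x, h⟩), by simp [f]⟩
    · push Not at h
      obtain ⟨i, rfl⟩ := h
      exact ⟨Sum.inr i, rfl⟩
  have hinl : ∀ x : Kept r, (Equiv.ofBijective f hf).symm x = Sum.inl (ψ x) := fun x => by
    rw [Equiv.symm_apply_eq]; simp [f]
  have hinr : ∀ i, (Equiv.ofBijective f hf).symm (r i) = Sum.inr i := fun i => by
    rw [Equiv.symm_apply_eq]; rfl
  exact ⟨(Equiv.ofBijective f hf).symm.trans finSumFinEquiv, fun x => by simp [hinl],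
    fun i => by simp [hinr]⟩

lemma lt_of_codeAdj {n : ℕ} {E : List (ℕ × ℕ)} (hE : ∀ p ∈ E, p.1 < n ∧ p.2 < n) {i j : ℕ}
    (h : codeAdj E i j = true) : i < n ∧ j < n := by
  simp only [codeAdj, List.any_eq_true, Bool.or_eq_true, Bool.and_eq_true, beq_iff_eq] at h
  obtain ⟨p, hp, ⟨rfl, rfl⟩ | ⟨rfl, rfl⟩⟩ := h
  · exact hE p hp
  · exact (hE p hp).symm

lemma hasCode_append {n k : ℕ} {E : List (ℕ × ℕ)} (hE : ∀ p ∈ E, p.1 < n ∧ p.2 < n)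
    {r : Fin k → V} {H : SimpleGraph (Kept r)} {ψ : Kept r ≃ Fin n}
    (hψ : ∀ x y, H.Adj x y ↔ codeAdj E (ψ x) (ψ y) = true) {e : V ≃ Fin (n + k)}
    (he : ∀ x : Kept r, (e x : ℕ) = ψ x) (her : ∀ i, (e (r i) : ℕ) = n + i) (L : List (V × V))
    (hL : ∀ x y, G.Adj x y ↔ (∃ hx hy, H.Adj ⟨x, hx⟩ ⟨y, hy⟩) ∨
      ∃ p ∈ L, (x = p.1 ∧ y = p.2) ∨ (x = p.2 ∧ y = p.1)) :
    HasCode G (n + k) (E ++ L.map fun p => ((e p.1 : ℕ), (e p.2 : ℕ))) := by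
  have hkept : ∀ x, (e x : ℕ) < n → ∀ i, x ≠ r i := by
    rintro x hx i rfl
    rw [her] at hx
    omega
  refine ⟨e, fun x y => ?_⟩
  rw [hL, codeAdj_append, Bool.or_eq_true]
  refine or_congr ⟨?_, fun h => ?_⟩ ?_
  · rintro ⟨hx, hy, h⟩
    rwa [hψ, ← he, ← he] at h
  · obtain ⟨hx, hy⟩ := lt_of_codeAdj hE h
    refine ⟨hkept x hx, hkept y hy, ?_⟩
    rwa [hψ, ← he, ← he]
  · simp only [codeAdj, List.any_map, List.any_eq_true, Function.comp_apply, Bool.or_eq_true,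
      Bool.and_eq_true, beq_iff_eq]
    refine exists_congr fun p => and_congr_right fun _ => ?_
    rw [Fin.val_inj, Fin.val_inj, Fin.val_inj, Fin.val_inj, e.injective.eq_iff, e.injective.eq_iff,
      e.injective.eq_iff, e.injective.eq_iff]
    exact or_congr (and_congr eq_comm eq_comm) (and_comm.trans (and_congr eq_comm eq_comm))

lemma badCodes_lt : ∀ p ∈ (1, []) :: badCodes, ∀ e ∈ p.2, e.1 < p.1 ∧ e.2 < p.1 := by
  decide

end

lemma good_or_bad_of_chord {V : Type*} {G : SimpleGraph V} {u v : V} (huv : G.Adj u v)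
    (hH : Good (G.deleteEdges {s(u, v)}) ∨ InBadFamily (G.deleteEdges {s(u, v)}))
    (hG : ∀ x, ∃ a b, a ≠ b ∧ G.Adj x a ∧ G.Adj x b) (hu : Deg3 G u) (hv : Deg3 G v) :
    Good G ∨ InBadFamily G := by
  have hadj : ∀ x y, G.Adj x y ↔ (G.deleteEdges {s(u, v)}).Adj x y ∨ (x = u ∧ y = v) ∨
      (x = v ∧ y = u) := by
    intro x y
    rw [SimpleGraph.deleteEdges_adj, Set.mem_singleton_iff, Sym2.eq_iff]
    have := huv.symm
    grind
  set H := G.deleteEdges {s(u, v)} with hHdef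
  rcases hH with ⟨m, hm, A, hA, hs⟩ | hbad
  · refine Or.inl ⟨m, hm, A, hA, fun x => Or.inr ?_⟩
    have hx : ∃ a b, a ≠ b ∧ H.Adj x a ∧ H.Adj x b := by
      by_cases hxu : x = u
      · obtain ⟨a, b, c, h⟩ := hu
        have h1 := hadj u a; have h2 := hadj u b; have h3 := hadj u c
        have := huv.ne
        grind
      by_cases hxv : x = v
      · obtain ⟨a, b, c, h⟩ := hv
        have h1 := hadj v a; have h2 := hadj v b; have h3 := hadj v c
        have := huv.ne
        grind
      obtain ⟨a, b, h⟩ := hG x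
      have h1 := hadj x a; have h2 := hadj x b
      grind
    obtain ⟨a, b, hab, ha, hb⟩ := hx
    intro c
    obtain ⟨w, hw, hc⟩ := (hs x).full hab ha hb c
    exact ⟨w, hw.imp_right fun h => (hadj _ _).2 (Or.inl h), hc⟩
  · obtain ⟨p, hp, e, he⟩ := (inBadFamily_iff _).1 hbad
    have hcode : HasCode G p.1 (p.2 ++ [((e u : ℕ), (e v : ℕ))]) := by
      refine ⟨e, fun x y => ?_⟩
      rw [hadj, codeAdj_append, Bool.or_eq_true, he]
      simp only [codeAdj, List.any_cons, List.any_nil, Bool.or_false, Bool.or_eq_true,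
        Bool.and_eq_true, beq_iff_eq, Fin.val_inj, e.injective.eq_iff]
      grind
    refine good_or_bad_of_checkCode hcode (check_chord p hp _ (e u).2 _ (e v).2 ?_ ?_)
    · exact fun h => huv.ne (e.injective (Fin.ext h))
    · rw [Bool.eq_false_iff, Ne, ← he]
      exact fun h => (SimpleGraph.deleteEdges_adj.1 h).2 rfl

universe u

section

variable {V : Type u} [Fintype V] {G : SimpleGraph V}

lemma good_or_bad_of_removed (hn : GoodBelow.{u} (Fintype.card V)) {k : ℕ} {r : Fin (k + 1) → V}
    {H : SimpleGraph (Kept r)} (hH : H.Connected) (h2 : ∃ x y : Kept r, x ≠ y) :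
    Good H ∨ InBadFamily H := by
  refine hn _ H (Fintype.card_subtype_lt (x := r 0) (by simp)) hH ?_
  have : Nontrivial (Kept r) := ⟨h2⟩
  exact Fintype.one_lt_card

lemma exists_ear_colours {m : ℕ} {X Y : Finset (Fin (5 * m))} (hX : #X = 2 * m)
    (hY : #Y = 2 * m) : ∃ a b c : Finset (Fin (5 * m)), #a ≤ 2 * m ∧ #b ≤ 2 * m ∧ #c ≤ 2 * m ∧
      (∀ i, i ∈ X ∨ i ∈ a ∨ i ∈ b) ∧ (∀ i, i ∈ a ∨ i ∈ b ∨ i ∈ c) ∧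
      (∀ i, i ∈ b ∨ i ∈ c ∨ i ∈ Y) := by
  have hO : #(X ∪ Y)ᶜ = m + #(X ∩ Y) := by
    have h1 := Finset.card_union_add_card_inter X Y
    have h2 := Finset.card_compl_add_card (X ∪ Y)
    rw [Fintype.card_fin] at h2
    omega
  have hXY : #(X \ Y) + #(X ∩ Y) = 2 * m := by rw [← hX, card_sdiff_add_card_inter]
  have hYX : #(Y \ X) + #(X ∩ Y) = 2 * m := by
    rw [← hY, inter_comm, card_sdiff_add_card_inter]
  obtain ⟨b, hbO, hb⟩ := exists_subset_card_eq (min_le_right (2 * m) #(X ∪ Y)ᶜ)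
  obtain ⟨I, hI, hIc⟩ := exists_subset_card_eq (min_le_right m #(X ∩ Y))
  have hR := card_sdiff_of_subset hbO
  have hI' := card_sdiff_of_subset hI
  have hle : #I ≤ #(X ∩ Y) := card_le_card hI
  refine ⟨(Y \ X) ∪ ((X ∪ Y)ᶜ \ b) ∪ I, b, (X \ Y) ∪ ((X ∪ Y)ᶜ \ b) ∪ ((X ∩ Y) \ I), ?_, ?_, ?_,
    ?_, ?_, ?_⟩
  · refine (card_union_le _ _).trans ((Nat.add_le_add_right (card_union_le _ _) _).trans ?_)
    omega
  · omega
  · refine (card_union_le _ _).trans ((Nat.add_le_add_right (card_union_le _ _) _).trans ?_)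
    omega
  all_goals
    intro i
    simp only [mem_union, mem_sdiff, mem_compl, mem_inter]
    tauto

lemma good_or_bad_of_ear (hn : GoodBelow.{u} (Fintype.card V)) (hG : G.Connected)
    (hb : Bridgeless G) {u v a b c : V} (ha : Deg2 G a u b) (hb' : Deg2 G b a c)
    (hc : Deg2 G c b v) (huv : u = v ∨ (Deg3 G u ∧ Deg3 G v)) : Good G ∨ InBadFamily G := by
  have hua := ha.left
  have hab := ha.right
  have hbc := hb'.right
  have hcv := hc.right
  have hac : a ≠ c := hb'.1
  have huc : u ≠ c := by
    rintro rfl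
    rcases huv with rfl | ⟨h, -⟩
    · exact hcv.ne rfl
    · exact hc.not_deg3 h
  have hva : v ≠ a := by
    rintro rfl
    rcases huv with rfl | ⟨-, h⟩
    · exact hua.ne rfl
    · exact ha.not_deg3 h
  replace huv : u = v ∨ (u ≠ v ∧ Deg3 G u ∧ Deg3 G v) := by tauto
  have hub : u ≠ b := ha.1
  have hvb : v ≠ b := hc.1.symm
  have hr : Function.Injective ![a, b, c] := by
    intro i j
    have := hab.ne
    have := hbc.ne
    have := hab.ne'
    have := hbc.ne'
    have := hac.symm
    fin_cases i <;> fin_cases j <;> simp_all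
  have hkept : ∀ x, (∀ i, x ≠ ![a, b, c] i) ↔ x ≠ a ∧ x ≠ b ∧ x ≠ c := by
    intro x
    simp [Fin.forall_fin_succ]
  have huk : ∀ i, u ≠ ![a, b, c] i := (hkept u).2 ⟨hua.ne', hub, huc⟩
  have hvk : ∀ i, v ≠ ![a, b, c] i := (hkept v).2 ⟨hva, hvb, hcv.ne'⟩
  have hH : (removed G ![a, b, c]).Connected := by
    refine connected_of_map (hb a u hua) (fun x => if h : ∀ i, x ≠ ![a, b, c] i then ⟨x, h⟩ else
      ⟨v, hvk⟩) (fun x => ⟨x, dif_pos x.2⟩) fun x y hxy => ?_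
    rw [SimpleGraph.deleteEdges_adj, Set.mem_singleton_iff, Sym2.eq_iff] at hxy
    obtain ⟨hxy, hne⟩ := hxy
    have hyx := hxy.symm
    simp only [SimpleGraph.comap_adj]
    by_cases hx : ∀ i, x ≠ ![a, b, c] i <;> by_cases hy : ∀ i, y ≠ ![a, b, c] i
    · rw [dif_pos hx, dif_pos hy]
      exact Or.inr hxy
    · rw [dif_pos hx, dif_neg hy, Subtype.mk.injEq]
      have h1 := ha.2 x; have h2 := hb'.2 x; have h3 := hc.2 x
      rw [hkept] at hx hy
      grind
    · rw [dif_neg hx, dif_pos hy, Subtype.mk.injEq]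
      have h1 := ha.2 y; have h2 := hb'.2 y; have h3 := hc.2 y
      rw [hkept] at hx hy
      grind
    · rw [dif_neg hx, dif_neg hy]
      exact Or.inl rfl
  have htwo : (∃ x y : Kept ![a, b, c], x ≠ y) →
      ∀ x : Kept ![a, b, c], ∃ y z : Kept ![a, b, c], y ≠ z ∧ G.Adj x y ∧ G.Adj x z := by
    intro hsub
    have : Nontrivial V := ⟨a, b, hab.ne⟩
    rintro ⟨x, hx⟩
    have hx' := (hkept x).1 hx
    have h1 := ha.2 x; have h2 := hb'.2 x; have h3 := hc.2 x
    have hcomm := fun y => G.adj_comm x y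
    suffices h : ∃ y z, (y ≠ a ∧ y ≠ b ∧ y ≠ c) ∧ (z ≠ a ∧ z ≠ b ∧ z ≠ c) ∧ y ≠ z ∧ G.Adj x y ∧
        G.Adj x z by
      obtain ⟨y, z, hy, hz, hyz, h⟩ := h
      exact ⟨⟨y, (hkept y).2 hy⟩, ⟨z, (hkept z).2 hz⟩, fun h => hyz (congrArg Subtype.val h), h⟩
    by_cases hxu : x = u
    · subst hxu
      rcases huv with rfl | ⟨hne, ⟨p, q, r, h⟩, -⟩
      · have : ∃ z, G.Adj x z ∧ z ≠ a ∧ z ≠ b ∧ z ≠ c := by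
          obtain ⟨y, z, hyz⟩ := hsub
          have : ∃ w : Kept ![a, b, c], w ≠ ⟨x, hx⟩ := by
            by_cases h : y = ⟨x, hx⟩
            · exact ⟨z, fun h' => hyz (h.trans h'.symm)⟩
            · exact ⟨y, h⟩
          obtain ⟨w, hw⟩ := this
          obtain ⟨z, hz⟩ := exists_adj_of_connected hH hw
          exact ⟨z, hz, (hkept _).1 z.2⟩
        obtain ⟨z, hxz, hz⟩ := this
        by_contra! hno
        have := mem_of_closed (hb x z hxz) {w | w = x ∨ w = a ∨ w = b ∨ w = c} (x := x)
          (Or.inl rfl) (fun v w hv hvw => ?_) z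
        · simp only [Set.mem_ofPred_eq] at this
          have := hxz.ne'
          grind
        · rw [SimpleGraph.deleteEdges_adj, Set.mem_singleton_iff, Sym2.eq_iff] at hvw
          have h1 := ha.2 w; have h2 := hb'.2 w; have h3 := hc.2 w
          simp only [Set.mem_ofPred_eq] at hv ⊢
          have := hno z w hz
          grind
      · have := hcomm p; have := hcomm q; have := hcomm r
        have hk : ∀ w, G.Adj x w → w ≠ a → w ≠ b ∧ w ≠ c := by
          intro w hw hwa
          have := hcomm w
          grind
        grind
    by_cases hxv : x = v
    · subst hxv
      rcases huv with rfl | ⟨hne, -, ⟨p, q, r, h⟩⟩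
      · exact absurd rfl hxu
      · have hk : ∀ w, G.Adj x w → w ≠ c → w ≠ a ∧ w ≠ b := by
          intro w hw hwa
          have := hcomm w
          grind
        grind
    obtain ⟨y, z, hyz, hy, hz⟩ := hb.two_le hG x
    have := hcomm y; have := hcomm z
    exact ⟨y, z, by grind, by grind, hyz, hy, hz⟩
  have hadj : ∀ x y, G.Adj x y ↔ (∃ (hx : ∀ i, x ≠ ![a, b, c] i) (hy : ∀ i, y ≠ ![a, b, c] i),
      (removed G ![a, b, c]).Adj ⟨x, hx⟩ ⟨y, hy⟩) ∨ ∃ p ∈ [(u, a), (a, b), (b, c), (c, v)],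
      (x = p.1 ∧ y = p.2) ∨ (x = p.2 ∧ y = p.1) := by
    intro x y
    simp only [SimpleGraph.comap_adj, exists_prop, List.mem_cons, List.not_mem_nil, or_false,
      exists_eq_or_imp, exists_eq_left, hkept]
    have h1 := ha.2 x; have h2 := hb'.2 x; have h3 := hc.2 x
    have h4 := ha.2 y; have h5 := hb'.2 y; have h6 := hc.2 y
    have h7 := G.adj_comm x y
    grind
  have hcode : ∀ p ∈ (1, []) :: badCodes, HasCode (removed G ![a, b, c]) p.1 p.2 →
      Good G ∨ InBadFamily G := by
    rintro p hp ⟨ψ, hψ⟩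
    obtain ⟨e, he, her⟩ := exists_numbering hr ψ
    have h := hasCode_append (badCodes_lt p hp) hψ he her _ hadj
    have h0 := her 0; have h1 := her 1; have h2 := her 2
    have hu := he ⟨u, huk⟩; have hv := he ⟨v, hvk⟩
    simp only [Matrix.cons_val] at h0 h1 h2
    simp only [List.map_cons, List.map_nil, h0, h1, h2, hu, hv] at h
    exact good_or_bad_of_checkCode h (check_ear p hp _ (ψ _).2 _ (ψ _).2)
  by_cases hsub : ∃ x y : Kept ![a, b, c], x ≠ y
  swap
  · push Not at hsub
    refine hcode _ List.mem_cons_self ⟨⟨fun _ => 0, fun _ => ⟨u, huk⟩, fun x => hsub _ _,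
      fun i => Subsingleton.elim _ _⟩, fun x y => ?_⟩
    simp only [codeAdj, List.any_nil, Bool.false_eq_true, iff_false]
    rw [hsub x y]
    exact (removed G ![a, b, c]).loopless.irrefl _
  rcases good_or_bad_of_removed hn hH hsub with ⟨m, hm, A, hA, hs⟩ | hbad
  swap
  · obtain ⟨p, hp, h⟩ := (inBadFamily_iff _).1 hbad
    exact hcode p (List.mem_cons_of_mem _ hp) h
  obtain ⟨Ca, Cb, Cc, hCa, hCb, hCc, hfa, hfb, hfc⟩ :=
    exists_ear_colours (hA ⟨u, huk⟩) (hA ⟨v, hvk⟩)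
  obtain ⟨B, hB, hBr⟩ := exists_extend hr A ![Ca, Cb, Cc]
  have hBu := hB ⟨u, huk⟩
  have hBv := hB ⟨v, hvk⟩
  have hBa := hBr 0; have hBb := hBr 1; have hBc := hBr 2
  simp only [Matrix.cons_val] at hBa hBb hBc
  refine Or.inl (good_of_full G m hm (Fintype.card_fin _) B (fun x => ?_) fun x => ?_)
  · by_cases hx : ∀ i, x ≠ ![a, b, c] i
    · rw [hB ⟨x, hx⟩, hA]
    · rw [hkept] at hx
      have : x = a ∨ x = b ∨ x = c := by tauto
      rcases this with rfl | rfl | rfl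
      · rwa [hBa]
      · rwa [hBb]
      · rwa [hBc]
  · intro i
    by_cases hx : ∀ i, x ≠ ![a, b, c] i
    · obtain ⟨y, z, hyz, hy, hz⟩ := htwo hsub ⟨x, hx⟩
      obtain ⟨w, hw, hi⟩ := (hs ⟨x, hx⟩).full hyz hy hz i
      exact ⟨w, hw.imp (congrArg Subtype.val) id, by rwa [hB]⟩
    · rw [hkept] at hx
      have : x = a ∨ x = b ∨ x = c := by tauto
      rcases this with rfl | rfl | rfl
      · rcases hfa i with h | h | h
        · exact ⟨u, Or.inr hua, by rwa [hBu]⟩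
        · exact ⟨x, Or.inl rfl, by rwa [hBa]⟩
        · exact ⟨b, Or.inr hab, by rwa [hBb]⟩
      · rcases hfb i with h | h | h
        · exact ⟨a, Or.inr hab.symm, by rwa [hBa]⟩
        · exact ⟨x, Or.inl rfl, by rwa [hBb]⟩
        · exact ⟨c, Or.inr hbc, by rwa [hBc]⟩
      · rcases hfc i with h | h | h
        · exact ⟨b, Or.inr hbc.symm, by rwa [hBb]⟩
        · exact ⟨x, Or.inl rfl, by rwa [hBc]⟩
        · exact ⟨v, Or.inr hcv, by rwa [hBv]⟩

end

section

variable {V : Type u} [Fintype V] {G : SimpleGraph V}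

lemma exists_parts {m : ℕ} {X : Finset (Fin (5 * m))} (hX : #X = 2 * m) :
    ∃ P : Fin 5 → Finset (Fin (5 * m)), (∀ i, #(P i) = m) ∧ (∀ c, ∃ i, c ∈ P i) ∧
      P 0 ∪ P 1 = X := by
  have hXc : #Xᶜ = 3 * m := by rw [card_compl, Fintype.card_fin]; omega
  obtain ⟨X₁, hX₁, h₁⟩ := exists_subset_card_eq (s := X) (n := m) (by omega)
  obtain ⟨Y, hY, h₂⟩ := exists_subset_card_eq (s := Xᶜ) (n := m) (by omega)
  have hYc := card_sdiff_of_subset hY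
  obtain ⟨Z, hZ, h₃⟩ := exists_subset_card_eq (s := Xᶜ \ Y) (n := m) (by omega)
  have hZc := card_sdiff_of_subset hZ
  have hXX := card_sdiff_of_subset hX₁
  refine ⟨![X₁, X \ X₁, Y, Z, (Xᶜ \ Y) \ Z], fun i => ?_, fun c => ?_, ?_⟩
  · fin_cases i <;> simp only [Fin.reduceFinMk, Fin.zero_eta, Fin.mk_one, Matrix.cons_val] <;> omega
  · simp only [Fin.exists_fin_succ, Matrix.cons_val_zero, Matrix.cons_val_succ,
      mem_sdiff, mem_compl]
    tauto
  · simpa using union_sdiff_of_subset hX₁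

lemma good_of_closed_ear (hn : GoodBelow.{u} (Fintype.card V)) (hG : G.Connected)
    (hb : Bridgeless G) [Nontrivial V] {k : ℕ} {r : Fin (k + 1) → V} (hr : Function.Injective r)
    {u : V} (hu : ∀ i, u ≠ r i) (hadj : ∀ i y, G.Adj (r i) y → y = u ∨ ∃ j, y = r j)
    (f g : Fin (k + 1) → Fin 5)
    (hfull : ∀ (m : ℕ) (P : Fin 5 → Finset (Fin (5 * m))) (B : V → Finset (Fin (5 * m))),
      (∀ c, ∃ i, c ∈ P i) → B u = P 0 ∪ P 1 → (∀ i, B (r i) = P (f i) ∪ P (g i)) →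
        ∀ x, (x = u ∨ ∃ i, x = r i) → Full G B x) : Good G := by
  have hH : (removed G r).Connected := by
    refine connected_of_map hG (fun x => if h : ∀ i, x ≠ r i then ⟨x, h⟩ else ⟨u, hu⟩)
      (fun x => ⟨x, dif_pos x.2⟩) fun x y hxy => ?_
    by_cases hx : ∀ i, x ≠ r i <;> by_cases hy : ∀ i, y ≠ r i
    · rw [dif_pos hx, dif_pos hy]
      exact Or.inr hxy
    · rw [dif_pos hx, dif_neg hy, Subtype.mk.injEq]
      push Not at hy
      obtain ⟨i, rfl⟩ := hy
      rcases hadj i x hxy.symm with h | ⟨j, h⟩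
      · exact Or.inl h
      · exact absurd h (hx j)
    · rw [dif_neg hx, dif_pos hy, Subtype.mk.injEq]
      push Not at hx
      obtain ⟨i, rfl⟩ := hx
      rcases hadj i y hxy with h | ⟨j, h⟩
      · exact Or.inl h.symm
      · exact absurd h (hy j)
    · rw [dif_neg hx, dif_neg hy]
      exact Or.inl rfl
  obtain ⟨m, hm, A, -, hA, -, -, hs, -⟩ := rootedGood_of_goodBelow hn hH
    (Fintype.card_subtype_lt (x := r 0) (by simp)) ⟨u, hu⟩
  obtain ⟨P, hP, hPc, hPu⟩ := exists_parts (hA ⟨u, hu⟩)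
  obtain ⟨B, hB, hBr⟩ := exists_extend hr A fun i => P (f i) ∪ P (g i)
  refine good_of_full G m hm (Fintype.card_fin _) B (fun x => ?_) fun x => ?_
  · by_cases hx : ∀ i, x ≠ r i
    · rw [hB ⟨x, hx⟩, hA]
    · push Not at hx
      obtain ⟨i, rfl⟩ := hx
      rw [hBr]
      refine (card_union_le _ _).trans ?_
      rw [hP, hP, two_mul]
  · by_cases hx : x = u ∨ ∃ i, x = r i
    · exact hfull m P B hPc (by rw [hPu, ← hB]) hBr x hx
    · push Not at hx
      obtain ⟨hxu, hx⟩ := hx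
      have hk : ∀ y, G.Adj x y → ∀ i, y ≠ r i := by
        rintro _ hxy i rfl
        rcases hadj i x hxy.symm with h | ⟨j, h⟩
        · exact hxu h
        · exact hx j h
      obtain ⟨y, z, hyz, hy, hz⟩ := hb.two_le hG x
      intro c
      obtain ⟨w, hw, hc⟩ := (hs ⟨x, hx⟩ fun h => hxu (congrArg Subtype.val h)).full
        (a := (⟨y, hk y hy⟩ : Kept r)) (b := (⟨z, hk z hz⟩ : Kept r))
        (fun h => hyz (congrArg Subtype.val h)) hy hz c
      exact ⟨w, hw.imp (congrArg Subtype.val) id, by rwa [hB]⟩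

lemma good_of_closed_ear_two (hn : GoodBelow.{u} (Fintype.card V)) (hG : G.Connected)
    (hb : Bridgeless G) {u a b : V} (ha : Deg2 G a u b) (hb' : Deg2 G b a u) : Good G := by
  have hab := ha.right
  have hua := ha.left
  have hub := hb'.right
  have : Nontrivial V := ⟨a, b, hab.ne⟩
  refine good_of_closed_ear hn hG hb (r := ![a, b]) (u := u) ?_ ?_ ?_ ![2, 4] ![3, 0] ?_
  · intro i j
    have := hab.ne
    have := hab.ne'
    fin_cases i <;> fin_cases j <;> simp_all
  · simp [Fin.forall_fin_succ, hua.ne', hub.ne']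
  · simp only [Fin.forall_fin_succ, Fin.exists_fin_succ, Matrix.cons_val_zero,
      Matrix.cons_val_succ, IsEmpty.forall_iff, IsEmpty.exists_iff, or_false, and_true, ha.2, hb'.2]
    grind
  · intro m P B hP hBu hBr x hx c
    have hBa := hBr 0; have hBb := hBr 1
    simp only [Matrix.cons_val] at hBa hBb
    have key : c ∈ B u ∨ c ∈ B a ∨ c ∈ B b := by
      obtain ⟨i, hi⟩ := hP c
      rw [hBu, hBa, hBb]
      simp only [mem_union]
      fin_cases i <;> tauto
    have hx : x = u ∨ x = a ∨ x = b := by simpa [Fin.exists_fin_succ] using hx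
    have := hua.symm; have := hab.symm; have := hub.symm
    rcases key with h | h | h
    · exact ⟨u, by grind, h⟩
    · exact ⟨a, by grind, h⟩
    · exact ⟨b, by grind, h⟩

lemma good_of_closed_ear_four (hn : GoodBelow.{u} (Fintype.card V)) (hG : G.Connected)
    (hb : Bridgeless G) {u a b c d : V} (ha : Deg2 G a u b) (hb' : Deg2 G b a c)
    (hc : Deg2 G c b d) (hd : Deg2 G d c u) : Good G := by
  have hua := ha.left; have hab := ha.right; have hbc := hb'.right; have hcd := hc.right
  have hdu := hd.right
  have hub := ha.1; have hac := hb'.1; have hbd := hc.1; have hcu := hd.1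
  have had : a ≠ d := by
    rintro rfl
    have := hbc.ne
    have := (hd.2 b).1 hab
    grind
  have : Nontrivial V := ⟨a, b, hab.ne⟩
  refine good_of_closed_ear hn hG hb (r := ![a, b, c, d]) (u := u) ?_ ?_ ?_ ![3, 0, 1, 2]
    ![4, 2, 4, 3] ?_
  · have := hab.ne; have := hbc.ne; have := hcd.ne
    intro i j
    fin_cases i <;> fin_cases j <;> simp_all [eq_comm]
  · simp [Fin.forall_fin_succ, hua.ne', hub, hcu.symm, hdu.ne']
  · simp only [Fin.forall_fin_succ, Fin.exists_fin_succ, Matrix.cons_val_zero,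
      Matrix.cons_val_succ, IsEmpty.forall_iff, IsEmpty.exists_iff, or_false, and_true, ha.2, hb'.2,
      hc.2, hd.2]
    grind
  · intro m P B hP hBu hBr x hx i
    have hBa := hBr 0; have hBb := hBr 1; have hBc := hBr 2; have hBd := hBr 3
    simp only [Matrix.cons_val] at hBa hBb hBc hBd
    have key : (i ∈ B u ∨ i ∈ B a ∨ i ∈ B b) ∧ (i ∈ B a ∨ i ∈ B b ∨ i ∈ B c) ∧
        (i ∈ B b ∨ i ∈ B c ∨ i ∈ B d) ∧ (i ∈ B c ∨ i ∈ B d ∨ i ∈ B u) ∧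
        (i ∈ B d ∨ i ∈ B u ∨ i ∈ B a) := by
      obtain ⟨j, hj⟩ := hP i
      rw [hBu, hBa, hBb, hBc, hBd]
      simp only [mem_union]
      fin_cases j <;> simp only [Fin.reduceFinMk, Fin.zero_eta, Fin.mk_one] at hj <;> simp [hj]
    have close : ∀ x y z, G.Adj x y → G.Adj y z → (i ∈ B x ∨ i ∈ B y ∨ i ∈ B z) →
        ∃ w, (w = y ∨ G.Adj y w) ∧ i ∈ B w := by
      rintro x y z hxy hyz (h | h | h)
      · exact ⟨x, Or.inr hxy.symm, h⟩
      · exact ⟨y, Or.inl rfl, h⟩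
      · exact ⟨z, Or.inr hyz, h⟩
    have hx : x = u ∨ x = a ∨ x = b ∨ x = c ∨ x = d := by simpa [Fin.exists_fin_succ] using hx
    rcases hx with rfl | rfl | rfl | rfl | rfl
    · exact close _ _ _ hdu hua.symm key.2.2.2.2
    · exact close _ _ _ hua.symm hab key.1
    · exact close _ _ _ hab hbc key.2.1
    · exact close _ _ _ hbc hcd key.2.2.1
    · exact close _ _ _ hcd hdu key.2.2.2.1

end

section

variable {V : Type u} [Fintype V] {G : SimpleGraph V}

lemma good_or_bad_of_twin (hn : GoodBelow.{u} (Fintype.card V)) (hG : G.Connected)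
    (hb : Bridgeless G) {u v a a' : V} (ha : Deg2 G a u v) (ha' : Deg2 G a' u v) (haa : a ≠ a')
    (hu : Deg3 G u) (hv : Deg3 G v) : Good G ∨ InBadFamily G := by
  have hau := ha.left; have hav := ha.right; have hau' := ha'.left; have hav' := ha'.right
  have : Nontrivial V := ⟨a, a', haa⟩
  have hr : Function.Injective ![a'] := Function.injective_of_subsingleton _
  have hkept : ∀ x, (∀ i, x ≠ ![a'] i) ↔ x ≠ a' := by
    intro x
    simp
  have huk : ∀ i, u ≠ ![a'] i := (hkept u).2 hau'.ne'
  have hvk : ∀ i, v ≠ ![a'] i := (hkept v).2 hav'.ne'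
  have hak : ∀ i, a ≠ ![a'] i := (hkept a).2 haa
  have hH : (removed G ![a']).Connected := by
    refine connected_of_map hG (fun x => if h : ∀ i, x ≠ ![a'] i then ⟨x, h⟩ else ⟨a, hak⟩)
      (fun x => ⟨x, dif_pos x.2⟩) fun x y hxy => ?_
    have hyx := hxy.symm
    simp only [SimpleGraph.comap_adj]
    by_cases hx : ∀ i, x ≠ ![a'] i <;> by_cases hy : ∀ i, y ≠ ![a'] i
    · rw [dif_pos hx, dif_pos hy]
      exact Or.inr hxy
    · rw [dif_pos hx, dif_neg hy, Subtype.mk.injEq]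
      have h1 := ha.2 x; have h2 := ha'.2 x; have h3 := G.adj_comm x a
      rw [hkept] at hx hy
      grind
    · rw [dif_neg hx, dif_pos hy, Subtype.mk.injEq]
      have h1 := ha.2 y; have h2 := ha'.2 y
      rw [hkept] at hx hy
      grind
    · rw [dif_neg hx, dif_neg hy]
      exact Or.inl rfl
  have htwo : ∀ x : Kept ![a'], ∃ y z : Kept ![a'], y ≠ z ∧ G.Adj x y ∧ G.Adj x z := by
    rintro ⟨x, hx⟩
    have hx' := (hkept x).1 hx
    suffices h : ∃ y z, y ≠ a' ∧ z ≠ a' ∧ y ≠ z ∧ G.Adj x y ∧ G.Adj x z by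
      obtain ⟨y, z, hy, hz, hyz, h⟩ := h
      exact ⟨⟨y, (hkept y).2 hy⟩, ⟨z, (hkept z).2 hz⟩, fun h => hyz (congrArg Subtype.val h), h⟩
    by_cases hd : Deg3 G x
    · obtain ⟨p, q, r, h⟩ := hd
      grind
    · obtain ⟨y, z, hyz, hy, hz⟩ := hb.two_le hG x
      have h1 := ha'.2 x; have h2 := G.adj_comm x a'
      exact ⟨y, z, by grind, by grind, hyz, hy, hz⟩
  have hadj : ∀ x y, G.Adj x y ↔ (∃ (hx : ∀ i, x ≠ ![a'] i) (hy : ∀ i, y ≠ ![a'] i),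
      (removed G ![a']).Adj ⟨x, hx⟩ ⟨y, hy⟩) ∨ ∃ p ∈ [(u, a'), (v, a')],
      (x = p.1 ∧ y = p.2) ∨ (x = p.2 ∧ y = p.1) := by
    intro x y
    simp only [SimpleGraph.comap_adj, exists_prop, List.mem_cons, List.not_mem_nil, or_false,
      exists_eq_or_imp, exists_eq_left, hkept]
    have h1 := ha'.2 x; have h2 := ha'.2 y; have h3 := G.adj_comm x y
    grind
  rcases good_or_bad_of_removed hn hH ⟨⟨a, hak⟩, ⟨u, huk⟩, fun h => hau.ne (congrArg Subtype.val h)⟩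
    with ⟨m, hm, A, hA, hs⟩ | hbad
  swap
  · obtain ⟨p, hp, ψ, hψ⟩ := (inBadFamily_iff _).1 hbad
    obtain ⟨e, he, her⟩ := exists_numbering hr ψ
    have h := hasCode_append (badCodes_lt p (List.mem_cons_of_mem _ hp)) hψ he her _ hadj
    have h0 := her 0
    have hu := he ⟨u, huk⟩; have hv := he ⟨v, hvk⟩
    simp only [Matrix.cons_val] at h0
    simp only [List.map_cons, List.map_nil, h0, hu, hv] at h
    refine good_or_bad_of_checkCode h (check_twin p hp _ (ψ _).2 _ (ψ _).2 fun h => ?_)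
    exact ha.1 (congrArg Subtype.val (ψ.injective (Fin.ext h)))
  obtain ⟨B, hB, hBr⟩ := exists_extend hr A ![A ⟨a, hak⟩]
  have hBa := hB ⟨a, hak⟩
  have hBa' := hBr 0
  simp only [Matrix.cons_val] at hBa'
  have hkeep : ∀ x, x ≠ a' → Full G B x := by
    intro x hx i
    obtain ⟨y, z, hyz, hy, hz⟩ := htwo ⟨x, (hkept x).2 hx⟩
    obtain ⟨w, hw, hi⟩ := (hs ⟨x, (hkept x).2 hx⟩).full hyz hy hz i
    exact ⟨w, hw.imp (congrArg Subtype.val) id, by rwa [hB]⟩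
  refine Or.inl (good_of_full G m hm (Fintype.card_fin _) B (fun x => ?_) fun x => ?_)
  · by_cases hx : ∀ i, x ≠ ![a'] i
    · rw [hB ⟨x, hx⟩, hA]
    · obtain rfl : x = a' := by simpa using hx
      rw [hBa', hA]
  · by_cases hx : x = a'
    · subst hx
      intro i
      obtain ⟨w, hw, hi⟩ := hkeep a haa i
      rcases hw with rfl | hw
      · exact ⟨x, Or.inl rfl, by rwa [hBa', ← hBa]⟩
      · exact ⟨w, Or.inr ((ha'.2 w).2 ((ha.2 w).1 hw)), hi⟩
    · exact hkeep x hx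

lemma codeAdj_filter {E : List (ℕ × ℕ)} {i j k l : ℕ} :
    codeAdj (E.filter fun e => !codeAdj [(i, j)] e.1 e.2) k l = true ↔
      codeAdj E k l = true ∧ ¬ (k = i ∧ l = j ∨ k = j ∧ l = i) := by
  simp only [codeAdj, List.any_eq_true, List.mem_filter]
  simp
  grind

lemma good_or_bad_of_subdiv (hn : GoodBelow.{u} (Fintype.card V)) (hG : G.Connected)
    (hb : Bridgeless G) {s a b c d t : V} (ha : Deg2 G a s b) (hb' : Deg2 G b a c)
    (hc : Deg2 G c b d) (hd : Deg2 G d c t) (hsc : s ≠ c) (hsd : s ≠ d) (hst : s ≠ t) :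
    Good G ∨ InBadFamily G := by
  have hsa := ha.left; have hab := ha.right; have hbc := hb'.right; have hcd := hc.right
  have hdt := hd.right
  have hsb := ha.1; have hac := hb'.1; have hbd := hc.1; have hct := hd.1
  have had : a ≠ d := by
    rintro rfl
    have := (ha.2 c).1 hcd.symm
    have := hbc.ne
    grind
  have hat : a ≠ t := by
    rintro rfl
    have := (ha.2 d).1 hdt.symm
    grind
  have hbt : b ≠ t := by
    rintro rfl
    have := (hb'.2 d).1 hdt.symm
    have := hcd.ne
    grind
  have hatn : ¬ G.Adj a t := by
    rw [ha.2]
    grind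
  have : Nontrivial V := ⟨a, c, hac⟩
  have hr : Function.Injective ![b, c, d] := by
    intro i j
    have := hbc.ne
    have := hcd.ne
    fin_cases i <;> fin_cases j <;> simp_all [eq_comm]
  have hkept : ∀ x, (∀ i, x ≠ ![b, c, d] i) ↔ x ≠ b ∧ x ≠ c ∧ x ≠ d := by
    intro x
    simp [Fin.forall_fin_succ]
  have hak : ∀ i, a ≠ ![b, c, d] i := (hkept a).2 ⟨hab.ne, hac, had⟩
  have htk : ∀ i, t ≠ ![b, c, d] i := (hkept t).2 ⟨hbt.symm, hct.symm, hdt.ne'⟩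
  have hsk : ∀ i, s ≠ ![b, c, d] i := (hkept s).2 ⟨hsb, hsc, hsd⟩
  obtain ⟨H, hHdef⟩ : ∃ H : SimpleGraph (Kept ![b, c, d]), ∀ x y, H.Adj x y ↔
      G.Adj x y ∨ (x.1 = a ∧ y.1 = t) ∨ (x.1 = t ∧ y.1 = a) := by
    refine ⟨removed G ![b, c, d] ⊔ SimpleGraph.edge ⟨a, hak⟩ ⟨t, htk⟩, fun x y => ?_⟩
    rw [SimpleGraph.sup_adj, SimpleGraph.edge_adj, SimpleGraph.comap_adj]
    simp only [Subtype.ext_iff, ne_eq]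
    grind
  have hH : H.Connected := by
    refine connected_of_map hG (fun x => if h : ∀ i, x ≠ ![b, c, d] i then ⟨x, h⟩ else
      if x = b then ⟨a, hak⟩ else ⟨t, htk⟩) (fun x => ⟨x, dif_pos x.2⟩) fun x y hxy => ?_
    have hyx := hxy.symm
    have h1 := ha.2 x; have h2 := hb'.2 x; have h3 := hc.2 x; have h4 := hd.2 x
    have h5 := ha.2 y; have h6 := hb'.2 y; have h7 := hc.2 y; have h8 := hd.2 y
    simp only [hHdef]
    by_cases hx : ∀ i, x ≠ ![b, c, d] i <;> by_cases hy : ∀ i, y ≠ ![b, c, d] i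
    · rw [dif_pos hx, dif_pos hy]
      exact Or.inr (Or.inl hxy)
    · rw [dif_pos hx, dif_neg hy]
      rw [hkept] at hx hy
      split_ifs <;> simp only [Subtype.mk.injEq] <;> grind
    · rw [dif_neg hx, dif_pos hy]
      rw [hkept] at hx hy
      split_ifs <;> simp only [Subtype.mk.injEq] <;> grind
    · rw [dif_neg hx, dif_neg hy]
      split_ifs <;> simp
  have htwo : ∀ x : Kept ![b, c, d], ∃ y z : Kept ![b, c, d], y ≠ z ∧ H.Adj x y ∧ H.Adj x z := by
    rintro ⟨x, hx⟩
    have hx' := (hkept x).1 hx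
    suffices h : ∃ y z, (y ≠ b ∧ y ≠ c ∧ y ≠ d) ∧ (z ≠ b ∧ z ≠ c ∧ z ≠ d) ∧ y ≠ z ∧
        (G.Adj x y ∨ (x = a ∧ y = t) ∨ (x = t ∧ y = a)) ∧
        (G.Adj x z ∨ (x = a ∧ z = t) ∨ (x = t ∧ z = a)) by
      obtain ⟨y, z, hy, hz, hyz, h⟩ := h
      exact ⟨⟨y, (hkept y).2 hy⟩, ⟨z, (hkept z).2 hz⟩, fun h => hyz (congrArg Subtype.val h),
        (hHdef _ _).2 h.1, (hHdef _ _).2 h.2⟩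
    have h1 := hb'.2 x; have h2 := hc.2 x; have h3 := hd.2 x
    have hcomm := fun y => G.adj_comm x y
    by_cases hxa : x = a
    · subst hxa
      exact ⟨s, t, (hkept _).1 hsk, (hkept _).1 htk, hst, Or.inl hsa, Or.inr (Or.inl ⟨rfl, rfl⟩)⟩
    by_cases hxt : x = t
    · subst hxt
      obtain ⟨z, hzd, hz⟩ := hb.exists_other hdt.symm
      have := hcomm z
      exact ⟨a, z, (hkept _).1 hak, by grind, by grind, by grind, Or.inl hz⟩
    obtain ⟨y, z, hyz, hy, hz⟩ := hb.two_le hG x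
    have := hcomm y; have := hcomm z
    exact ⟨y, z, by grind, by grind, hyz, Or.inl hy, Or.inl hz⟩
  rcases good_or_bad_of_removed hn hH ⟨⟨a, hak⟩, ⟨t, htk⟩, fun h => hat (congrArg Subtype.val h)⟩
    with ⟨m, hm, A, hA, hs⟩ | hbad
  swap
  · have hadj : ∀ x y, G.Adj x y ↔ (∃ (hx : ∀ i, x ≠ ![b, c, d] i) (hy : ∀ i, y ≠ ![b, c, d] i),
        (removed G ![b, c, d]).Adj ⟨x, hx⟩ ⟨y, hy⟩) ∨ ∃ p ∈ [(a, b), (b, c), (c, d), (d, t)],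
        (x = p.1 ∧ y = p.2) ∨ (x = p.2 ∧ y = p.1) := by
      intro x y
      simp only [SimpleGraph.comap_adj, exists_prop, List.mem_cons, List.not_mem_nil, or_false,
        exists_eq_or_imp, exists_eq_left, hkept]
      have h1 := hb'.2 x; have h2 := hc.2 x; have h3 := hd.2 x
      have h4 := hb'.2 y; have h5 := hc.2 y; have h6 := hd.2 y
      have h7 := G.adj_comm x y
      grind
    obtain ⟨p, hp, ψ, hψ⟩ := (inBadFamily_iff _).1 hbad
    obtain ⟨e, he, her⟩ := exists_numbering hr ψ
    have hψ' : ∀ x y, (removed G ![b, c, d]).Adj x y ↔ codeAdj (p.2.filter fun e =>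
        !codeAdj [((ψ ⟨a, hak⟩ : ℕ), (ψ ⟨t, htk⟩ : ℕ))] e.1 e.2) (ψ x) (ψ y) = true := by
      intro x y
      rw [codeAdj_filter, ← hψ, hHdef, SimpleGraph.comap_adj]
      simp only [← Fin.ext_iff, ψ.injective.eq_iff, Subtype.ext_iff]
      have := G.adj_comm x y
      grind
    have h := hasCode_append (fun e he => badCodes_lt p (List.mem_cons_of_mem _ hp) e
      (List.mem_of_mem_filter he)) hψ' he her _ hadj
    have h0 := her 0; have h1 := her 1; have h2 := her 2
    have hu := he ⟨a, hak⟩; have hv := he ⟨t, htk⟩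
    simp only [Matrix.cons_val] at h0 h1 h2
    simp only [List.map_cons, List.map_nil, h0, h1, h2, hu, hv] at h
    refine good_or_bad_of_checkCode h (check_subdiv p hp _ (ψ _).2 _ (ψ _).2 ?_)
    exact (hψ _ _).1 ((hHdef _ _).2 (Or.inr (Or.inl ⟨rfl, rfl⟩)))
  have hfull : ∀ x, Full H A x := fun x => by
    obtain ⟨y, z, hyz, hy, hz⟩ := htwo x
    exact (hs x).full hyz hy hz
  obtain ⟨B, hB, hBr⟩ := exists_extend hr A
    ![(A ⟨s, hsk⟩ ∪ A ⟨a, hak⟩)ᶜ, A ⟨s, hsk⟩, A ⟨a, hak⟩]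
  have hBb := hBr 0; have hBc := hBr 1; have hBd := hBr 2
  simp only [Matrix.cons_val] at hBb hBc hBd
  rw [← hB, ← hB] at hBb
  rw [← hB] at hBc hBd
  have hcov : ∀ i, i ∈ B a ∨ i ∈ B s ∨ i ∈ B t := by
    intro i
    obtain ⟨⟨w, hwk⟩, hw, hi⟩ := hfull ⟨a, hak⟩ i
    rw [hHdef, Subtype.mk.injEq, ha.2] at hw
    rw [← hB] at hi
    have := (hkept w).1 hwk
    grind
  have hcol : ∀ x : Kept ![b, c, d], #(B x) = 2 * m := fun x => by rw [hB, hA]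
  refine Or.inl (good_of_full G m hm (Fintype.card_fin _) B (fun x => ?_) fun x => ?_)
  · by_cases hx : ∀ i, x ≠ ![b, c, d] i
    · exact (hcol ⟨x, hx⟩).le
    · rw [hkept] at hx
      have : x = b ∨ x = c ∨ x = d := by tauto
      rcases this with rfl | rfl | rfl
      · rw [hBb]
        refine (card_le_card fun i hi => ?_).trans (hcol ⟨t, htk⟩).le
        have := hcov i
        simp only [mem_compl, mem_union] at hi
        tauto
      · rw [hBc]
        exact (hcol ⟨s, hsk⟩).le
      · rw [hBd]
        exact (hcol ⟨a, hak⟩).le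
  · intro i
    have hmemb : i ∈ B b ↔ ¬ (i ∈ B s ∨ i ∈ B a) := by rw [hBb, mem_compl, mem_union]
    have hcovi := hcov i
    by_cases hx : ∀ i, x ≠ ![b, c, d] i
    · by_cases hxa : x = a
      · subst hxa
        by_cases h1 : i ∈ B s
        · exact ⟨s, Or.inr hsa, h1⟩
        by_cases h2 : i ∈ B x
        · exact ⟨x, Or.inl rfl, h2⟩
        exact ⟨b, Or.inr hab, hmemb.2 (by tauto)⟩
      · obtain ⟨⟨w, hwk⟩, hw, hi⟩ := hfull ⟨x, hx⟩ i
        rw [hHdef, Subtype.mk.injEq] at hw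
        rw [← hB] at hi
        rcases hw with h | h | h | ⟨rfl, h⟩
        · exact ⟨w, Or.inl h, hi⟩
        · exact ⟨w, Or.inr h, hi⟩
        · exact absurd h.1 hxa
        · subst h
          exact ⟨d, Or.inr hdt.symm, by rwa [hBd]⟩
    · rw [hkept] at hx
      have : x = b ∨ x = c ∨ x = d := by tauto
      rcases this with rfl | rfl | rfl
      · by_cases h1 : i ∈ B s
        · exact ⟨c, Or.inr hbc, by rwa [hBc]⟩
        by_cases h2 : i ∈ B a
        · exact ⟨a, Or.inr hab.symm, h2⟩
        exact ⟨x, Or.inl rfl, hmemb.2 (by tauto)⟩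
      · by_cases h1 : i ∈ B s
        · exact ⟨x, Or.inl rfl, by rwa [hBc]⟩
        by_cases h2 : i ∈ B a
        · exact ⟨d, Or.inr hcd, by rwa [hBd]⟩
        exact ⟨b, Or.inr hbc.symm, hmemb.2 (by tauto)⟩
      · rcases hcovi with h | h | h
        · exact ⟨x, Or.inl rfl, by rwa [hBd]⟩
        · exact ⟨c, Or.inr hcd.symm, by rwa [hBc]⟩
        · exact ⟨t, Or.inr hdt, h⟩

end

section

lemma card_neighbours_eq {V : Type*} [Fintype V] {G : SimpleGraph V} {n : ℕ} {E : List (ℕ × ℕ)}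
    {ψ : V ≃ Fin n} (hψ : ∀ x y, G.Adj x y ↔ codeAdj E (ψ x) (ψ y) = true) (x : V) :
    codeDeg n E (ψ x) = #{y | G.Adj x y} := by
  rw [codeDeg, ← List.toFinset_card_of_nodup (List.nodup_range.filter _)]
  refine (card_bij (fun y _ => (ψ y : ℕ)) (fun y hy => ?_) (fun y _ z _ h => ?_)
    fun j hj => ?_).symm
  · simpa [← hψ] using hy
  · exact ψ.injective (Fin.ext h)
  · rw [List.mem_toFinset, List.mem_filter, List.mem_range] at hj
    exact ⟨ψ.symm ⟨j, hj.1⟩, by simpa [hψ] using hj.2, by simp⟩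

lemma deg3_iff {V : Type*} [Fintype V] {G : SimpleGraph V} {x : V} :
    Deg3 G x ↔ 3 ≤ #{y | G.Adj x y} := by
  rw [Nat.succ_le_iff, two_lt_card]
  simp only [mem_filter, mem_univ, true_and, Deg3]
  grind

variable {V : Type u} [Fintype V] {G : SimpleGraph V}

lemma good_of_contract_colouring (hG : G.Connected) (hb : Bridgeless G) {u a b v : V}
    (ha : Deg2 G a u b) (hb' : Deg2 G b a v) (hu : Deg3 G u) (hv : Deg3 G v) (huv : u ≠ v)
    (hcom : ∀ t, G.Adj t u → ¬ G.Adj t v) (hind : ∀ x y, Deg3 G x → Deg3 G y → ¬ G.Adj x y)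
    {H : SimpleGraph (Kept ![a, b, v])} (hHdef : ∀ x y, H.Adj x y ↔
      G.Adj x y ∨ (x.1 = u ∧ G.Adj v y) ∨ (y.1 = u ∧ G.Adj v x))
    (huk : ∀ i, u ≠ ![a, b, v] i) {p q : V} (hpk : ∀ i, p ≠ ![a, b, v] i) (hup : G.Adj u p)
    (hqk : ∀ i, q ≠ ![a, b, v] i) (hvq : G.Adj v q) {m : ℕ} (hm : 0 < m)
    {A : Kept ![a, b, v] → Finset (Fin (5 * m))} (hA : ∀ x, #(A x) = 2 * m)
    (hfull : ∀ x, Full H A x) : Good G := by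
  have hau := ha.left; have hab := ha.right; have hbv := hb'.right
  have : Nontrivial V := ⟨a, b, hab.ne⟩
  have hr : Function.Injective ![a, b, v] := by
    intro i j
    have := hab.ne
    have := hbv.ne
    have := hb'.1
    fin_cases i <;> fin_cases j <;> simp_all [eq_comm]
  have hkept : ∀ x, (∀ i, x ≠ ![a, b, v] i) ↔ x ≠ a ∧ x ≠ b ∧ x ≠ v := by
    intro x
    simp [Fin.forall_fin_succ]
  have hnb : ∀ x, x ≠ a → x ≠ b → x ≠ u → x ≠ v → ∀ y, G.Adj x y → y ≠ a ∧ y ≠ b := by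
    intro x h1 h2 h3 h4 y hxy
    have h5 := ha.2 x; have h6 := hb'.2 x; have h7 := hxy.symm
    grind
  obtain ⟨Mu, hMu⟩ : ∃ M : Finset (Fin (5 * m)), ∀ c, c ∈ M ↔
      ∀ y : Kept ![a, b, v], y.1 = u ∨ G.Adj u y → c ∉ A y :=
    ⟨univ.filter fun c => ∀ y : Kept ![a, b, v], y.1 = u ∨ G.Adj u y → c ∉ A y, by simp⟩
  obtain ⟨Mv, hMv⟩ : ∃ M : Finset (Fin (5 * m)), ∀ c, c ∈ M ↔
      ∀ y : Kept ![a, b, v], y.1 = u ∨ G.Adj v y → c ∉ A y :=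
    ⟨univ.filter fun c => ∀ y : Kept ![a, b, v], y.1 = u ∨ G.Adj v y → c ∉ A y, by simp⟩
  have hdisj : Disjoint Mu Mv := by
    rw [disjoint_left]
    intro c hc hc'
    obtain ⟨w, hw, hcw⟩ := hfull ⟨u, huk⟩ c
    rw [hHdef, Subtype.ext_iff] at hw
    have h1 := (hMu c).1 hc w
    have h2 := (hMv c).1 hc' w
    have := G.adj_comm u v
    grind
  have hbound : ∀ (M : Finset (Fin (5 * m))) (w x : V) (hw : w = u ∨ w = v)
      (hx : ∀ i, x ≠ ![a, b, v] i), G.Adj w x →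
      (∀ c ∈ M, c ∉ A ⟨u, huk⟩ ∧ c ∉ A ⟨x, hx⟩) → #M ≤ 2 * m := by
    intro M w x hw hx hwx hM
    have hx' := (hkept x).1 hx
    have hw3 : Deg3 G w := by rcases hw with rfl | rfl <;> assumption
    have hx2 := (hb.deg hG x).resolve_left fun h => hind w x hw3 h hwx
    obtain ⟨y, y', hy⟩ := hx2
    obtain ⟨z, hz⟩ := hy.exists_of_adj hwx.symm
    have hxu : x ≠ u := by
      rintro rfl
      exact hind w x hw3 hu hwx
    have hzk : ∀ i, z ≠ ![a, b, v] i := by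
      rw [hkept]
      have := hnb x hx'.1 hx'.2.1 hxu hx'.2.2 z hz.right
      have := hcom x; have := hz.left; have := hz.right; have := hz.1
      grind
    rw [← hA ⟨z, hzk⟩]
    refine card_le_card fun c hc => ?_
    obtain ⟨t, ht, hct⟩ := hfull ⟨x, hx⟩ c
    rw [hHdef, Subtype.ext_iff, hz.2] at ht
    have htx := (hkept t).1 t.2
    have h1 := hM c hc
    have h2 : t.1 ≠ u := by
      intro h
      obtain rfl : t = ⟨u, huk⟩ := Subtype.ext h
      exact h1.1 hct
    have h3 : t.1 ≠ x := by
      intro h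
      obtain rfl : t = ⟨x, hx⟩ := Subtype.ext h
      exact h1.2 hct
    obtain rfl : t = ⟨z, hzk⟩ := Subtype.ext (by grind)
    exact hct
  have hMu2 := hbound Mu u p (Or.inl rfl) hpk hup fun c hc =>
    ⟨(hMu c).1 hc _ (Or.inl rfl), (hMu c).1 hc _ (Or.inr hup)⟩
  have hMv2 := hbound Mv v q (Or.inr rfl) hqk hvq fun c hc =>
    ⟨(hMv c).1 hc _ (Or.inl rfl), (hMv c).1 hc _ (Or.inr hvq)⟩
  have hX := hA ⟨u, huk⟩
  have hXc : #(A ⟨u, huk⟩)ᶜ = 3 * m := by rw [card_compl, Fintype.card_fin, hX]; omega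
  have hMuX : Mu ⊆ (A ⟨u, huk⟩)ᶜ := fun c hc => mem_compl.2 ((hMu c).1 hc _ (Or.inl rfl))
  have hMvX : Mv ⊆ (A ⟨u, huk⟩)ᶜ := fun c hc => mem_compl.2 ((hMv c).1 hc _ (Or.inl rfl))
  have hsub : Mu ⊆ (A ⟨u, huk⟩)ᶜ \ Mv := fun c hc =>
    mem_sdiff.2 ⟨hMuX hc, disjoint_left.1 hdisj hc⟩
  have hcs := card_sdiff_of_subset hMvX
  have hcu := card_le_card hsub
  obtain ⟨C, hC, hC', hCc⟩ := exists_subsuperset_card_eq hsub (le_max_left #Mu m)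
    (max_le hcu (by omega))
  have hCX : C ⊆ (A ⟨u, huk⟩)ᶜ := hC'.trans sdiff_subset
  have hcD := card_sdiff_of_subset hCX
  obtain ⟨B, hB, hBr⟩ := exists_extend hr A ![C, (A ⟨u, huk⟩)ᶜ \ C, A ⟨u, huk⟩]
  have hBa := hBr 0; have hBb := hBr 1; have hBv := hBr 2
  have hBu := hB ⟨u, huk⟩
  simp only [Matrix.cons_val] at hBa hBb hBv
  refine good_of_full G m hm (Fintype.card_fin _) B (fun x => ?_) fun x i => ?_
  · by_cases hx : ∀ i, x ≠ ![a, b, v] i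
    · rw [hB ⟨x, hx⟩, hA]
    · rw [hkept] at hx
      have : x = a ∨ x = b ∨ x = v := by tauto
      rcases this with rfl | rfl | rfl
      · rw [hBa]
        omega
      · rw [hBb]
        omega
      · rw [hBv, hX]
  · by_cases h1 : i ∈ A ⟨u, huk⟩
    · by_cases hx : ∀ i, x ≠ ![a, b, v] i
      · obtain ⟨w, hw, hi⟩ := hfull ⟨x, hx⟩ i
        rw [hHdef, Subtype.ext_iff] at hw
        rcases hw with h | h | ⟨h, -⟩ | ⟨-, h⟩
        · exact ⟨w, Or.inl h, by rwa [hB]⟩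
        · exact ⟨w, Or.inr h, by rwa [hB]⟩
        · exact ⟨u, Or.inl h.symm, by rwa [hBu]⟩
        · exact ⟨v, Or.inr h.symm, by rwa [hBv]⟩
      · rw [hkept] at hx
        have : x = a ∨ x = b ∨ x = v := by tauto
        rcases this with rfl | rfl | rfl
        · exact ⟨u, Or.inr hau, by rwa [hBu]⟩
        · exact ⟨v, Or.inr hbv, by rwa [hBv]⟩
        · exact ⟨x, Or.inl rfl, by rwa [hBv]⟩
    have h2 : i ∈ B a ∨ i ∈ B b := by
      rw [hBa, hBb, mem_sdiff, mem_compl]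
      tauto
    by_cases hx : ∀ i, x ≠ ![a, b, v] i
    · by_cases hxu : x = u
      · subst hxu
        by_cases hi : i ∈ Mu
        · exact ⟨a, Or.inr hau.symm, by rw [hBa]; exact hC hi⟩
        · rw [hMu] at hi
          push Not at hi
          obtain ⟨y, hy, hi⟩ := hi
          exact ⟨y, hy, by rwa [hB]⟩
      · obtain ⟨w, hw, hi⟩ := hfull ⟨x, hx⟩ i
        rw [hHdef, Subtype.ext_iff] at hw
        have hwu : w.1 ≠ u := by
          intro h
          obtain rfl : w = ⟨u, huk⟩ := Subtype.ext h
          exact h1 hi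
        exact ⟨w, by tauto, by rwa [hB]⟩
    · rw [hkept] at hx
      have : x = a ∨ x = b ∨ x = v := by tauto
      rcases this with rfl | rfl | rfl
      · exact h2.elim (fun h => ⟨x, Or.inl rfl, h⟩) fun h => ⟨b, Or.inr hab, h⟩
      · exact h2.elim (fun h => ⟨a, Or.inr hab.symm, h⟩) fun h => ⟨x, Or.inl rfl, h⟩
      · by_cases hi : i ∈ Mv
        · refine ⟨b, Or.inr hbv.symm, ?_⟩
          rw [hBb, mem_sdiff]
          exact ⟨hMvX hi, fun h => (mem_sdiff.1 (hC' h)).2 hi⟩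
        · rw [hMv] at hi
          push Not at hi
          obtain ⟨y, hy, hi⟩ := hi
          have : y.1 ≠ u := by
            intro h
            obtain rfl : y = ⟨u, huk⟩ := Subtype.ext h
            exact h1 hi
          exact ⟨y, Or.inr (by tauto), by rwa [hB]⟩

lemma good_of_contract (hn : GoodBelow.{u} (Fintype.card V)) (hG : G.Connected)
    (hb : Bridgeless G) {u a b v : V} (ha : Deg2 G a u b) (hb' : Deg2 G b a v) (hu : Deg3 G u)
    (hv : Deg3 G v) (huv : u ≠ v) (hcom : ∀ t, G.Adj t u → ¬ G.Adj t v)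
    (hind : ∀ x y, Deg3 G x → Deg3 G y → ¬ G.Adj x y)
    (hpath : ∀ x y z, x ≠ z → G.Adj x y → G.Adj y z → Deg3 G x ∨ Deg3 G y ∨ Deg3 G z) :
    Good G := by
  have hau := ha.left; have hab := ha.right; have hbv := hb'.right
  have hub := ha.1; have hav := hb'.1
  have huvn := hind u v hu hv
  have hvv := G.loopless.irrefl v
  have huu := G.loopless.irrefl u
  have : Nontrivial V := ⟨a, b, hab.ne⟩
  have hkept : ∀ x, (∀ i, x ≠ ![a, b, v] i) ↔ x ≠ a ∧ x ≠ b ∧ x ≠ v := by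
    intro x
    simp [Fin.forall_fin_succ]
  have huk : ∀ i, u ≠ ![a, b, v] i := (hkept u).2 ⟨hau.ne', hub, huv⟩
  obtain ⟨H, hHdef⟩ : ∃ H : SimpleGraph (Kept ![a, b, v]), ∀ x y, H.Adj x y ↔
      G.Adj x y ∨ (x.1 = u ∧ G.Adj v y) ∨ (y.1 = u ∧ G.Adj v x) := by
    refine ⟨⟨fun x y => G.Adj x y ∨ (x.1 = u ∧ G.Adj v y) ∨ (y.1 = u ∧ G.Adj v x),
      ⟨fun x y h => ?_⟩, ⟨fun x h => ?_⟩⟩, fun x y => Iff.rfl⟩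
    · have := G.adj_comm x y
      tauto
    · have := G.loopless.irrefl x
      have := G.adj_comm u v
      grind
  have hnb : ∀ x, x ≠ a → x ≠ b → x ≠ u → x ≠ v → ∀ y, G.Adj x y → y ≠ a ∧ y ≠ b := by
    intro x h1 h2 h3 h4 y hxy
    have h5 := ha.2 x; have h6 := hb'.2 x; have h7 := hxy.symm
    grind
  have hnbu : ∀ y, G.Adj u y → y ≠ a → y ≠ b ∧ y ≠ v := by
    intro y hy hya
    have h6 := hb'.2 u; have h7 := hy.symm; have := hau.ne
    grind
  have hnbv : ∀ y, G.Adj v y → y ≠ b → y ≠ a ∧ y ≠ v ∧ y ≠ u := by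
    intro y hy hyb
    have h6 := ha.2 v; have h7 := hy.symm; have := hbv.ne
    grind
  have hpu : ∃ p q, p ≠ q ∧ G.Adj u p ∧ G.Adj u q ∧ p ≠ a ∧ q ≠ a := by
    obtain ⟨p, q, r, h⟩ := hu
    grind
  have hpv : ∃ p q, p ≠ q ∧ G.Adj v p ∧ G.Adj v q ∧ p ≠ b ∧ q ≠ b := by
    obtain ⟨p, q, r, h⟩ := hv
    grind
  obtain ⟨p, p₂, hpp, hup, hup₂, hpa, hpa₂⟩ := hpu
  obtain ⟨q, q₂, hqq, hvq, hvq₂, hqb, hqb₂⟩ := hpv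
  have hpk : ∀ i, p ≠ ![a, b, v] i := (hkept p).2 ⟨hpa, hnbu p hup hpa⟩
  have hpk₂ : ∀ i, p₂ ≠ ![a, b, v] i := (hkept p₂).2 ⟨hpa₂, hnbu p₂ hup₂ hpa₂⟩
  have hqk : ∀ i, q ≠ ![a, b, v] i := (hkept q).2 (by have := hnbv q hvq hqb; tauto)
  have hqk₂ : ∀ i, q₂ ≠ ![a, b, v] i := (hkept q₂).2 (by have := hnbv q₂ hvq₂ hqb₂; tauto)
  have hH : H.Connected := by
    refine connected_of_map hG (fun x => if h : ∀ i, x ≠ ![a, b, v] i then ⟨x, h⟩ else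
      ⟨u, huk⟩) (fun x => ⟨x, dif_pos x.2⟩) fun x y hxy => ?_
    have hyx := hxy.symm
    have h1 := ha.2 x; have h2 := hb'.2 x
    have h5 := ha.2 y; have h6 := hb'.2 y
    simp only [hHdef]
    by_cases hx : ∀ i, x ≠ ![a, b, v] i <;> by_cases hy : ∀ i, y ≠ ![a, b, v] i
    · rw [dif_pos hx, dif_pos hy]
      exact Or.inr (Or.inl hxy)
    · rw [dif_pos hx, dif_neg hy, Subtype.mk.injEq]
      rw [hkept] at hx hy
      grind
    · rw [dif_neg hx, dif_pos hy, Subtype.mk.injEq]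
      rw [hkept] at hx hy
      grind
    · rw [dif_neg hx, dif_neg hy]
      exact Or.inl rfl
  have hlift : ∀ x : Kept ![a, b, v], x.1 ≠ u → ∃ f : V → Kept ![a, b, v],
      (∀ y, G.Adj x y → H.Adj x (f y)) ∧ ∀ y z, G.Adj x y → G.Adj x z → f y = f z → y = z := by
    intro x hxu
    have hx := (hkept x).1 x.2
    have hxn := hnb x hx.1 hx.2.1 hxu hx.2.2
    refine ⟨fun y => if h : ∀ i, y ≠ ![a, b, v] i then ⟨y, h⟩ else ⟨u, huk⟩, fun y hy => ?_,
      fun y z hy hz => ?_⟩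
    · have := hxn y hy
      have := hy.symm
      dsimp only
      split_ifs with h
      · exact (hHdef _ _).2 (Or.inl hy)
      · refine (hHdef _ _).2 (Or.inr (Or.inr ⟨rfl, ?_⟩))
        rw [hkept] at h
        grind
    · have := hxn y hy; have := hxn z hz; have := hcom x
      dsimp only
      split_ifs with h h' h' <;> simp only [hkept] at h h' <;> simp only [Subtype.mk.injEq] <;>
        grind
  have htwo : ∀ x : Kept ![a, b, v], ∃ y z : Kept ![a, b, v], y ≠ z ∧ H.Adj x y ∧ H.Adj x z := by
    intro x
    by_cases hxu : x.1 = u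
    · obtain rfl : x = ⟨u, huk⟩ := Subtype.ext hxu
      exact ⟨⟨p, hpk⟩, ⟨p₂, hpk₂⟩, fun h => hpp (congrArg Subtype.val h),
        (hHdef _ _).2 (Or.inl hup),
        (hHdef _ _).2 (Or.inl hup₂)⟩
    · obtain ⟨f, hf, hfi⟩ := hlift x hxu
      obtain ⟨y, z, hyz, hy, hz⟩ := hb.two_le hG x
      exact ⟨f y, f z, fun h => hyz (hfi y z hy hz h), hf y hy, hf z hz⟩
  rcases good_or_bad_of_removed hn hH ⟨⟨u, huk⟩, ⟨p, hpk⟩, fun h => hup.ne (congrArg Subtype.val h)⟩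
    with ⟨m, hm, A, hA, hs⟩ | hbad
  swap
  · obtain ⟨P, hP, ψ, hψ⟩ := (inBadFamily_iff _).1 hbad
    have hcard := card_neighbours_eq hψ
    have hup3 : ∀ x : Kept ![a, b, v], x.1 ≠ u → Deg3 G x → Deg3 H x := by
      rintro x hxu ⟨y, z, w, hyz, hyw, hzw, hy, hz, hw⟩
      obtain ⟨f, hf, hfi⟩ := hlift x hxu
      exact ⟨f y, f z, f w, fun h => hyz (hfi y z hy hz h), fun h => hyw (hfi y w hy hw h),
        fun h => hzw (hfi z w hz hw h), hf y hy, hf z hz, hf w hw⟩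
    have hdown3 : ∀ x : Kept ![a, b, v], Deg3 H x → Deg3 G x := by
      rintro x ⟨y, z, w, hyz, hyw, hzw, hy, hz, hw⟩
      by_cases hxu : x.1 = u
      · rwa [hxu]
      · have hx := (hkept x).1 x.2
        have hc : ∀ y, H.Adj x y → G.Adj x y ∨ (y.1 = u ∧ G.Adj x v) := by
          intro y hy
          have := (hHdef x y).1 hy
          have := G.adj_comm x v
          tauto
        have := hc y hy; have := hc z hz; have := hc w hw
        have := (hkept y).1 y.2; have := (hkept z).1 z.2; have := (hkept w).1 w.2
        rw [Ne, Subtype.ext_iff] at hyz hyw hzw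
        have hg : ∀ y z w : V, y ≠ z → y ≠ w → z ≠ w → G.Adj x y → G.Adj x z → G.Adj x w →
            Deg3 G x := fun y z w h1 h2 h3 h4 h5 h6 => ⟨y, z, w, h1, h2, h3, h4, h5, h6⟩
        have := hg y z w; have := hg v z w; have := hg y v w; have := hg y z v
        grind
    have hdeg4 : 4 ≤ #{y | H.Adj ⟨u, huk⟩ y} := by
      have hne : p ≠ q ∧ p ≠ q₂ ∧ p₂ ≠ q ∧ p₂ ≠ q₂ :=
        ⟨fun h => hcom p hup.symm (h ▸ hvq.symm), fun h => hcom p hup.symm (h ▸ hvq₂.symm),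
          fun h => hcom p₂ hup₂.symm (h ▸ hvq.symm), fun h => hcom p₂ hup₂.symm (h ▸ hvq₂.symm)⟩
      have h4 : #({⟨p, hpk⟩, ⟨p₂, hpk₂⟩, ⟨q, hqk⟩, ⟨q₂, hqk₂⟩} : Finset (Kept ![a, b, v])) = 4 := by
        rw [card_insert_of_notMem, card_insert_of_notMem, card_pair] <;>
          simp only [mem_insert, mem_singleton, Subtype.mk.injEq, ne_eq] <;> grind
      rw [← h4]
      refine card_le_card fun y hy => ?_
      simp only [mem_insert, mem_singleton] at hy
      rw [mem_filter, hHdef]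
      rcases hy with rfl | rfl | rfl | rfl
      · exact ⟨mem_univ _, Or.inl hup⟩
      · exact ⟨mem_univ _, Or.inl hup₂⟩
      · exact ⟨mem_univ _, Or.inr (Or.inl ⟨rfl, hvq⟩)⟩
      · exact ⟨mem_univ _, Or.inr (Or.inl ⟨rfl, hvq₂⟩)⟩
    have hsurj : ∀ i < P.1, ∃ x, (ψ x : ℕ) = i := fun i hi => ⟨ψ.symm ⟨i, hi⟩, by simp⟩
    rcases check_contract P hP _ (ψ ⟨u, huk⟩).2 (by rwa [hcard]) with
      ⟨i, hi, j, hj, hij, h1, h2⟩ | ⟨i, hi, j, hj, k, hk, hik, hij, hjk, h1, h2, h3⟩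
    · obtain ⟨x, rfl⟩ := hsurj i hi
      obtain ⟨y, rfl⟩ := hsurj j hj
      rw [← hψ, hHdef] at hij
      rw [hcard, ← deg3_iff] at h1 h2
      rcases hij with h | ⟨-, h⟩ | ⟨-, h⟩
      · exact absurd h (hind _ _ (hdown3 x h1) (hdown3 y h2))
      · exact absurd h (hind _ _ hv (hdown3 y h2))
      · exact absurd h (hind _ _ hv (hdown3 x h1))
    · obtain ⟨x, rfl⟩ := hsurj i hi
      obtain ⟨y, rfl⟩ := hsurj j hj
      obtain ⟨z, rfl⟩ := hsurj k hk
      rw [← hψ, hHdef] at hij hjk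
      rw [hcard] at h1 h2 h3
      have hsmall : ∀ x, #{y | H.Adj x y} ≤ 2 → x.1 ≠ u ∧ ¬ Deg3 G x := by
        intro x hx
        have hxu : x.1 ≠ u := fun h => by
          obtain rfl : x = ⟨u, huk⟩ := Subtype.ext h
          omega
        refine ⟨hxu, fun h => ?_⟩
        have := deg3_iff.1 (hup3 x hxu h)
        omega
      have := hsmall x h1; have := hsmall y h2; have := hsmall z h3
      have := hpath x y z fun h => hik (by rw [Subtype.ext h])
      tauto
  have hfull : ∀ x, Full H A x := fun x => by
    obtain ⟨y, z, hyz, hy, hz⟩ := htwo x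
    exact (hs x).full hyz hy hz
  exact good_of_contract_colouring hG hb ha hb' hu hv huv hcom hind hHdef huk hpk hup hqk
    hvq hm hA hfull

end

section

variable {V : Type*} [Fintype V]

/-- The probability of an event under a uniformly random map to five values. -/
noncomputable def pr (F : (V → Fin 5) → Prop) : ℚ :=
  #(univ.filter F) / 5 ^ Fintype.card V

lemma pr_eq (F : (V → Fin 5) → Prop) [DecidablePred F] :
    pr F = #(univ.filter F) / 5 ^ Fintype.card V := by
  unfold pr
  congr!

lemma pr_mono {F F' : (V → Fin 5) → Prop} (h : ∀ g, F g → F' g) : pr F ≤ pr F' := by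
  unfold pr
  gcongr with g hg
  exact h g

lemma pr_nonneg (F : (V → Fin 5) → Prop) : 0 ≤ pr F := by
  unfold pr
  positivity

lemma pr_false {F : (V → Fin 5) → Prop} (h : ∀ g, ¬ F g) : pr F = 0 := by
  simp [pr, h]

lemma pr_or_le (F F' : (V → Fin 5) → Prop) : pr (fun g => F g ∨ F' g) ≤ pr F + pr F' := by
  unfold pr
  rw [← add_div, ← Nat.cast_add]
  gcongr
  refine (card_le_card fun g hg => ?_).trans (card_union_le _ _)
  simpa using hg

lemma pr_pi (S : Finset V) (T : V → Finset (Fin 5)) :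
    pr (fun g => ∀ i ∈ S, g i ∈ T i) = ∏ i ∈ S, (#(T i) / 5 : ℚ) := by
  have h : univ.filter (fun g : V → Fin 5 => ∀ i ∈ S, g i ∈ T i) =
      Fintype.piFinset fun i => if i ∈ S then T i else univ := by
    ext g
    simp only [mem_filter, mem_univ, true_and, Fintype.mem_piFinset]
    refine forall_congr' fun i => ?_
    split_ifs with hi <;> simp [hi]
  have h5 : (5 : ℚ) ^ Fintype.card V = ∏ _i : V, 5 := by simp
  rw [pr_eq, h, Fintype.card_piFinset, Nat.cast_prod, h5, ← prod_div_distrib]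
  rw [← prod_subset (subset_univ S)]
  · exact prod_congr rfl fun i hi => by rw [if_pos hi]
  · intro i _ hi
    simp [hi]

lemma pr_one (x : V) (p : Fin 5 → Prop) [DecidablePred p] :
    pr (fun g => p (g x)) = #(univ.filter p) / 5 := by
  have h := pr_pi {x} fun _ => univ.filter p
  simpa using h

lemma pr_two {x y : V} (hxy : x ≠ y) (p q : Fin 5 → Prop) [DecidablePred p] [DecidablePred q] :
    pr (fun g => p (g x) ∧ q (g y)) = #(univ.filter p) / 5 * (#(univ.filter q) / 5) := by
  have h := pr_pi {x, y} fun i => univ.filter (if i = x then p else q)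
  rw [prod_pair hxy] at h
  simpa [hxy, hxy.symm] using h

lemma pr_four {x y z w : V} (hxy : x ≠ y) (hxz : x ≠ z) (hxw : x ≠ w) (hyz : y ≠ z) (hyw : y ≠ w)
    (hzw : z ≠ w) (p q r s : Fin 5 → Prop) [DecidablePred p] [DecidablePred q]
    [DecidablePred r] [DecidablePred s] :
    pr (fun g => p (g x) ∧ q (g y) ∧ r (g z) ∧ s (g w)) =
      #(univ.filter p) / 5 * (#(univ.filter q) / 5 * (#(univ.filter r) / 5 *
        (#(univ.filter s) / 5))) := by
  have h := pr_pi {x, y, z, w} fun i =>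
    univ.filter (if i = x then p else if i = y then q else if i = z then r else s)
  rw [prod_insert (by simp [*]), prod_insert (by simp [*]), prod_pair hzw] at h
  simpa [hxy.symm, hxz.symm, hxw.symm, hyz.symm, hyw.symm, hzw.symm] using h

/-- The number of values for which a vertex is selected. -/
noncomputable def threshold (P : Prop) (b : Bool) : ℕ := if P then (if b then 3 else 1) else 2

lemma card_lt_threshold (P : Prop) (b : Bool) :
    #(univ.filter fun i : Fin 5 => i.1 < threshold P b) = threshold P b := by
  have h : ∀ t < 5, #(univ.filter fun i : Fin 5 => i.1 < t) = t := by decide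
  refine h _ ?_
  unfold threshold
  split_ifs <;> norm_num

lemma card_not_lt_threshold (P : Prop) (b : Bool) :
    (#(univ.filter fun i : Fin 5 => ¬ i.1 < threshold P b) : ℚ) = 5 - threshold P b := by
  have h := card_filter_add_card_filter_not (s := univ) fun i : Fin 5 => i.1 < threshold P b
  rw [card_lt_threshold, card_univ, Fintype.card_fin] at h
  rw [eq_sub_iff_add_eq, add_comm]
  exact_mod_cast h

lemma good_of_pr [Nonempty V] {G : SimpleGraph V}
    (A : V → Bool → Bool → Fin 3 → (V → Fin 5) → Prop)
    (hfull : ∀ v b h s g, ∃ u, (u = v ∨ G.Adj v u) ∧ A u b h s g)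
    (hA : ∀ v, ∑ b, ∑ h, ∑ s, pr (A v b h s) ≤ 24 / 5) : Good G := by
  have hκ : Fintype.card (Bool × Bool × Fin 3 × (V → Fin 5)) =
      5 * (12 * 5 ^ (Fintype.card V - 1)) := by
    have : 5 ^ Fintype.card V = 5 ^ (Fintype.card V - 1) * 5 := by
      rw [← pow_succ, Nat.sub_add_cancel Fintype.card_pos]
    simp only [Fintype.card_prod, Fintype.card_bool, Fintype.card_fin, Fintype.card_fun, this]
    ring
  refine good_of_full G (12 * 5 ^ (Fintype.card V - 1)) (by positivity) hκ
    (fun v => univ.filter fun c => A v c.1 c.2.1 c.2.2.1 c.2.2.2) (fun v => ?_) fun v c => ?_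
  · have h := hA v
    have h5 : (0 : ℚ) < 5 ^ Fintype.card V := by positivity
    have hsum : (#(univ.filter fun c : Bool × Bool × Fin 3 × (V → Fin 5) =>
        A v c.1 c.2.1 c.2.2.1 c.2.2.2) : ℚ) =
          (∑ b, ∑ h, ∑ s, pr (A v b h s)) * 5 ^ Fintype.card V := by
      simp only [pr, sum_mul, div_mul_cancel₀ _ h5.ne', card_filter, Fintype.sum_prod_type]
      push_cast
      rfl
    have : (#(univ.filter fun c : Bool × Bool × Fin 3 × (V → Fin 5) =>
        A v c.1 c.2.1 c.2.2.1 c.2.2.2) : ℚ) ≤ 2 * (12 * 5 ^ (Fintype.card V - 1)) := by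
      rw [hsum]
      refine (mul_le_mul_of_nonneg_right h h5.le).trans (le_of_eq ?_)
      obtain ⟨n, hn⟩ := Nat.exists_eq_succ_of_ne_zero (Fintype.card_ne_zero (α := V))
      rw [hn, Nat.succ_eq_add_one, Nat.add_sub_cancel, pow_succ]
      ring
    exact_mod_cast this
  · obtain ⟨u, hu, h⟩ := hfull v c.1 c.2.1 c.2.2.1 c.2.2.2
    exact ⟨u, hu, by simpa using h⟩

/-- The vertex `u` has at least three neighbours and an edge between two vertices without this
property starts next to it. -/
def Special (G : SimpleGraph V) (u : V) : Prop :=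
  Deg3 G u ∧ ∃ a w, Deg2 G a u w ∧ ¬ Deg3 G w

/-- The vertex `u` is selected. -/
def Chosen (G : SimpleGraph V) (b : Bool) (g : V → Fin 5) (u : V) : Prop :=
  (g u).1 < threshold (Special G u) b

/-- The vertex `u` is not selected, but all vertices at distance two are. -/
def Missed (G : SimpleGraph V) (b : Bool) (g : V → Fin 5) (u : V) : Prop :=
  ¬ Chosen G b g u ∧ ∀ a v, Deg2 G a u v → Chosen G b g v

lemma pr_chosen (G : SimpleGraph V) (b : Bool) (u : V) :
    pr (fun g => Chosen G b g u) = threshold (Special G u) b / 5 := by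
  rw [← card_lt_threshold]
  exact pr_one u fun i => i.1 < threshold (Special G u) b

lemma pr_not_chosen_and_not_chosen (G : SimpleGraph V) (b : Bool) {u v : V} (huv : u ≠ v) :
    pr (fun g => ¬ Chosen G b g u ∧ ¬ Chosen G b g v) =
      (5 - threshold (Special G u) b) / 5 * ((5 - threshold (Special G v) b) / 5) := by
  rw [← card_not_lt_threshold, ← card_not_lt_threshold]
  exact pr_two huv (fun i => ¬ i.1 < threshold (Special G u) b)
    fun i => ¬ i.1 < threshold (Special G v) b

lemma pr_not_chosen_and_chosen (G : SimpleGraph V) (b : Bool) {u v : V} (huv : u ≠ v) :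
    pr (fun g => ¬ Chosen G b g u ∧ Chosen G b g v) =
      (5 - threshold (Special G u) b) / 5 * (threshold (Special G v) b / 5) := by
  rw [← card_not_lt_threshold, ← card_lt_threshold (Special G v)]
  exact pr_two huv (fun i => ¬ i.1 < threshold (Special G u) b)
    fun i => i.1 < threshold (Special G v) b

variable {G : SimpleGraph V}

lemma sum_pr_missed_le (hdeg : ∀ v, Deg3 G v ∨ ∃ a b, Deg2 G v a b)
    (hind : ∀ x y, Deg3 G x → Deg3 G y → ¬ G.Adj x y)
    (htwin : ∀ a a' u v, Deg3 G u → Deg3 G v → Deg2 G a u v → Deg2 G a' u v → a = a')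
    {a u v : V} (ha : Deg2 G a u v) (hu : Deg3 G u) (hP : ¬ Special G u) :
    ∑ b, pr (fun g => Missed G b g u) ≤ if Special G v then 84 / 625 else 60 / 625 := by
  have hd : ∀ a v, Deg2 G a u v → Deg3 G v := fun a v h => by
    by_contra hv
    exact hP ⟨hu, a, v, h, hv⟩
  have hnb : ∃ x y, x ≠ y ∧ x ≠ a ∧ y ≠ a ∧ G.Adj u x ∧ G.Adj u y := by
    obtain ⟨p, q, r, h⟩ := hu
    grind
  have hend : ∀ x, G.Adj u x → ∃ w, Deg2 G x u w := by
    intro x hx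
    obtain ⟨p, q, h⟩ := (hdeg x).resolve_left fun h => hind u x hu h hx
    exact h.exists_of_adj hx.symm
  obtain ⟨x, y, hxy, hxa, hya, hx, hy⟩ := hnb
  obtain ⟨w, hw⟩ := hend x hx
  obtain ⟨z, hz⟩ := hend y hy
  have hvw : v ≠ w := by
    rintro rfl
    exact hxa (htwin x a u v hu (hd _ _ ha) hw ha)
  have hvz : v ≠ z := by
    rintro rfl
    exact hya (htwin y a u v hu (hd _ _ ha) hz ha)
  have hwz : w ≠ z := by
    rintro rfl
    exact hxy (htwin x y u w hu (hd _ _ hw) hw hz)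
  have hle : ∀ b, pr (fun g => Missed G b g u) ≤ (5 - threshold (Special G u) b) / 5 *
      (threshold (Special G v) b / 5 * (threshold (Special G w) b / 5 *
        (threshold (Special G z) b / 5))) := by
    intro b
    rw [← card_not_lt_threshold, ← card_lt_threshold (Special G v),
      ← card_lt_threshold (Special G w), ← card_lt_threshold (Special G z)]
    rw [← pr_four ha.1 hw.1 hz.1 hvw hvz hwz]
    exact pr_mono fun g hg => ⟨hg.1, hg.2 a v ha, hg.2 x w hw, hg.2 y z hz⟩
  refine (sum_le_sum fun b _ => hle b).trans ?_
  simp only [Fintype.sum_bool, threshold, hP]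
  split_ifs <;> norm_num at *

end

lemma good_of_independent {V : Type*} [Fintype V] [Nonempty V] {G : SimpleGraph V}
    (hdeg : ∀ v, Deg3 G v ∨ ∃ a b, Deg2 G v a b)
    (hind : ∀ x y, Deg3 G x → Deg3 G y → ¬ G.Adj x y)
    (htwin : ∀ a a' u v, Deg3 G u → Deg3 G v → Deg2 G a u v → Deg2 G a' u v → a = a')
    (hthread : ∀ a b u v, Deg2 G a u b → Deg2 G b a v →
      Deg3 G u ∧ Deg3 G v ∧ u ≠ v ∧ ∃ t, G.Adj t u ∧ G.Adj t v) : Good G := by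
  have hend : ∀ {u a}, Deg3 G u → G.Adj u a → ∃ v, Deg2 G a u v := by
    intro u a hu ha
    obtain ⟨p, q, h⟩ := (hdeg a).resolve_left fun h => hind u a hu h ha
    exact h.exists_of_adj ha.symm
  have hnb : ∀ u, ∃ q : Fin 3 → V, Deg3 G u → Function.Injective q ∧ ∀ i, G.Adj u (q i) := by
    intro u
    by_cases hu : Deg3 G u
    · obtain ⟨x, y, z, hxy, hxz, hyz, hx, hy, hz⟩ := hu
      refine ⟨![x, y, z], fun _ => ⟨fun i j h => ?_, fun i => ?_⟩⟩
      · fin_cases i <;> fin_cases j <;> simp_all [eq_comm]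
      · fin_cases i <;> assumption
    · exact ⟨fun _ => u, fun h => absurd h hu⟩
  choose q hq using hnb
  obtain ⟨o, ho⟩ : ∃ o : V → V → Bool, ∀ a b, a ≠ b → o b a = !o a b := by
    refine ⟨fun a b => decide (Fintype.equivFin V a < Fintype.equivFin V b), fun a b hab => ?_⟩
    have := (Fintype.equivFin V).injective.ne hab
    simp only [← decide_not, decide_eq_decide]
    omega
  let Split (b : Bool) (g : V → Fin 5) (h : Bool) (a : V) : Prop := ∃ u c v, Deg2 G a u c ∧
    Deg2 G c a v ∧ ¬ Chosen G b g u ∧ (Chosen G b g v ∨ h = o a c)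
  let Single (b : Bool) (g : V → Fin 5) (s : Fin 3) (a u : V) : Prop :=
    (¬ Special G u ∧ q u s = a) ∧ Missed G b g u
  let Mid (b : Bool) (g : V → Fin 5) (s : Fin 3) (a : V) : Prop :=
    (∀ u, G.Adj a u → ¬ Chosen G b g u) ∨ ∃ u, G.Adj a u ∧ Single b g s a u
  let A (x : V) (b h : Bool) (s : Fin 3) (g : V → Fin 5) : Prop :=
    if Deg3 G x then Chosen G b g x else if ∃ c, G.Adj x c ∧ ¬ Deg3 G c then Split b g h x else
      Mid b g s x
  have hA3 : ∀ {x b h s g}, Deg3 G x → (A x b h s g ↔ Chosen G b g x) := fun hx => by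
    simp only [A, if_pos hx]
  have hA2 : ∀ {x c b h s g}, ¬ Deg3 G x → G.Adj x c → ¬ Deg3 G c →
      (A x b h s g ↔ Split b g h x) := fun {x c} _ _ _ _ hx hxc hc => by
    simp only [A, if_neg hx, if_pos (⟨c, hxc, hc⟩ : ∃ c, G.Adj x c ∧ ¬ Deg3 G c)]
  have hA1 : ∀ {x b h s g}, ¬ Deg3 G x → (∀ c, G.Adj x c → Deg3 G c) →
      (A x b h s g ↔ Mid b g s x) := fun {x} _ _ _ _ hx hxc => by
    have : ¬ ∃ c, G.Adj x c ∧ ¬ Deg3 G c := by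
      push Not
      exact hxc
    simp only [A, if_neg hx, if_neg this]
  have hother : ∀ {a u c}, Deg2 G a u c → ¬ Deg3 G c → ∃ v, Deg2 G c a v ∧ Deg3 G u ∧ Deg3 G v ∧
      u ≠ v ∧ ∃ t, G.Adj t u ∧ G.Adj t v := by
    intro a u c ha hc
    obtain ⟨p, r, h⟩ := (hdeg c).resolve_left hc
    obtain ⟨v, hv⟩ := h.exists_of_adj ha.right.symm
    exact ⟨v, hv, hthread a c u v ha hv⟩
  have hone : ∀ {a u v}, Deg2 G a u v → Deg3 G u → Deg3 G v → ∀ c, G.Adj a c → Deg3 G c := by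
    intro a u v ha hu hv c hc
    rcases (ha.2 c).1 hc with rfl | rfl <;> assumption
  have hmid : ∀ {a u v b h s g}, Deg2 G a u v → Deg3 G u → Deg3 G v → ¬ Chosen G b g u →
      ¬ Chosen G b g v → A a b h s g := by
    intro a u v b h s g ha hu hv hu' hv'
    refine (hA1 ha.not_deg3 (hone ha hu hv)).2 (Or.inl fun w hw => ?_)
    rcases (ha.2 w).1 hw with rfl | rfl <;> assumption
  refine good_of_pr A (fun x b h s g => ?_) fun x => ?_
  · by_cases hx : Deg3 G x
    · by_cases hxc : Chosen G b g x
      · exact ⟨x, Or.inl rfl, (hA3 hx).2 hxc⟩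
      by_cases hP : Special G x
      · obtain ⟨-, a, c, ha, hc⟩ := hP
        obtain ⟨v, hv, -, hv3, hxv, t, htx, htv⟩ := hother ha hc
        by_cases hvc : Chosen G b g v
        · exact ⟨a, Or.inr ha.left.symm, (hA2 ha.not_deg3 ha.right hc).2
            ⟨x, c, v, ha, hv, hxc, Or.inl hvc⟩⟩
        · obtain ⟨w, hw⟩ := hend hx htx.symm
          obtain rfl := hw.eq_of_adj htv hxv.symm
          exact ⟨t, Or.inr htx.symm, hmid hw hx hv3 hxc hvc⟩
      · have hd : ∀ a v, Deg2 G a x v → Deg3 G v := fun a v h => by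
          by_contra hv
          exact hP ⟨hx, a, v, h, hv⟩
        by_cases hM : Missed G b g x
        · obtain ⟨v, hv⟩ := hend hx ((hq x hx).2 s)
          exact ⟨q x s, Or.inr hv.left.symm, (hA1 hv.not_deg3 (hone hv hx (hd _ _ hv))).2
            (Or.inr ⟨x, hv.left, ⟨hP, rfl⟩, hM⟩)⟩
        · simp only [Missed, not_and, not_forall] at hM
          obtain ⟨a, v, ha, hv⟩ := hM hxc
          exact ⟨a, Or.inr ha.left.symm, hmid ha hx (hd _ _ ha) hxc hv⟩
    · by_cases hx2 : ∃ c, G.Adj x c ∧ ¬ Deg3 G c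
      · obtain ⟨c, hxc, hc⟩ := hx2
        obtain ⟨p, r, h2⟩ := (hdeg x).resolve_left hx
        obtain ⟨u, hu⟩ := h2.exists_of_adj hxc
        obtain ⟨v, hv, hu3, hv3, huv, -⟩ := hother hu.symm hc
        by_cases huc : Chosen G b g u
        · exact ⟨u, Or.inr hu.right, (hA3 hu3).2 huc⟩
        by_cases h' : Chosen G b g v ∨ h = o x c
        · exact ⟨x, Or.inl rfl, (hA2 hx hxc hc).2 ⟨u, c, v, hu.symm, hv, huc, h'⟩⟩
        push Not at h'
        refine ⟨c, Or.inr hxc, (hA2 hc hxc.symm hx).2 ⟨v, x, u, hv.symm, hu, h'.1, Or.inr ?_⟩⟩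
        rw [ho _ _ hxc.ne]
        exact Bool.eq_not.2 h'.2
      · push Not at hx2
        obtain ⟨u, v, ha⟩ := (hdeg x).resolve_left hx
        have hu := hx2 u ha.left
        have hv := hx2 v ha.right
        by_cases huc : Chosen G b g u
        · exact ⟨u, Or.inr ha.left, (hA3 hu).2 huc⟩
        by_cases hvc : Chosen G b g v
        · exact ⟨v, Or.inr ha.right, (hA3 hv).2 hvc⟩
        exact ⟨x, Or.inl rfl, hmid ha hu hv huc hvc⟩
  · by_cases hx : Deg3 G x
    · have hle : ∀ b h s, pr (A x b h s) ≤ threshold (Special G x) b / 5 := fun b h s =>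
        (pr_mono fun g hg => (hA3 hx).1 hg).trans (pr_chosen G b x).le
      refine (sum_le_sum fun b _ => sum_le_sum fun h _ => sum_le_sum fun s _ => hle b h s).trans ?_
      simp only [sum_const, card_univ, Fintype.card_bool, Fintype.card_fin, Fintype.sum_bool,
        threshold]
      split_ifs <;> norm_num at *
    by_cases hx2 : ∃ c, G.Adj x c ∧ ¬ Deg3 G c
    · obtain ⟨c, hxc, hc⟩ := hx2
      obtain ⟨p, r, h2⟩ := (hdeg x).resolve_left hx
      obtain ⟨u, hu⟩ := h2.exists_of_adj hxc
      obtain ⟨v, hv, hu3, hv3, huv, -⟩ := hother hu.symm hc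
      have hPu : Special G u := ⟨hu3, x, c, hu.symm, hc⟩
      have hPv : Special G v := ⟨hv3, c, x, hv.symm, hx⟩
      have hle : ∀ b h s, pr (A x b h s) ≤ pr (fun g => ¬ Chosen G b g u ∧ Chosen G b g v) +
          if h = o x c then pr (fun g => ¬ Chosen G b g u ∧ ¬ Chosen G b g v) else 0 := by
        intro b h s
        have key : ∀ g, A x b h s g → (¬ Chosen G b g u ∧ Chosen G b g v) ∨
            (h = o x c ∧ ¬ Chosen G b g u ∧ ¬ Chosen G b g v) := by
          intro g hg
          obtain ⟨u', c', v', h1, h2, h3, h4⟩ := (hA2 hx hxc hc).1 hg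
          have h5 := (hthread x c' u' v' h1 h2).1
          obtain rfl : u' = u := hu.eq_of_adj h1.left fun h => hc (h ▸ h5)
          obtain rfl : c' = c := hu.symm.eq_of_adj h1.right h1.1.symm
          obtain rfl : v' = v := hv.eq_of_adj h2.right h2.1.symm
          tauto
        refine (pr_mono key).trans ((pr_or_le _ _).trans (add_le_add_right ?_ _))
        split_ifs with h
        · exact pr_mono fun g hg => hg.2
        · exact (pr_false fun g hg => h hg.1).le
      refine (sum_le_sum fun b _ => sum_le_sum fun h _ => sum_le_sum fun s _ => hle b h s).trans ?_
      simp only [pr_not_chosen_and_chosen G _ huv, pr_not_chosen_and_not_chosen G _ huv, sum_const,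
        card_univ, Fintype.card_fin, sum_add_distrib, smul_add, Fintype.card_bool, threshold,
        if_pos hPu, if_pos hPv, ← smul_sum, sum_ite_eq', mem_univ, if_true, Fintype.sum_bool]
      norm_num
    · push Not at hx2
      obtain ⟨u, v, ha⟩ := (hdeg x).resolve_left hx
      have hu := hx2 u ha.left
      have hv := hx2 v ha.right
      have hle : ∀ b h s, pr (A x b h s) ≤ pr (fun g => ¬ Chosen G b g u ∧ ¬ Chosen G b g v) +
          ((if q u s = x then if Special G u then 0 else pr (fun g => Missed G b g u) else 0) +
          (if q v s = x then if Special G v then 0 else pr (fun g => Missed G b g v) else 0)) := by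
        intro b h s
        have key : ∀ g, A x b h s g → (¬ Chosen G b g u ∧ ¬ Chosen G b g v) ∨
            (Single b g s x u ∨ Single b g s x v) := by
          intro g hg
          rcases (hA1 hx hx2).1 hg with h | ⟨w, hw, h⟩
          · exact Or.inl ⟨h u ha.left, h v ha.right⟩
          · rcases (ha.2 w).1 hw with rfl | rfl
            · exact Or.inr (Or.inl h)
            · exact Or.inr (Or.inr h)
        have hs : ∀ w, pr (fun g => Single b g s x w) ≤
            if q w s = x then if Special G w then 0 else pr (fun g => Missed G b g w) else 0 := by
          intro w
          split_ifs with h1 h2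
          · exact (pr_false fun g hg => hg.1.1 h2).le
          · exact pr_mono fun g hg => hg.2
          · exact (pr_false fun g hg => h1 hg.1.2).le
        exact (pr_mono key).trans ((pr_or_le _ _).trans (add_le_add_right
          ((pr_or_le _ _).trans (add_le_add (hs u) (hs v))) _))
      have hsum : ∀ w c, Deg3 G w → 0 ≤ c → ∑ s, (if q w s = x then c else 0 : ℚ) ≤ c := by
        intro w c hw hc
        rw [← sum_filter, sum_const, nsmul_eq_mul]
        refine mul_le_of_le_one_left hc ?_
        have : #(univ.filter fun s => q w s = x) ≤ 1 := by
          rw [card_le_one]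
          intro i hi j hj
          rw [mem_filter] at hi hj
          exact (hq w hw).1 (hi.2.trans hj.2.symm)
        exact_mod_cast this
      have hle' : ∀ b h, ∑ s, pr (A x b h s) ≤
          3 * pr (fun g => ¬ Chosen G b g u ∧ ¬ Chosen G b g v) +
          ((if Special G u then 0 else pr (fun g => Missed G b g u)) +
          if Special G v then 0 else pr (fun g => Missed G b g v)) := by
        intro b h
        refine (sum_le_sum fun s _ => hle b h s).trans ?_
        rw [sum_add_distrib, sum_add_distrib, sum_const, card_univ, Fintype.card_fin, nsmul_eq_mul]
        refine add_le_add le_rfl (add_le_add (hsum u _ hu ?_) (hsum v _ hv ?_)) <;>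
          split_ifs <;> first | exact le_rfl | exact pr_nonneg _
      refine (sum_le_sum fun b _ => sum_le_sum fun h _ => hle' b h).trans ?_
      have hmu := sum_pr_missed_le hdeg hind htwin ha hu
      have hmv := sum_pr_missed_le hdeg hind htwin ha.symm hv
      simp only [pr_not_chosen_and_not_chosen G _ ha.1, sum_const, card_univ, Fintype.card_bool,
        Fintype.sum_bool, threshold] at hmu hmv ⊢
      by_cases h1 : Special G u <;> by_cases h2 : Special G v
      · simp only [h1, h2]
        norm_num
      · have := hmv h2
        simp only [h1, h2, if_true, if_false] at this ⊢
        norm_num at this ⊢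
        linarith
      · have := hmu h1
        simp only [h1, h2, if_true, if_false] at this ⊢
        norm_num at this ⊢
        linarith
      · have := hmu h1
        have := hmv h2
        simp only [h1, h2, if_false] at *
        norm_num at *
        linarith

section

variable {V : Type u} [Fintype V] {G : SimpleGraph V}

lemma good_or_bad_of_three_path (hn : GoodBelow.{u} (Fintype.card V)) (hG : G.Connected)
    (hb : Bridgeless G) [Nontrivial V] {x a b y : V} (hxy : x ≠ y) (hx : ¬ Deg3 G x)
    (ha : Deg2 G a x b) (hb' : Deg2 G b a y) : Good G ∨ InBadFamily G := by
  obtain ⟨p, q, h⟩ := (hb.deg hG x).resolve_left hx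
  obtain ⟨w, hxw⟩ := h.exists_of_adj ha.left.symm
  by_cases hwy : w = y
  · subst hwy
    exact good_or_bad_of_ear hn hG hb hxw.symm ha hb' (Or.inl rfl)
  have hbx : ¬ G.Adj b x := fun h => hxy (hb'.eq_of_adj h ha.left.ne')
  have hwb : w ≠ b := by
    rintro rfl
    exact hbx hxw.right.symm
  by_cases hy : Deg3 G y
  · by_cases hw : Deg3 G w
    · exact good_or_bad_of_ear hn hG hb hxw.symm ha hb' (Or.inr ⟨hw, hy⟩)
    · obtain ⟨p, q, h⟩ := (hb.deg hG w).resolve_left hw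
      obtain ⟨w', hw'⟩ := h.exists_of_adj hxw.right.symm
      by_cases hyw : w' = y
      · subst hyw
        exact Or.inl (good_of_closed_ear_four hn hG hb hb'.symm ha.symm hxw hw')
      · exact good_or_bad_of_subdiv hn hG hb hb'.symm ha.symm hxw hw' (Ne.symm hxy) (Ne.symm hwy)
          (Ne.symm hyw)
  · obtain ⟨p, q, h⟩ := (hb.deg hG y).resolve_left hy
    obtain ⟨z, hz⟩ := h.exists_of_adj hb'.right.symm
    by_cases hwz : w = z
    · subst hwz
      exact Or.inl (good_of_closed_ear_four hn hG hb hxw.symm ha hb' hz)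
    · exact good_or_bad_of_subdiv hn hG hb hxw.symm ha hb' hz hwb hwy hwz

lemma good_or_bad_of_bridgeless (hn : GoodBelow.{u} (Fintype.card V)) (hG : G.Connected)
    (hb : Bridgeless G) [Nontrivial V] (hind : ∀ x y, Deg3 G x → Deg3 G y → ¬ G.Adj x y) :
    Good G ∨ InBadFamily G := by
  by_contra hcon
  have hend : ∀ {a b u v}, Deg2 G a u b → Deg2 G b a v → Deg3 G u ∧ Deg3 G v ∧ u ≠ v := by
    intro a b u v ha hv
    have huv : u ≠ v := by
      rintro rfl
      exact hcon (Or.inl (good_of_closed_ear_two hn hG hb ha hv))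
    refine ⟨?_, ?_, huv⟩ <;> by_contra h
    · exact hcon (good_or_bad_of_three_path hn hG hb huv h ha hv)
    · exact hcon (good_or_bad_of_three_path hn hG hb huv.symm h hv.symm ha.symm)
  have hpath : ∀ x y z, x ≠ z → G.Adj x y → G.Adj y z → Deg3 G x ∨ Deg3 G y ∨ Deg3 G z := by
    intro x y z hxz hxy hyz
    by_contra! h
    obtain ⟨p, q, hx⟩ := (hb.deg hG x).resolve_left h.1
    obtain ⟨p', q', hy⟩ := (hb.deg hG y).resolve_left h.2.1
    obtain ⟨w, hw⟩ := hx.exists_of_adj hxy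
    obtain ⟨z', hz⟩ := hy.exists_of_adj hxy.symm
    obtain rfl := hz.eq_of_adj hyz hxz.symm
    exact h.2.2 (hend hz.symm hw).1
  refine hcon (Or.inl (good_of_independent (hb.deg hG) hind (fun a a' u v hu hv ha ha' => ?_)
    fun a b u v ha hv => ?_))
  · by_contra haa
    exact hcon (good_or_bad_of_twin hn hG hb ha ha' haa hu hv)
  · obtain ⟨hu3, hv3, huv⟩ := hend ha hv
    refine ⟨hu3, hv3, huv, ?_⟩
    by_contra! hcom
    exact hcon (Or.inl (good_of_contract hn hG hb ha hv hu3 hv3 huv hcom hind hpath))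

lemma good_or_bad_of_connected (hn : GoodBelow.{u} (Fintype.card V)) [Nontrivial V] (k : ℕ)
    (G : SimpleGraph V) (hk : G.edgeSet.ncard = k) (hG : G.Connected) : Good G ∨ InBadFamily G := by
  induction k using Nat.strong_induction_on generalizing G with
  | _ k ih =>
    by_cases hb : Bridgeless G
    · by_cases hind : ∀ x y, Deg3 G x → Deg3 G y → ¬ G.Adj x y
      · exact good_or_bad_of_bridgeless hn hG hb hind
      · push Not at hind
        obtain ⟨x, y, hx, hy, hxy⟩ := hind
        refine good_or_bad_of_chord hxy (ih _ ?_ _ rfl (hb x y hxy)) (hb.two_le hG) hx hy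
        rw [← hk]
        refine Set.ncard_lt_ncard (SimpleGraph.edgeSet_ssubset_edgeSet.2
          ((SimpleGraph.deleteEdges_le _).lt_of_ne fun h => ?_))
        have := h ▸ hxy
        simp at this
    · simp only [Bridgeless, not_forall] at hb
      obtain ⟨x, y, hxy, hb⟩ := hb
      refine Or.inl (good_of_bridge hn hG hxy fun hr => hb ?_)
      exact hG.connected_delete_edge_of_not_isBridge fun h => (SimpleGraph.isBridge_iff.1 h) hr

lemma goodBelow (n : ℕ) : GoodBelow.{u} n := by
  induction n using Nat.strong_induction_on with
  | _ n ih =>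
    intro W _ H hW hH h2
    have := Fintype.one_lt_card_iff_nontrivial.1 h2
    exact good_or_bad_of_connected (ih _ hW) _ H rfl hH

end

end FDom

/-- Every connected graph on at least two vertices not in the exceptional family `B` admits an
`f_G`-dominating `2/5`-colouring, where `f_G v = 4/5` if `v` has degree `1` and `f_G v = 1`
otherwise. -/
theorem exists_fG_dominating_colouring {V : Type*} [Fintype V] [DecidableEq V]
    (G : SimpleGraph V) (hcard : 2 ≤ Fintype.card V) (hconn : G.Connected)
    (hbad : ¬ InBadFamily G) :
    ∃ w : Finset V → ℝ,
      IsFDomColouring G (fun v => if G.degree v = 1 then (4 / 5 : ℝ) else 1) (2 / 5) w := by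
  obtain ⟨m, hm, A, hA, hsat⟩ :=
    (FDom.goodBelow _ V G (Nat.lt_succ_self _) hconn hcard).resolve_right hbad
  have hm' : (0 : ℝ) < 5 * m := by positivity
  let S (c : Fin (5 * m)) : Finset V := univ.filter fun v => c ∈ A v
  have hsum : ∀ (P : Finset V → Prop) [DecidablePred P] (T : Finset (Fin (5 * m))),
      (∀ c, c ∈ T ↔ P (S c)) →
        ∑ D ∈ univ.filter P, (#(univ.filter fun c => S c = D) / (5 * m) : ℝ) = #T / (5 * m) := by
    intro P _ T hT
    rw [← sum_div, card_eq_sum_card_fiberwise (f := S) (t := univ.filter P)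
      (fun c hc => by simpa [hT] using hc), Nat.cast_sum]
    congr 1
    refine sum_congr rfl fun D hD => ?_
    congr 2
    ext c
    simp only [mem_filter, mem_univ, true_and, hT] at hD ⊢
    exact ⟨fun h => ⟨h ▸ hD, h⟩, fun h => h.2⟩
  refine ⟨fun D => #(univ.filter fun c => S c = D) / (5 * m), fun D => by positivity, ?_,
    fun v => ?_, fun v => ?_⟩
  · have h := hsum (fun _ => True) univ (by simp)
    simp only [filter_true, card_univ, Fintype.card_fin] at h
    rw [h]
    push_cast
    exact div_self hm'.ne'
  · have h1 : ∀ T : Finset (Fin (5 * m)), (∀ c ∈ T, ∃ u ∈ S c, u = v ∨ G.Adj u v) →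
        (#T / (5 * m) : ℝ) ≤ ∑ D ∈ univ.filter (fun D : Finset V => ∃ u ∈ D, u = v ∨ G.Adj u v),
          (#(univ.filter fun c => S c = D) / (5 * m) : ℝ) := by
      intro T hT
      rw [hsum _ (univ.filter fun c => ∃ u ∈ S c, u = v ∨ G.Adj u v) (by simp)]
      gcongr
      exact fun c hc => by simpa using hT c hc
    rcases hsat v with ⟨u, hu, hw, hd⟩ | hfull
    · have hdeg : G.degree v = 1 := by
        rw [SimpleGraph.degree_eq_one_iff_existsUnique_adj]
        exact ⟨u, hu, hw⟩
      beta_reduce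
      rw [if_pos hdeg]
      refine le_trans (le_of_eq ?_) (h1 (A v ∪ A u) fun c hc => ?_)
      · rw [card_union_of_disjoint hd, hA, hA]
        push_cast
        field_simp
        norm_num
      · rcases mem_union.1 hc with hc | hc
        · exact ⟨v, by simpa [S] using hc, Or.inl rfl⟩
        · exact ⟨u, by simpa [S] using hc, Or.inr hu.symm⟩
    · refine le_trans ?_ (h1 univ fun c _ => ?_)
      · rw [card_univ, Fintype.card_fin]
        push_cast
        rw [div_self hm'.ne']
        split_ifs <;> norm_num
      · obtain ⟨u, hu, hc⟩ := hfull c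
        exact ⟨u, by simpa [S] using hc, hu.imp id SimpleGraph.Adj.symm⟩
  · rw [hsum (fun D => v ∈ D) (A v) (by simp [S]), hA]
    push_cast
    field_simp
end

section
/- Let G be a finite simple graph and P a suspended path of G of length ℓ ≥ 1, and let G' be the graph obtained from G by deleting the internal vertices and the edges of P. Writing k = ⌈ℓ/3⌉, one has fdom(G) ≥ min{(3k−1)/k, fdom(G')}. -/
open Finset
open scoped Classical

/-- `D` is a dominating set of `G`. -/
def IsDominatingSet {V : Type*} (G : SimpleGraph V) (D : Finset V) : Prop :=
  ∀ v : V, ∃ u ∈ D, u = v ∨ G.Adj u v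

/-- A finitely supported probability distribution over dominating sets of `G`
under which each vertex has marginal probability at most `p`. -/
def IsDomDistribution {V : Type*} [Fintype V] [DecidableEq V]
    (G : SimpleGraph V) (w : Finset V → ℝ) (p : ℝ) : Prop :=
  (∀ D, 0 ≤ w D) ∧ (∑ D : Finset V, w D) = 1 ∧
    (∀ D, w D ≠ 0 → IsDominatingSet G D) ∧
    (∀ v : V, ∑ D ∈ Finset.univ.filter (fun D : Finset V => v ∈ D), w D ≤ p)

/-- The fractional domatic number of `G`. -/
noncomputable def fdom {V : Type*} [Fintype V] [DecidableEq V] (G : SimpleGraph V) : ℝ :=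
  sSup {x : ℝ | ∃ p : ℝ, 0 < p ∧ p ≤ 1 ∧ x = 1 / p ∧ ∃ w : Finset V → ℝ, IsDomDistribution G w p}

theorem IsDomDistribution.one_div_le_card {V : Type*} [Fintype V] [DecidableEq V]
    [Nonempty V] {G : SimpleGraph V} {w : Finset V → ℝ} {p : ℝ} (hp : 0 < p)
    (h : IsDomDistribution G w p) : 1 / p ≤ Fintype.card V := by
  obtain ⟨h0, h1, hdom, hmarg⟩ := h
  rw [div_le_iff₀ hp]
  calc (1 : ℝ) = ∑ D : Finset V, w D := h1.symm
    _ ≤ ∑ D : Finset V, ∑ v : V, if v ∈ D then w D else 0 := by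
        refine Finset.sum_le_sum fun D _ => ?_
        by_cases hD : w D = 0
        · simp [hD]
        · obtain ⟨u, hu, -⟩ := hdom D hD (Classical.arbitrary V)
          calc w D = if u ∈ D then w D else 0 := by simp [hu]
            _ ≤ _ := Finset.single_le_sum (f := fun v => if v ∈ D then w D else 0)
              (fun v _ => by split_ifs <;> simp [h0]) (Finset.mem_univ u)
    _ = ∑ v : V, ∑ D : Finset V, if v ∈ D then w D else 0 := Finset.sum_comm
    _ ≤ ∑ _v : V, p := by
        refine Finset.sum_le_sum fun v _ => ?_
        rw [← Finset.sum_filter]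
        exact hmarg v
    _ = Fintype.card V * p := by simp

theorem fdom_nonneg {V : Type*} [Fintype V] [DecidableEq V] (G : SimpleGraph V) :
    0 ≤ fdom G := by
  refine Real.sSup_nonneg ?_
  rintro x ⟨p, hp, -, rfl, -⟩
  positivity

theorem IsDomDistribution.one_div_le_fdom {V : Type*} [Fintype V] [DecidableEq V]
    [Nonempty V] {G : SimpleGraph V} {w : Finset V → ℝ} {p : ℝ} (hp : 0 < p) (hp1 : p ≤ 1)
    (h : IsDomDistribution G w p) : 1 / p ≤ fdom G := by
  refine le_csSup ⟨Fintype.card V, ?_⟩ ⟨p, hp, hp1, rfl, w, h⟩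
  rintro x ⟨q, hq, -, rfl, w', h'⟩
  exact h'.one_div_le_card hq

/-- `A` assigns to every vertex an event in `Ω` so that, at every outcome, the vertices whose
event occurs form a dominating set of `G`. -/
def IsDomFamily {V Ω : Type*} (G : SimpleGraph V) (A : V → Finset Ω) : Prop :=
  ∀ (ω : Ω) (v : V), ∃ u, ω ∈ A u ∧ (u = v ∨ G.Adj u v)

theorem IsDomFamily.div_le_fdom {V Ω : Type*} [Fintype V] [DecidableEq V] [Nonempty V]
    [Fintype Ω] [Nonempty Ω] {G : SimpleGraph V} {A : V → Finset Ω} (hA : IsDomFamily G A)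
    {m : ℕ} (hm : 0 < m) (hmN : m ≤ Fintype.card Ω) (hcard : ∀ v, (A v).card ≤ m) :
    (Fintype.card Ω : ℝ) / m ≤ fdom G := by
  have hN : (0 : ℝ) < Fintype.card Ω := by exact_mod_cast Fintype.card_pos
  let S : Ω → Finset V := fun ω => Finset.univ.filter fun v => ω ∈ A v
  have key : IsDomDistribution G
      (fun D => ((Finset.univ.filter fun ω => S ω = D).card : ℝ) / Fintype.card Ω)
      (m / Fintype.card Ω) := by
    refine ⟨fun D => by positivity, ?_, fun D hD => ?_, fun v => ?_⟩
    · rw [← Finset.sum_div, div_eq_one_iff_eq hN.ne']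
      exact_mod_cast (Finset.card_eq_sum_card_fiberwise
        (f := S) (s := Finset.univ) (t := Finset.univ) (fun _ _ => by simp)).symm
    · have hne : (Finset.univ.filter fun ω => S ω = D).Nonempty := by
        rw [Finset.nonempty_iff_ne_empty]
        rintro h
        simp [h] at hD
      obtain ⟨ω, hω⟩ := hne
      have hω : S ω = D := by simpa using hω
      intro v
      obtain ⟨u, hu, huv⟩ := hA ω v
      exact ⟨u, by simpa [← hω, S] using hu, huv⟩
    · rw [← Finset.sum_div]
      gcongr
      refine le_trans ?_ (Nat.cast_le.2 (hcard v))
      have := Finset.card_eq_sum_card_fiberwise (f := S) (s := A v)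
        (t := Finset.univ.filter fun D : Finset V => v ∈ D) (fun ω hω => by simpa [S] using hω)
      rw [this]
      push_cast
      refine Finset.sum_le_sum fun D hD => ?_
      have hvD : v ∈ D := by simpa using hD
      refine Nat.cast_le.2 (Finset.card_le_card fun ω hω => ?_)
      have hω : S ω = D := by simpa using hω
      have : ω ∈ A v := by simpa [← hω, S] using hvD
      simp [this, hω]
  have := key.one_div_le_fdom (by positivity) (by
    rw [div_le_one hN]; exact_mod_cast hmN)
  simpa using this

theorem IsDomDistribution.exists_isDomFamily {V : Type*} [Fintype V] [DecidableEq V]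
    {G : SimpleGraph V} {w : Finset V → ℝ} {p : ℝ} (h : IsDomDistribution G w p) (N : ℕ) :
    ∃ (c : Finset V → ℕ) (A : V → Finset (Σ D, Fin (c D))), IsDomFamily G A ∧
      (N : ℝ) ≤ Fintype.card (Σ D, Fin (c D)) ∧
      (Fintype.card (Σ D, Fin (c D)) : ℝ) ≤ N + Fintype.card (Finset V) ∧
      ∀ v, ((A v).card : ℝ) ≤ N * p + Fintype.card (Finset V) := by
  obtain ⟨h0, h1, hdom, hmarg⟩ := h
  have hceil : ∀ D, (⌈N * w D⌉₊ : ℝ) ≤ N * w D + 1 := fun D =>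
    (Nat.ceil_lt_add_one (mul_nonneg (Nat.cast_nonneg _) (h0 D))).le
  have hcard : (Fintype.card (Σ D : Finset V, Fin ⌈N * w D⌉₊) : ℝ)
      = ∑ D : Finset V, (⌈N * w D⌉₊ : ℝ) := by simp
  refine ⟨fun D => ⌈N * w D⌉₊, fun v => Finset.univ.filter fun ω => v ∈ ω.1, ?_, ?_, ?_, ?_⟩
  · rintro ⟨D, i⟩ v
    have hD : w D ≠ 0 := by
      intro hD
      have : ⌈N * w D⌉₊ = 0 := by simp [hD]
      exact absurd i.2 (by simp [this])
    obtain ⟨u, hu, huv⟩ := hdom D hD v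
    exact ⟨u, by simpa using hu, huv⟩
  · rw [hcard]
    calc (N : ℝ) = ∑ D : Finset V, N * w D := by rw [← Finset.mul_sum, h1, mul_one]
      _ ≤ _ := Finset.sum_le_sum fun D _ => Nat.le_ceil _
  · rw [hcard]
    calc _ ≤ ∑ D : Finset V, (N * w D + 1) := Finset.sum_le_sum fun D _ => hceil D
      _ = _ := by rw [Finset.sum_add_distrib, ← Finset.mul_sum, h1]; simp
  · intro v
    have hv : (Finset.univ.filter fun ω : Σ D : Finset V, Fin ⌈N * w D⌉₊ => v ∈ ω.1)
        = (Finset.univ.filter fun D : Finset V => v ∈ D).sigma fun _ => Finset.univ := by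
      ext ω; simp
    dsimp only
    rw [hv, Finset.card_sigma]
    push_cast
    calc _ ≤ ∑ D ∈ Finset.univ.filter (fun D : Finset V => v ∈ D), (N * w D + 1) :=
          Finset.sum_le_sum fun D _ => by simpa using hceil D
      _ = N * (∑ D ∈ Finset.univ.filter (fun D : Finset V => v ∈ D), w D)
          + (Finset.univ.filter (fun D : Finset V => v ∈ D)).card := by
          rw [Finset.sum_add_distrib, ← Finset.mul_sum]; simp
      _ ≤ _ := by
          gcongr
          · exact hmarg v
          · exact Finset.card_le_univ _

/-- A sequence of events of size at most `m`, starting with `X, Y` and having `B` in position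
`n`, such that any three consecutive events up to position `n` cover `Ω`. -/
def CoverChain {Ω : Type*} [Fintype Ω] (m n : ℕ) (X Y B : Finset Ω) : Prop :=
  ∃ f : ℕ → Finset Ω, f 0 = X ∧ f 1 = Y ∧ f n = B ∧ (∀ i, (f i).card ≤ m) ∧
    ∀ i, i + 2 ≤ n → ∀ ω, ω ∈ f i ∨ ω ∈ f (i + 1) ∨ ω ∈ f (i + 2)

theorem CoverChain.cons {Ω : Type*} [Fintype Ω] {m n : ℕ} {X Y B A : Finset Ω}
    (h : CoverChain m n X Y B) (hA : A.card ≤ m) (hc : ∀ ω, ω ∈ A ∨ ω ∈ X ∨ ω ∈ Y) :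
    CoverChain m (n + 1) A X B := by
  obtain ⟨f, h0, h1, hn, hm, hf⟩ := h
  refine ⟨fun i => i.casesOn A f, rfl, h0, hn, ?_, ?_⟩
  · rintro (_ | i)
    exacts [hA, hm i]
  · rintro (_ | i) hi ω
    · simpa [h0, h1] using hc ω
    · exact hf i (by omega) ω

/-- An event containing the complement of `U ∪ X` that is as disjoint from `X` as possible. -/
theorem exists_card_eq_cover {Ω : Type*} [Fintype Ω] {m : ℕ} (hm : m ≤ Fintype.card Ω)
    {U X : Finset Ω} (hX : X.card = m) (hU : Fintype.card Ω ≤ (U ∪ X).card + m) :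
    ∃ Y : Finset Ω, Y.card = m ∧ (∀ ω, ω ∈ U ∨ ω ∈ X ∨ ω ∈ Y) ∧
      (2 * m ≤ (X ∪ Y).card ∨ Fintype.card Ω ≤ (X ∪ Y).card) := by
  have hXc := Finset.card_add_card_compl X
  have hUc := Finset.card_add_card_compl (U ∪ X)
  have hsub : (U ∪ X)ᶜ ⊆ Xᶜ := by simp
  have cover : ∀ Y : Finset Ω, (U ∪ X)ᶜ ⊆ Y → ∀ ω, ω ∈ U ∨ ω ∈ X ∨ ω ∈ Y := by
    intro Y hY ω
    by_cases h : ω ∈ U ∪ X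
    · simp only [Finset.mem_union] at h; tauto
    · exact Or.inr (Or.inr (hY (by simpa using h)))
  rcases le_total (2 * m) (Fintype.card Ω) with h | h
  · obtain ⟨Y, h1, h2, h3⟩ := Finset.exists_subsuperset_card_eq (n := m) hsub
      (by omega) (by omega)
    refine ⟨Y, h3, cover Y h1, Or.inl ?_⟩
    rw [Finset.card_union_of_disjoint, hX, h3, two_mul]
    exact Finset.disjoint_left.2 fun a ha hY => by simpa [ha] using h2 hY
  · obtain ⟨Y, h1, -, h3⟩ := Finset.exists_subsuperset_card_eq (n := m)
      (Finset.subset_univ Xᶜ) (by omega) (by simpa using hm)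
    refine ⟨Y, h3, cover Y (hsub.trans h1), Or.inr ?_⟩
    rw [← Finset.card_univ]
    refine Finset.card_le_card fun ω _ => ?_
    by_cases hω : ω ∈ X
    · simp [hω]
    · simp [h1 (by simpa using hω : ω ∈ Xᶜ)]

/-- Moving `X` towards `B` by exchanging at most `e` elements. -/
theorem exists_exchange {Ω : Type*} {m e r : ℕ} {X B : Finset Ω}
    (hX : X.card = m) (hB : B.card = m) (h : (X \ B).card ≤ r + e) :
    ∃ X' : Finset Ω, X'.card = m ∧ (X' \ B).card ≤ r ∧ (X \ X').card ≤ e := by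
  obtain ⟨E, hE, hEc⟩ := Finset.exists_subset_card_eq (min_le_right e (X \ B).card)
  have hcomm : (B \ X).card = (X \ B).card := Finset.card_sdiff_comm (hB.trans hX.symm)
  obtain ⟨F, hF, hFc⟩ := Finset.exists_subset_card_eq
    ((min_le_right e (X \ B).card).trans hcomm.ge)
  have hEX : E ⊆ X := hE.trans Finset.sdiff_subset
  have hdisj : Disjoint (X \ E) F := Finset.disjoint_left.2 fun a ha hF' => by
    have := hF hF'
    simp at this ha
    exact this.2 ha.1
  refine ⟨(X \ E) ∪ F, ?_, ?_, ?_⟩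
  · rw [Finset.card_union_of_disjoint hdisj, Finset.card_sdiff_of_subset hEX, hEc, hFc, hX]
    have := Finset.card_le_card hEX
    omega
  · have hs : ((X \ E) ∪ F) \ B ⊆ (X \ B) \ E := by
      intro a ha
      have := @hF a
      simp at ha this ⊢
      tauto
    have := Finset.card_le_card hs
    rw [Finset.card_sdiff_of_subset hE] at this
    omega
  · have hs : X \ ((X \ E) ∪ F) ⊆ E := by
      intro a ha
      simp at ha
      tauto
    have := Finset.card_le_card hs
    omega

theorem card_union_le_add_sdiff {Ω : Type*} (A X X' : Finset Ω) :
    (A ∪ X).card ≤ (A ∪ (X ∩ X')).card + (X \ X').card := by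
  refine le_trans (Finset.card_le_card fun a ha => ?_) (Finset.card_union_le _ _)
  simp at ha ⊢
  tauto

theorem card_le_of_cover {Ω : Type*} [Fintype Ω] {m : ℕ} {A X Y : Finset Ω}
    (hA : A.card ≤ m) (h : ∀ ω, ω ∈ A ∨ ω ∈ X ∨ ω ∈ Y) :
    Fintype.card Ω ≤ (X ∪ Y).card + m := by
  have : (Finset.univ : Finset Ω) ⊆ (X ∪ Y) ∪ A := fun ω _ => by
    have := h ω
    simp
    tauto
  have h1 := Finset.card_le_card this
  have h2 := Finset.card_union_le (X ∪ Y) A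
  rw [Finset.card_univ] at h1
  omega

theorem coverChain_three_mul {Ω : Type*} [Fintype Ω] {m e : ℕ} (hm : m ≤ Fintype.card Ω)
    (hem : e ≤ m) (he : e + Fintype.card Ω ≤ 3 * m) {B : Finset Ω} (hB : B.card = m) (j : ℕ) :
    ∀ {X Y : Finset Ω}, X.card = m → Y.card = m →
      (2 * m ≤ (X ∪ Y).card ∨ Fintype.card Ω ≤ (X ∪ Y).card) → (X \ B).card ≤ j * e →
      CoverChain m (3 * j) X Y B := by
  induction j with
  | zero =>
    intro X Y hX hY _ hXB
    have hsub : X ⊆ B := by simpa [Finset.sdiff_eq_empty_iff_subset] using hXB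
    have : X = B := Finset.eq_of_subset_of_card_le hsub (by omega)
    refine ⟨fun i => if i = 0 then X else Y, by simp, by simp, by simpa, fun i => ?_, ?_⟩
    · dsimp only
      split_ifs <;> omega
    · intro i hi
      omega
  | succ j ih =>
    intro X Y hX hY hXY hXB
    obtain ⟨X', hX', hX'B, hXX'⟩ := exists_exchange hX hB (r := j * e) (e := e)
      (by rw [← Nat.succ_mul]; exact hXB)
    have h1 := card_union_le_add_sdiff Y X X'
    rw [Finset.union_comm Y X] at h1
    have h2 := Finset.card_add_card_compl (Y ∪ (X ∩ X'))
    obtain ⟨Z, hZ, -, hZc⟩ := Finset.exists_subsuperset_card_eq (n := m)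
      (Finset.subset_univ (Y ∪ (X ∩ X'))ᶜ) (by omega) (by simpa using hm)
    have hcov : ∀ ω, ω ∈ Y ∨ (ω ∈ X ∧ ω ∈ X') ∨ ω ∈ Z := by
      intro ω
      by_contra hcon
      exact hcon (Or.inr (Or.inr (hZ (by
        simp
        tauto))))
    have hc1 : ∀ ω, ω ∈ Y ∨ ω ∈ Z ∨ ω ∈ X' := fun ω => by have := hcov ω; tauto
    obtain ⟨Y', hY', hc2, hXY'⟩ := exists_card_eq_cover hm hX' (card_le_of_cover hY.le hc1)
    exact (((ih hX' hY' hXY' hX'B).cons hZc.le hc2).cons hY.le hc1).cons hX.le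
      (fun ω => by have := hcov ω; tauto)

/-- Any two events of size `m` are joined by a covering sequence of length `ℓ`, as soon as
`k / (3k - 1) ≤ m / |Ω|` where `k = ⌈ℓ / 3⌉`. -/
theorem exists_coverChain {Ω : Type*} [Fintype Ω] {m e ℓ : ℕ} (hm : m ≤ Fintype.card Ω)
    (hem : e ≤ m) (he : e + Fintype.card Ω ≤ 3 * m) (hk : m ≤ (ℓ + 2) / 3 * e) (hℓ : 1 ≤ ℓ)
    {A B : Finset Ω} (hA : A.card = m) (hB : B.card = m) :
    ∃ Y, CoverChain m ℓ A Y B := by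
  obtain ⟨X₀, hX₀, -, hAX₀⟩ := exists_card_eq_cover hm hA (U := Finset.univ)
    (by
      have := Finset.card_le_card (Finset.subset_union_left (s₁ := Finset.univ) (s₂ := A))
      rw [Finset.card_univ] at this
      omega)
  have hsd : ∀ X : Finset Ω, X.card = m → (X \ B).card ≤ m := fun X hX =>
    hX ▸ Finset.card_le_card Finset.sdiff_subset
  obtain ⟨j, hj⟩ : ∃ j, (ℓ + 2) / 3 = j + 1 := ⟨(ℓ + 2) / 3 - 1, by omega⟩
  rw [hj] at hk
  obtain ⟨X, hX, hXB, hX₀X⟩ := exists_exchange hX₀ hB (r := j * e) (e := e)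
    (by rw [← Nat.succ_mul]; exact (hsd X₀ hX₀).trans hk)
  have hAX : Fintype.card Ω ≤ (A ∪ X).card + m := by
    have h1 := card_union_le_add_sdiff A X₀ X
    have h2 : (A ∪ (X₀ ∩ X)).card ≤ (A ∪ X).card :=
      Finset.card_le_card (Finset.union_subset_union_right Finset.inter_subset_right)
    omega
  have hcases : ℓ = 3 * j + 1 ∨ ℓ = 3 * j + 2 ∨ ℓ = 3 * (j + 1) := by omega
  rcases hcases with rfl | rfl | rfl
  · obtain ⟨Y, hY, hc, hXY⟩ := exists_card_eq_cover hm hX hAX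
    exact ⟨X, (coverChain_three_mul hm hem he hB j hX hY hXY hXB).cons hA.le hc⟩
  · obtain ⟨Z, hZ, hc, -⟩ := exists_card_eq_cover hm hX hAX
    have hc' : ∀ ω, ω ∈ A ∨ ω ∈ Z ∨ ω ∈ X := fun ω => by have := hc ω; tauto
    obtain ⟨Y, hY, hc2, hXY⟩ := exists_card_eq_cover hm hX (card_le_of_cover hA.le hc')
    exact ⟨Z, ((coverChain_three_mul hm hem he hB j hX hY hXY hXB).cons hZ.le hc2).cons
      hA.le hc'⟩
  · exact ⟨X₀, coverChain_three_mul hm hem he hB (j + 1) hA hX₀ hAX₀ ((hsd A hA).trans hk)⟩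

/-- A dominating family of the graph without the path extends along the path. -/
theorem IsDomFamily.exists_extend {V Ω : Type*} [Fintype Ω] {G : SimpleGraph V}
    {u v : V} {P : G.Walk u v} (hP : P.IsPath) (hℓ1 : 1 ≤ P.length)
    {A : {x : V | x = u ∨ x = v ∨ x ∉ P.support} → Finset Ω}
    (hA : IsDomFamily ((G.deleteEdges {e | e ∈ P.edges}).induce
      {x : V | x = u ∨ x = v ∨ x ∉ P.support}) A)
    {m e : ℕ} (hAm : ∀ x, (A x).card ≤ m) (hm : m ≤ Fintype.card Ω)
    (hem : e ≤ m) (he : e + Fintype.card Ω ≤ 3 * m) (hk : m ≤ (P.length + 2) / 3 * e) :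
    ∃ B : V → Finset Ω, IsDomFamily G B ∧ ∀ x, (B x).card ≤ m := by
  have hext : ∀ x, ∃ C : Finset Ω, A x ⊆ C ∧ C.card = m := fun x => by
    obtain ⟨C, h1, -, h2⟩ := Finset.exists_subsuperset_card_eq (n := m)
      (Finset.subset_univ (A x)) (hAm x) (by simpa using hm)
    exact ⟨C, h1, h2⟩
  obtain ⟨Cu, hCu, hCum⟩ := hext ⟨u, Or.inl rfl⟩
  obtain ⟨Cv, hCv, hCvm⟩ := hext ⟨v, Or.inr (Or.inl rfl)⟩
  obtain ⟨Y, f, hf0, -, hfℓ, hfm, hf⟩ := exists_coverChain hm hem he hk hℓ1 hCum hCvm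
  let B : V → Finset Ω := fun x =>
    if h : x ∈ P.support then f (P.support.idxOf x) else A ⟨x, Or.inr (Or.inr h)⟩
  have hB : ∀ i ≤ P.length, B (P.getVert i) = f i := by
    intro i hi
    have hmem : P.getVert i ∈ P.support := P.getVert_mem_support i
    have hidx : P.support.idxOf (P.getVert i) = i := by
      have hlt : i < P.support.length := by rw [SimpleGraph.Walk.length_support]; omega
      rw [P.getVert_eq_support_getElem hi]
      exact hP.support_nodup.idxOf_getElem i hlt
    simp only [B, dif_pos hmem, hidx]
  have hBu : B u = Cu := by simpa [hf0] using hB 0 (Nat.zero_le _)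
  have hBv : B v = Cv := by simpa [hfℓ] using hB P.length le_rfl
  have hAB : ∀ x, A x ⊆ B x := by
    rintro ⟨x, hx⟩
    by_cases hxu : x = u
    · subst hxu; rwa [hBu]
    by_cases hxv : x = v
    · subst hxv; rwa [hBv]
    have hxP : x ∉ P.support := by rcases hx with h | h | h <;> tauto
    simp [B, hxP]
  refine ⟨B, fun ω x => ?_, fun x => ?_⟩
  · by_cases hx : x = u ∨ x = v ∨ x ∉ P.support
    · obtain ⟨y, hy, hyx⟩ := hA ω ⟨x, hx⟩
      refine ⟨y, hAB y hy, hyx.imp (fun h => by rw [h]) fun h => ?_⟩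
      simp only [SimpleGraph.comap_adj, SimpleGraph.deleteEdges_adj] at h
      exact h.1
    · push Not at hx
      obtain ⟨hxu, hxv, hxP⟩ := hx
      obtain ⟨i, rfl, hi⟩ := SimpleGraph.Walk.mem_support_iff_exists_getVert.1 hxP
      have hi0 : i ≠ 0 := by rintro rfl; simp at hxu
      have hiℓ : i ≠ P.length := by rintro rfl; simp at hxv
      obtain ⟨i, rfl⟩ := Nat.exists_eq_succ_of_ne_zero hi0
      simp only [Nat.succ_eq_add_one] at *
      rcases hf i (by omega) ω with h | h | h
      · exact ⟨P.getVert i, by rwa [hB i (by omega)],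
          Or.inr (P.adj_getVert_succ (by omega))⟩
      · exact ⟨P.getVert (i + 1), by rwa [hB _ (by omega)], Or.inl rfl⟩
      · exact ⟨P.getVert (i + 2), by rwa [hB _ (by omega)],
          Or.inr (P.adj_getVert_succ (by omega)).symm⟩
  · by_cases h : x ∈ P.support
    · simp only [B, dif_pos h, hfm]
    · simp only [B, dif_neg h, hAm]

theorem min_le_fdom_of_isDomDistribution {V : Type*} [Fintype V] [DecidableEq V]
    {G : SimpleGraph V} {u v : V} {P : G.Walk u v} (hP : P.IsPath) (hℓ1 : 1 ≤ P.length)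
    [Fintype {x : V | x = u ∨ x = v ∨ x ∉ P.support}]
    [DecidableEq {x : V | x = u ∨ x = v ∨ x ∉ P.support}]
    {k : ℕ} (hk : (P.length + 2) / 3 = k) {p : ℝ} (hp : 0 < p)
    {w : Finset {x : V | x = u ∨ x = v ∨ x ∉ P.support} → ℝ}
    (hw : IsDomDistribution ((G.deleteEdges {e | e ∈ P.edges}).induce
      {x : V | x = u ∨ x = v ∨ x ∉ P.support}) w p) :
    min ((3 * (k : ℝ) - 1) / k) (1 / p) ≤ fdom G := by
  have hk1 : 1 ≤ k := by omega
  have hk1' : (1 : ℝ) ≤ k := by exact_mod_cast hk1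
  have : Nonempty V := ⟨u⟩
  set K := Fintype.card (Finset {x : V | x = u ∨ x = v ∨ x ∉ P.support})
  set q : ℝ := max p (k / (3 * k - 1))
  have hd : (0 : ℝ) < 3 * k - 1 := by linarith
  have hq : 0 < q := lt_max_of_lt_left hp
  have hF : 0 ≤ fdom G := fdom_nonneg G
  have main : ∀ N : ℕ, 1 ≤ N → (N : ℝ) ≤ fdom G * (N * q + (K + 1)) := by
    intro N hN
    obtain ⟨c, A, hA, hN1, hN2, hAc⟩ := hw.exists_isDomFamily N
    generalize hM : Fintype.card (Σ D, Fin (c D)) = M at hN1 hN2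
    have hM1 : 1 ≤ M := by
      have : N ≤ M := by exact_mod_cast hN1
      omega
    have : Nonempty (Σ D, Fin (c D)) := Fintype.card_pos_iff.1 (by omega)
    set m := min M (max ⌊N * p + K⌋₊ ⌈(k : ℝ) / (3 * k - 1) * M⌉₊) with hmdef
    have hfrac : (k : ℝ) / (3 * k - 1) * M ≤ m := by
      rw [hmdef, Nat.cast_min, Nat.cast_max]
      refine le_min ?_ ((Nat.le_ceil _).trans (le_max_right _ _))
      refine mul_le_of_le_one_left (Nat.cast_nonneg _) ?_
      rw [div_le_one hd]
      linarith
    have hm : (m : ℝ) ≤ N * q + (K + 1) := by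
      have hpos : (0 : ℝ) ≤ (k : ℝ) / (3 * k - 1) := by positivity
      have hle : (k : ℝ) / (3 * k - 1) ≤ 1 := by
        rw [div_le_one hd]
        linarith
      have hpq : p ≤ q := le_max_left _ _
      have hkq : (k : ℝ) / (3 * k - 1) ≤ q := le_max_right _ _
      have hN0 : (0 : ℝ) ≤ N := Nat.cast_nonneg _
      have hK0 : (0 : ℝ) ≤ K := Nat.cast_nonneg _
      rw [hmdef, Nat.cast_min, Nat.cast_max]
      refine (min_le_right _ _).trans (max_le ?_ ?_)
      · refine (Nat.floor_le (by positivity)).trans ?_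
        nlinarith
      · refine (Nat.ceil_lt_add_one (by positivity)).le.trans ?_
        nlinarith
    have hmM : m ≤ M := min_le_left _ _
    have hm0 : 0 < m := by
      have : (0 : ℝ) < m := lt_of_lt_of_le (by positivity) hfrac
      exact_mod_cast this
    have hAm : ∀ x, (A x).card ≤ m := fun x => by
      refine le_min (hM ▸ Finset.card_le_univ _) (le_trans (Nat.le_floor (hAc x))
        (le_max_left _ _))
    have hkm : k * M + m ≤ 3 * k * m := by
      rw [div_mul_eq_mul_div, div_le_iff₀ hd] at hfrac
      have : (k * M + m : ℝ) ≤ 3 * k * m := by linarith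
      exact_mod_cast this
    have h3m : M ≤ 3 * m := by
      by_contra hcon
      push Not at hcon
      nlinarith
    have hke : m ≤ (P.length + 2) / 3 * min m (3 * m - M) := by
      rw [hk]
      rcases min_cases m (3 * m - M) with ⟨h, -⟩ | ⟨h, -⟩ <;> rw [h]
      · exact Nat.le_mul_of_pos_left _ hk1
      · obtain ⟨e, he⟩ := Nat.exists_eq_add_of_le h3m
        rw [he, Nat.add_sub_cancel_left]
        nlinarith
    obtain ⟨B, hB, hBm⟩ := hA.exists_extend hP hℓ1 hAm (hM.symm ▸ hmM)
      (e := min m (3 * m - M)) (min_le_left _ _) (by omega) hke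
    have hres := hB.div_le_fdom hm0 (hM.symm ▸ hmM) hBm
    rw [hM, div_le_iff₀ (by exact_mod_cast hm0)] at hres
    calc (N : ℝ) ≤ M := hN1
      _ ≤ fdom G * m := hres
      _ ≤ _ := by gcongr
  have hone : 1 ≤ fdom G * q := by
    by_contra hcon
    push Not at hcon
    obtain ⟨N, hN⟩ := exists_nat_gt (fdom G * (K + 1) / (1 - fdom G * q))
    rw [div_lt_iff₀ (by linarith)] at hN
    have hN1 : 1 ≤ N := by
      by_contra h0
      have h0 : N = 0 := by omega
      subst h0
      have : 0 ≤ fdom G * (K + 1) := by positivity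
      simp at hN
      linarith
    nlinarith [main N hN1]
  have hqF : 1 / q ≤ fdom G := by rwa [div_le_iff₀ hq]
  rcases max_cases p ((k : ℝ) / (3 * k - 1)) with ⟨h, -⟩ | ⟨h, -⟩
  · exact (min_le_right _ _).trans (by rwa [← h])
  · refine (min_le_left _ _).trans ?_
    rwa [show q = (k : ℝ) / (3 * k - 1) from h, one_div_div] at hqF

/-- Removing a suspended path `P` of length `ℓ ≥ 1` (with endpoints of degree at least 3 and
internal vertices of degree 2) from `G`: with `k = ⌈ℓ/3⌉`, one has
`fdom G ≥ min ((3k-1)/k) (fdom G')`, where `G'` is obtained from `G` by deleting the edges and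
the internal vertices of `P`. -/
theorem fdom_ge_of_suspended_path {V : Type*} [Fintype V] [DecidableEq V] (G : SimpleGraph V)
    {u v : V} (huv : u ≠ v) (P : G.Walk u v) (hP : P.IsPath)
    (ℓ : ℕ) (hℓ : P.length = ℓ) (hℓ1 : 1 ≤ ℓ)
    (hdu : 3 ≤ G.degree u) (hdv : 3 ≤ G.degree v)
    (hint : ∀ x ∈ P.support, x ≠ u → x ≠ v → G.degree x = 2) :
    min ((3 * (((ℓ + 2) / 3 : ℕ) : ℝ) - 1) / (((ℓ + 2) / 3 : ℕ) : ℝ))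
        (fdom ((G.deleteEdges {e | e ∈ P.edges}).induce
          {x : V | x = u ∨ x = v ∨ x ∉ P.support}))
      ≤ fdom G := by
  subst hℓ
  rw [min_le_iff, or_iff_not_imp_left, not_le]
  intro hlt
  refine Real.sSup_le ?_ (fdom_nonneg G)
  rintro x ⟨p, hp, -, rfl, w, hw⟩
  have := min_le_fdom_of_isDomDistribution hP hℓ1 rfl hp hw
  exact (min_le_iff.1 this).resolve_left hlt.not_ge
end

section
/- Let n ≥ 2 be an integer and let G be the graph obtained from the complete graph K_n by replacing each edge uv by a hammock, i.e. two internally disjoint paths between u and v, one of length 2 and one of length 3, whose internal vertices are new and pairwise distinct across different edges. Then fdom(G) = 5/2, and for every positive integer k, every dominating (5k : 2k)-colouring of G satisfies k ≥ n/5. -/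
open Finset
open scoped Classical

/-- A dominating `(p:q)`-colouring of `G`: each vertex gets a `q`-element subset of the `p`
colours, and every closed neighbourhood sees all `p` colours. -/
def IsDomPQColouring {V : Type*} (G : SimpleGraph V) (p q : ℕ) (φ : V → Finset (Fin p)) :
    Prop :=
  (∀ v, (φ v).card = q) ∧ ∀ v : V, ∀ c : Fin p, ∃ u : V, (u = v ∨ G.Adj u v) ∧ c ∈ φ u

/-- The graph obtained from `K_n` by replacing each edge `{a, b}` (with `a < b`) by a
hammock: a path `a – z – b` of length 2 and a path `a – x – y – b` of length 3, where the
internal vertices `z, x, y` (encoded as the pair together with an index in `Fin 3`: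
`0 ↦ z`, `1 ↦ x`, `2 ↦ y`) are new and pairwise distinct across different edges. -/
def KnHammock (n : ℕ) :
    SimpleGraph (Fin n ⊕ ({p : Fin n × Fin n // p.1 < p.2} × Fin 3)) :=
  SimpleGraph.fromRel (fun s t =>
    match s, t with
    | .inl a, .inr (e, j) =>
        (j = 0 ∧ (a = e.1.1 ∨ a = e.1.2)) ∨ (j = 1 ∧ a = e.1.1) ∨ (j = 2 ∧ a = e.1.2)
    | .inr (e, j), .inr (e', j') => e = e' ∧ j = 1 ∧ j' = 2
    | _, _ => False)

/-- A family of dominating sets indexed by a finite probability space yields a distribution on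
dominating sets by pushforward. -/
theorem isDomDistribution_of_family {V ι : Type*} [Fintype V] [DecidableEq V] [Fintype ι]
    {G : SimpleGraph V} {p : ℝ} (μ : ι → ℝ) (D : ι → Finset V) (hμ : ∀ i, 0 ≤ μ i)
    (hsum : ∑ i, μ i = 1) (hdom : ∀ i, IsDominatingSet G (D i))
    (hp : ∀ v, ∑ i with v ∈ D i, μ i ≤ p) :
    IsDomDistribution G (fun X => ∑ i with D i = X, μ i) p := by
  refine ⟨fun X => Finset.sum_nonneg fun i _ => hμ i, ?_, ?_, ?_⟩
  · rw [← hsum]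
    exact Finset.sum_fiberwise _ _ _
  · intro X hX
    obtain ⟨i, hi, -⟩ := Finset.exists_ne_zero_of_sum_ne_zero hX
    rw [Finset.mem_filter] at hi
    exact hi.2 ▸ hdom i
  · intro v
    refine le_of_eq_of_le ?_ (hp v)
    simp only [Finset.sum_filter]
    rw [← Finset.sum_fiberwise _ D (fun i => if v ∈ D i then μ i else 0)]
    refine Finset.sum_congr rfl fun X _ => ?_
    rw [Finset.sum_filter]
    by_cases hv : v ∈ X
    · rw [if_pos hv]
      refine Finset.sum_congr rfl fun i _ => ?_
      by_cases h : D i = X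
      · simp [h, hv]
      · simp [h]
    · rw [if_neg hv]
      refine (Finset.sum_eq_zero fun i _ => ?_).symm
      by_cases h : D i = X
      · simp [h, hv]
      · simp [h]

/-- Fisher inequality: equal-sized sets with pairwise intersections of constant smaller size are at
most as many as the points of the ground set. -/
theorem card_le_of_inter_card_eq {ι α : Type*} [Fintype ι] [Fintype α] [DecidableEq α]
    {k l : ℕ} (hkl : l < k) (A : ι → Finset α) (hcard : ∀ i, (A i).card = k)
    (hinter : ∀ i j, i ≠ j → (A i ∩ A j).card = l) : Fintype.card ι ≤ Fintype.card α := by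
  have hli : LinearIndependent ℝ (fun i (c : α) => if c ∈ A i then (1 : ℝ) else 0) := by
    rw [Fintype.linearIndependent_iff]
    intro g hg
    have hzero : ∀ c, ∑ i, g i * (if c ∈ A i then (1 : ℝ) else 0) = 0 := by
      intro c
      simpa [Finset.sum_apply] using congrFun hg c
    have hgram : ∀ i j, ∑ c, (if c ∈ A i then (1 : ℝ) else 0) * (if c ∈ A j then 1 else 0)
        = l + if i = j then (k - l : ℝ) else 0 := by
      intro i j
      have : ∑ c, (if c ∈ A i then (1 : ℝ) else 0) * (if c ∈ A j then 1 else 0)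
          = (A i ∩ A j).card := by
        rw [Finset.card_eq_sum_ones, ← Finset.filter_mem_eq_inter]
        simp only [← ite_and, mul_ite, mul_one, mul_zero]
        rw [← Finset.sum_filter, ← Finset.card_eq_sum_ones, Finset.sum_const, nsmul_one]
        congr 2
        ext c
        simp [and_comm]
      rw [this]
      by_cases h : i = j
      · subst h
        simp [hcard]
      · simp [h, hinter i j h]
    have hsq : (l : ℝ) * (∑ i, g i) ^ 2 + (k - l) * ∑ i, g i ^ 2 = 0 := by
      have h1 : ∑ c, (∑ i, g i * (if c ∈ A i then (1 : ℝ) else 0)) *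
          (∑ j, g j * (if c ∈ A j then (1 : ℝ) else 0)) = 0 :=
        Finset.sum_eq_zero fun c _ => by rw [hzero, zero_mul]
      rw [← h1]
      simp only [Finset.sum_mul_sum]
      rw [Finset.sum_comm]
      simp_rw [Finset.sum_comm (s := (Finset.univ : Finset α))]
      have h2 : ∀ i j, ∑ c, g i * (if c ∈ A i then (1 : ℝ) else 0) *
          (g j * (if c ∈ A j then (1 : ℝ) else 0))
          = g i * g j * l + if i = j then (k - l) * (g i * g j) else 0 := by
        intro i j
        calc _ = g i * g j * ∑ c, (if c ∈ A i then (1 : ℝ) else 0) *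
              (if c ∈ A j then 1 else 0) := by
              rw [Finset.mul_sum]
              exact Finset.sum_congr rfl fun c _ => by ring
          _ = _ := by
              rw [hgram]
              split_ifs <;> ring
      simp_rw [h2, Finset.sum_add_distrib]
      simp only [Finset.sum_ite_eq, Finset.mem_univ, if_true, ← Finset.sum_mul,
        ← Finset.mul_sum, ← pow_two]
      ring
    have hkl' : (0 : ℝ) < k - l := sub_pos.2 (by exact_mod_cast hkl)
    have hg2 : ∑ i, g i ^ 2 = 0 := by
      have h1 : 0 ≤ (l : ℝ) * (∑ i, g i) ^ 2 := by positivity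
      have h2 : 0 ≤ ∑ i, g i ^ 2 := by positivity
      nlinarith [mul_nonneg hkl'.le h2]
    intro i
    rw [Finset.sum_eq_zero_iff_of_nonneg fun i _ => sq_nonneg _] at hg2
    simpa using hg2 i (Finset.mem_univ i)
  simpa using hli.fintype_card_le_finrank

section SubsetCounts

variable {α : Type*} [Fintype α]

theorem card_filter_mem_finset (a : α) [DecidablePred fun S : Finset α => a ∈ S] :
    (#{S : Finset α | a ∈ S} : ℝ) / 2 ^ Fintype.card α = 1 / 2 := by
  have h : ({S : Finset α | a ∈ S} : Finset (Finset α)) = Finset.Icc {a} univ := by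
    ext S
    simp
  rw [h, Finset.card_Icc_finset (by simp)]
  have hc : 0 < Fintype.card α := Fintype.card_pos_iff.2 ⟨a⟩
  obtain ⟨m, hm⟩ := Nat.exists_eq_add_of_lt hc
  simp [hm, pow_succ]
  field_simp

theorem card_filter_notMem_finset (a : α) [DecidablePred fun S : Finset α => a ∉ S] :
    (#{S : Finset α | a ∉ S} : ℝ) / 2 ^ Fintype.card α = 1 / 2 := by
  have h : ({S : Finset α | a ∉ S} : Finset (Finset α)) = Finset.Icc ∅ {a}ᶜ := by
    ext S
    simp [Finset.subset_compl_iff_disjoint_right]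
  rw [h, Finset.card_Icc_finset (by simp), Finset.card_compl]
  have hc : 0 < Fintype.card α := Fintype.card_pos_iff.2 ⟨a⟩
  obtain ⟨m, hm⟩ := Nat.exists_eq_add_of_lt hc
  simp [hm, pow_succ]
  field_simp

theorem card_filter_mem_notMem_finset {a b : α} (hab : a ≠ b)
    [DecidablePred fun S : Finset α => a ∈ S ∧ b ∉ S] :
    (#{S : Finset α | a ∈ S ∧ b ∉ S} : ℝ) / 2 ^ Fintype.card α = 1 / 4 := by
  have h : ({S : Finset α | a ∈ S ∧ b ∉ S} : Finset (Finset α)) = Finset.Icc {a} {b}ᶜ := by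
    ext S
    simp [Finset.subset_compl_iff_disjoint_right]
  rw [h, Finset.card_Icc_finset (by simpa using hab.symm), Finset.card_compl]
  have hc : 1 < Fintype.card α := Fintype.one_lt_card_iff.2 ⟨a, b, hab⟩
  obtain ⟨m, hm⟩ := Nat.exists_eq_add_of_lt hc
  have hm2 : Fintype.card α = m + 2 := by omega
  simp [hm2, pow_succ]
  field_simp
  norm_num

theorem card_filter_notMem_notMem_finset {a b : α} (hab : a ≠ b)
    [DecidablePred fun S : Finset α => a ∉ S ∧ b ∉ S] :
    (#{S : Finset α | a ∉ S ∧ b ∉ S} : ℝ) / 2 ^ Fintype.card α = 1 / 4 := by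
  have h : ({S : Finset α | a ∉ S ∧ b ∉ S} : Finset (Finset α)) = Finset.Icc ∅ {a, b}ᶜ := by
    ext S
    simp [-Finset.compl_insert, Finset.subset_compl_iff_disjoint_right]
  rw [h, Finset.card_Icc_finset (by simp), Finset.card_compl, Finset.card_pair hab]
  have hc : 1 < Fintype.card α := Fintype.one_lt_card_iff.2 ⟨a, b, hab⟩
  obtain ⟨m, hm⟩ := Nat.exists_eq_add_of_lt hc
  have hm2 : Fintype.card α = m + 2 := by omega
  simp [hm2, pow_succ]
  field_simp
  norm_num

end SubsetCounts

namespace KnHammock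

variable {n : ℕ}

theorem adj_zero {e : {p : Fin n × Fin n // p.1 < p.2}}
    {u : Fin n ⊕ ({p : Fin n × Fin n // p.1 < p.2} × Fin 3)} :
    (KnHammock n).Adj u (.inr (e, 0)) ↔ u = .inl e.1.1 ∨ u = .inl e.1.2 := by
  rcases u with a | ⟨e', j⟩ <;> simp [KnHammock, SimpleGraph.fromRel_adj]

theorem adj_one {e : {p : Fin n × Fin n // p.1 < p.2}}
    {u : Fin n ⊕ ({p : Fin n × Fin n // p.1 < p.2} × Fin 3)} :
    (KnHammock n).Adj u (.inr (e, 1)) ↔ u = .inl e.1.1 ∨ u = .inr (e, 2) := by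
  rcases u with a | ⟨e', j⟩ <;> simp [KnHammock, SimpleGraph.fromRel_adj]
  grind

theorem adj_two {e : {p : Fin n × Fin n // p.1 < p.2}}
    {u : Fin n ⊕ ({p : Fin n × Fin n // p.1 < p.2} × Fin 3)} :
    (KnHammock n).Adj u (.inr (e, 2)) ↔ u = .inl e.1.2 ∨ u = .inr (e, 1) := by
  rcases u with a | ⟨e', j⟩ <;> simp [KnHammock, SimpleGraph.fromRel_adj]
  grind

/-- What it means for `D` to dominate the three internal vertices of a hammock. -/
theorem mem_of_isDominatingSet
    {D : Finset (Fin n ⊕ ({p : Fin n × Fin n // p.1 < p.2} × Fin 3))}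
    (hD : IsDominatingSet (KnHammock n) D) (e : {p : Fin n × Fin n // p.1 < p.2}) :
    (.inr (e, 0) ∈ D ∨ .inl e.1.1 ∈ D ∨ .inl e.1.2 ∈ D) ∧
    (.inr (e, 1) ∈ D ∨ .inl e.1.1 ∈ D ∨ .inr (e, 2) ∈ D) ∧
    (.inr (e, 2) ∈ D ∨ .inl e.1.2 ∈ D ∨ .inr (e, 1) ∈ D) := by
  have h0 := hD (.inr (e, 0))
  have h1 := hD (.inr (e, 1))
  have h2 := hD (.inr (e, 2))
  simp only [adj_zero, adj_one, adj_two] at h0 h1 h2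
  grind

theorem isDominatingSet_of_mem (hn : 2 ≤ n)
    {D : Finset (Fin n ⊕ ({p : Fin n × Fin n // p.1 < p.2} × Fin 3))}
    (hhub : ∀ e : {p : Fin n × Fin n // p.1 < p.2},
      (.inl e.1.1 ∈ D ∨ .inr (e, 0) ∈ D ∨ .inr (e, 1) ∈ D) ∧
      (.inl e.1.2 ∈ D ∨ .inr (e, 0) ∈ D ∨ .inr (e, 2) ∈ D))
    (hinner : ∀ e : {p : Fin n × Fin n // p.1 < p.2},
      (.inr (e, 0) ∈ D ∨ .inl e.1.1 ∈ D ∨ .inl e.1.2 ∈ D) ∧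
      (.inr (e, 1) ∈ D ∨ .inl e.1.1 ∈ D ∨ .inr (e, 2) ∈ D) ∧
      (.inr (e, 2) ∈ D ∨ .inl e.1.2 ∈ D ∨ .inr (e, 1) ∈ D)) :
    IsDominatingSet (KnHammock n) D := by
  rintro (a | ⟨e, j⟩)
  · have : Nontrivial (Fin n) := Fin.nontrivial_iff_two_le.2 hn
    obtain ⟨b, hb⟩ := exists_ne a
    rcases lt_or_gt_of_ne hb with h | h
    · obtain hm | hm | hm := (hhub ⟨(b, a), h⟩).2
      · exact ⟨_, hm, .inl rfl⟩
      · exact ⟨_, hm, .inr (adj_zero.2 (.inr rfl)).symm⟩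
      · exact ⟨_, hm, .inr (adj_two.2 (.inl rfl)).symm⟩
    · obtain hm | hm | hm := (hhub ⟨(a, b), h⟩).1
      · exact ⟨_, hm, .inl rfl⟩
      · exact ⟨_, hm, .inr (adj_zero.2 (.inl rfl)).symm⟩
      · exact ⟨_, hm, .inr (adj_one.2 (.inl rfl)).symm⟩
  · obtain ⟨h0, h1, h2⟩ := hinner e
    fin_cases j
    · simp only [Fin.zero_eta, adj_zero]
      grind
    · simp only [Fin.mk_one, adj_one]
      grind
    · simp only [Fin.reduceFinMk, adj_two]
      grind

/-- The number of vertices of the hammock cycle at `e` contained in `D`. -/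
noncomputable def cycleCount
    (D : Finset (Fin n ⊕ ({p : Fin n × Fin n // p.1 < p.2} × Fin 3)))
    (e : {p : Fin n × Fin n // p.1 < p.2}) : ℕ :=
  (if .inl e.1.1 ∈ D then 1 else 0) + (if .inl e.1.2 ∈ D then 1 else 0) +
    (if .inr (e, 0) ∈ D then 1 else 0) + (if .inr (e, 1) ∈ D then 1 else 0) +
    (if .inr (e, 2) ∈ D then 1 else 0)

theorem two_le_cycleCount
    {D : Finset (Fin n ⊕ ({p : Fin n × Fin n // p.1 < p.2} × Fin 3))}
    (hD : IsDominatingSet (KnHammock n) D) (e : {p : Fin n × Fin n // p.1 < p.2}) :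
    2 ≤ cycleCount D e := by
  have := mem_of_isDominatingSet hD e
  unfold cycleCount
  grind

theorem mem_zero_iff_of_cycleCount_eq_two
    {D : Finset (Fin n ⊕ ({p : Fin n × Fin n // p.1 < p.2} × Fin 3))}
    (hD : IsDominatingSet (KnHammock n) D) {e : {p : Fin n × Fin n // p.1 < p.2}}
    (h : cycleCount D e = 2) :
    .inr (e, 0) ∈ D ↔ .inl e.1.1 ∉ D ∧ .inl e.1.2 ∉ D := by
  have := mem_of_isDominatingSet hD e
  unfold cycleCount at h
  grind

theorem two_fifths_le {w : Finset (Fin n ⊕ ({p : Fin n × Fin n // p.1 < p.2} × Fin 3)) → ℝ}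
    {p : ℝ} (hw : IsDomDistribution (KnHammock n) w p)
    (e : {p : Fin n × Fin n // p.1 < p.2}) : 2 / 5 ≤ p := by
  obtain ⟨hnonneg, hsum, hdom, hp⟩ := hw
  have hlow : ∑ D, w D * 2 ≤ ∑ D, w D * (cycleCount D e : ℝ) := by
    refine Finset.sum_le_sum fun D _ => ?_
    by_cases h : w D = 0
    · simp [h]
    · exact mul_le_mul_of_nonneg_left
        (by exact_mod_cast two_le_cycleCount (hdom D h) e) (hnonneg D)
  have hexp : ∑ D, w D * (cycleCount D e : ℝ) =
      ∑ D with .inl e.1.1 ∈ D, w D + ∑ D with .inl e.1.2 ∈ D, w D +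
      ∑ D with .inr (e, 0) ∈ D, w D + ∑ D with .inr (e, 1) ∈ D, w D +
      ∑ D with .inr (e, 2) ∈ D, w D := by
    simp only [cycleCount, Finset.sum_filter, ← Finset.sum_add_distrib]
    refine Finset.sum_congr rfl fun D _ => ?_
    push_cast
    simp only [mul_add, mul_ite, mul_one, mul_zero]
  rw [← Finset.sum_mul, hsum, hexp] at hlow
  linarith [hp (.inl e.1.1), hp (.inl e.1.2), hp (.inr (e, 0)), hp (.inr (e, 1)),
    hp (.inr (e, 2))]

/-- The dominating set with hub set `S`; `t` decides which of the two inner vertices of the long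
path is used in hammocks without a selected hub. -/
noncomputable def domSet (S : Finset (Fin n)) (t : Bool) :
    Finset (Fin n ⊕ ({p : Fin n × Fin n // p.1 < p.2} × Fin 3)) :=
  {v | match v with
    | .inl a => a ∈ S
    | .inr (e, j) => (j = 0 ∧ e.1.1 ∉ S ∧ e.1.2 ∉ S) ∨
        (j = 1 ∧ e.1.1 ∉ S ∧ (e.1.2 ∈ S ∨ t = true)) ∨
        (j = 2 ∧ e.1.2 ∉ S ∧ (e.1.1 ∈ S ∨ t = false))}

theorem inl_mem_domSet {S : Finset (Fin n)} {t : Bool} {a : Fin n} :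
    .inl a ∈ domSet S t ↔ a ∈ S := by
  simp [domSet]

theorem zero_mem_domSet {S : Finset (Fin n)} {t : Bool}
    {e : {p : Fin n × Fin n // p.1 < p.2}} :
    .inr (e, 0) ∈ domSet S t ↔ e.1.1 ∉ S ∧ e.1.2 ∉ S := by
  simp [domSet]

theorem one_mem_domSet {S : Finset (Fin n)} {t : Bool}
    {e : {p : Fin n × Fin n // p.1 < p.2}} :
    .inr (e, 1) ∈ domSet S t ↔ e.1.1 ∉ S ∧ (e.1.2 ∈ S ∨ t = true) := by
  simp [domSet]

theorem two_mem_domSet {S : Finset (Fin n)} {t : Bool}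
    {e : {p : Fin n × Fin n // p.1 < p.2}} :
    .inr (e, 2) ∈ domSet S t ↔ e.1.2 ∉ S ∧ (e.1.1 ∈ S ∨ t = false) := by
  simp [domSet]

theorem isDominatingSet_domSet (hn : 2 ≤ n) (S : Finset (Fin n)) (t : Bool) :
    IsDominatingSet (KnHammock n) (domSet S t) := by
  apply isDominatingSet_of_mem hn <;> intro e <;>
    simp only [inl_mem_domSet, zero_mem_domSet, one_mem_domSet, two_mem_domSet] <;>
    cases t <;> grind

/-- Half the law of the random hub set, which is empty with probability `1 / 5` and uniform
otherwise. -/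
noncomputable def hubWeight (S : Finset (Fin n)) : ℝ :=
  (if S = ∅ then 1 / 10 else 0) + 2 / 5 / 2 ^ n

theorem sum_hubWeight (P : Finset (Fin n) → Prop) [DecidablePred P] :
    ∑ S with P S, hubWeight S =
      (if P ∅ then 1 / 10 else 0) + 2 / 5 * ((#{S | P S} : ℝ) / 2 ^ Fintype.card (Fin n)) := by
  simp only [hubWeight, Finset.sum_add_distrib, Finset.sum_const, Finset.sum_ite_eq',
    Finset.mem_filter, Finset.mem_univ, true_and, nsmul_eq_mul, Fintype.card_fin]
  ring

theorem sum_hubWeight_mem_domSet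
    (v : Fin n ⊕ ({p : Fin n × Fin n // p.1 < p.2} × Fin 3)) :
    ∑ i : Finset (Fin n) × Bool with v ∈ domSet i.1 i.2, hubWeight i.1 = 2 / 5 := by
  have hsplit : ∑ i : Finset (Fin n) × Bool with v ∈ domSet i.1 i.2, hubWeight i.1 =
      ∑ S with v ∈ domSet S true, hubWeight S + ∑ S with v ∈ domSet S false, hubWeight S := by
    simp only [Finset.sum_filter, Fintype.sum_prod_type, Fintype.sum_bool,
      Finset.sum_add_distrib]
  rw [hsplit, sum_hubWeight, sum_hubWeight]
  rcases v with a | ⟨e, j⟩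
  · simp only [inl_mem_domSet, card_filter_mem_finset]
    norm_num
  · have hne : e.1.1 ≠ e.1.2 := e.2.ne
    fin_cases j
    · simp only [Fin.zero_eta, zero_mem_domSet, card_filter_notMem_notMem_finset hne]
      norm_num
    · simp only [Fin.mk_one, one_mem_domSet, or_true, true_and, or_false, Bool.false_eq_true,
        and_comm (a := e.1.1 ∉ _), card_filter_notMem_finset,
        card_filter_mem_notMem_finset hne.symm]
      norm_num
    · simp only [Fin.reduceFinMk, two_mem_domSet, or_true, true_and, or_false,
        Bool.true_eq_false, and_comm (a := e.1.2 ∉ _), card_filter_notMem_finset,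
        card_filter_mem_notMem_finset hne]
      norm_num

theorem exists_isDomDistribution (hn : 2 ≤ n) :
    ∃ w, IsDomDistribution (KnHammock n) w (2 / 5) := by
  refine ⟨_, isDomDistribution_of_family (fun i : Finset (Fin n) × Bool => hubWeight i.1)
    (fun i => domSet i.1 i.2) (fun i => ?_) ?_ (fun i => isDominatingSet_domSet hn i.1 i.2)
    (fun v => ?_)⟩
  · unfold hubWeight
    positivity
  · have h := sum_hubWeight (n := n) (fun _ => True)
    simp only [Finset.filter_true, if_true, Finset.card_univ, Fintype.card_finset] at h
    simp only [Fintype.sum_prod_type, Fintype.sum_bool, Finset.sum_add_distrib, h]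
    push_cast
    rw [div_self (by positivity)]
    norm_num
  · exact (sum_hubWeight_mem_domSet v).le

theorem fdom_eq (hn : 2 ≤ n) : fdom (KnHammock n) = 5 / 2 := by
  refine IsGreatest.csSup_eq ⟨⟨2 / 5, by norm_num, by norm_num, by norm_num,
    exists_isDomDistribution hn⟩, ?_⟩
  rintro x ⟨p, hp, -, rfl, w, hw⟩
  have h := two_fifths_le hw ⟨(⟨0, by omega⟩, ⟨1, by omega⟩), by simp [Fin.lt_def]⟩
  rw [div_le_iff₀ hp]
  linarith

theorem card_inter_eq {k : ℕ}
    {φ : (Fin n ⊕ ({p : Fin n × Fin n // p.1 < p.2} × Fin 3)) → Finset (Fin (5 * k))}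
    (hφ : IsDomPQColouring (KnHammock n) (5 * k) (2 * k) φ)
    (e : {p : Fin n × Fin n // p.1 < p.2}) :
    (φ (.inl e.1.1) ∩ φ (.inl e.1.2)).card = k := by
  obtain ⟨hcard, hcov⟩ := hφ
  let D : Fin (5 * k) → Finset (Fin n ⊕ ({p : Fin n × Fin n // p.1 < p.2} × Fin 3)) :=
    fun c => {v | c ∈ φ v}
  have hmem : ∀ c v, v ∈ D c ↔ c ∈ φ v := fun c v => by simp [D]
  have hdom : ∀ c, IsDominatingSet (KnHammock n) (D c) := by
    intro c v
    obtain ⟨u, hu, hc⟩ := hcov v c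
    exact ⟨u, (hmem c u).2 hc, hu⟩
  have hind : ∀ v, ∑ c, (if c ∈ φ v then 1 else 0) = 2 * k := by
    intro v
    rw [← hcard v]
    simp
  have hsum : ∑ c, cycleCount (D c) e = ∑ _c : Fin (5 * k), 2 := by
    simp only [cycleCount, hmem, Finset.sum_add_distrib, hind]
    simp
    ring
  have htwo : ∀ c, cycleCount (D c) e = 2 := fun c =>
    (((Finset.sum_eq_sum_iff_of_le fun c _ => two_le_cycleCount (hdom c) e).1 hsum.symm) c
      (Finset.mem_univ c)).symm
  have hz : φ (.inr (e, 0)) = (φ (.inl e.1.1) ∪ φ (.inl e.1.2))ᶜ := by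
    ext c
    simpa [hmem] using mem_zero_iff_of_cycleCount_eq_two (hdom c) (htwo c)
  have h1 := Finset.card_union_add_card_inter (φ (.inl e.1.1)) (φ (.inl e.1.2))
  have h2 := Finset.card_add_card_compl (φ (.inl e.1.1) ∪ φ (.inl e.1.2))
  rw [← hz, Fintype.card_fin] at h2
  rw [hcard] at h2
  rw [hcard, hcard] at h1
  omega

end KnHammock

/-- For `n ≥ 2`, the graph obtained from `K_n` by replacing every edge by a hammock has
fractional domatic number exactly `5/2`, and every dominating `(5k : 2k)`-colouring of it
satisfies `k ≥ n/5`. -/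
theorem fdom_KnHammock (n : ℕ) (hn : 2 ≤ n) :
    fdom (KnHammock n) = 5 / 2 ∧
      ∀ k : ℕ, 1 ≤ k →
        ∀ φ : (Fin n ⊕ ({p : Fin n × Fin n // p.1 < p.2} × Fin 3)) → Finset (Fin (5 * k)),
          IsDomPQColouring (KnHammock n) (5 * k) (2 * k) φ → n ≤ 5 * k := by
  refine ⟨KnHammock.fdom_eq hn, fun k hk φ hφ => ?_⟩
  have h := card_le_of_inter_card_eq (by omega : k < 2 * k) (fun a : Fin n => φ (.inl a))
    (fun a => hφ.1 _) (fun a b hab => ?_)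
  · simpa using h
  · rcases lt_or_gt_of_ne hab with h | h
    · exact KnHammock.card_inter_eq hφ ⟨(a, b), h⟩
    · rw [Finset.inter_comm]
      exact KnHammock.card_inter_eq hφ ⟨(b, a), h⟩
end
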